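/- Let S ⊆ TT_n. Then {A ∈ (M_n(ℝ))^g : s(A) = 0 for all s ∈ S} = ∅ if and only if −1 = ω + Σ_i tr(h_i s_i) for some ω ∈ Ω_n and finitely many h_i ∈ TT_n, s_i ∈ S (an identity in C_n ⊆ ℝ[ξ]). -/

import Mathlib

noncomputable section

open Matrix

/-- The polynomial ring ℝ[ξ] in the g·n² commuting variables ξ_{jıȷ}. -/
abbrev PolyRing (n g : ℕ) : Type := MvPolynomial (Fin g × Fin n × Fin n) ℝ

/-- n×n matrices over ℝ[ξ]. -/
abbrev MatP (n g : ℕ) : Type := Matrix (Fin n) (Fin n) (PolyRing n g)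

/-- The generic matrices Ξ_j = (ξ_{jıȷ})_{ıȷ}. -/
def genMat (n g : ℕ) (j : Fin g) : MatP n g :=
  Matrix.of fun a b => MvPolynomial.X (j, a, b)

/-- The set of generic matrices together with their transposes. -/
def genSet (n g : ℕ) : Set (MatP n g) :=
  Set.range (genMat n g) ∪ Set.range (fun j => (genMat n g j)ᵀ)

/-- The trace ring TT_n: the ℝ-subalgebra of M_n(ℝ[ξ]) generated by the Ξ_j, their
transposes, and the scalar matrices tr(w)·1 for all products w of the Ξ_j, Ξ_jᵀ. -/
def traceRing (n g : ℕ) : Subalgebra ℝ (MatP n g) :=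
  Algebra.adjoin ℝ
    (genSet n g ∪
      {m | ∃ w ∈ Submonoid.closure (genSet n g), m = (Matrix.trace w) • (1 : MatP n g)})

/-- The center C_n of the trace ring: the scalar matrices in TT_n. -/
def centerSet (n g : ℕ) : Set (MatP n g) :=
  {c | c ∈ traceRing n g ∧ ∃ p : PolyRing n g, c = p • (1 : MatP n g)}

/-- Evaluation of a matrix of polynomials at a g-tuple X of n×n real matrices. -/
def evalMat (n g : ℕ) (X : Fin g → Matrix (Fin n) (Fin n) ℝ) (h : MatP n g) :
    Matrix (Fin n) (Fin n) ℝ :=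
  h.map (MvPolynomial.eval fun v => X v.1 v.2.1 v.2.2)

/-- The semialgebraic set K_S determined by S. -/
def KSet (n g : ℕ) (S : Set (MatP n g)) : Set (Fin g → Matrix (Fin n) (Fin n) ℝ) :=
  {X | ∀ s ∈ S, (evalMat n g X s).PosSemidef}

/-- Cyclic quadratic module in Sym TT_n. -/
def IsCyclicQM (n g : ℕ) (Q : Set (MatP n g)) : Prop :=
  (∀ q ∈ Q, q ∈ traceRing n g ∧ qᵀ = q) ∧
  (1 : MatP n g) ∈ Q ∧
  (∀ a ∈ Q, ∀ b ∈ Q, a + b ∈ Q) ∧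
  (∀ h ∈ traceRing n g, ∀ q ∈ Q, h * q * hᵀ ∈ Q) ∧
  (∀ q ∈ Q, (Matrix.trace q) • (1 : MatP n g) ∈ Q)

/-- Cyclic preordering: a cyclic quadratic module whose intersection with the center
is closed under multiplication. -/
def IsCyclicPreordering (n g : ℕ) (T : Set (MatP n g)) : Prop :=
  IsCyclicQM n g T ∧
  ∀ a ∈ T ∩ centerSet n g, ∀ b ∈ T ∩ centerSet n g, a * b ∈ T

/-- The smallest cyclic preordering T_S^tr containing S. -/
def TtrS (n g : ℕ) (S : Set (MatP n g)) : Set (MatP n g) :=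
  {a | ∀ T : Set (MatP n g), IsCyclicPreordering n g T → S ⊆ T → a ∈ T}

/-- Ω_n: finite sums of finite products of elements tr(hhᵀ)·1 with h ∈ TT_n. -/
def OmegaSet (n g : ℕ) : Set (MatP n g) :=
  (AddSubmonoid.closure
    ((Submonoid.closure
        {c : MatP n g | ∃ h ∈ traceRing n g,
          c = (Matrix.trace (h * hᵀ)) • (1 : MatP n g)} : Submonoid (MatP n g)) :
      Set (MatP n g)) : AddSubmonoid (MatP n g))

section

open Polynomial

/-- The intermediate value property for polynomials over an ordered field. -/
def PolyIVT (R : Type) [Field R] [LinearOrder R] : Prop :=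
  ∀ (p : R[X]) (a b : R), a ≤ b → p.eval a ≤ 0 → 0 ≤ p.eval b →
    ∃ c, a ≤ c ∧ c ≤ b ∧ p.eval c = 0

theorem polyIVT_real : PolyIVT ℝ := by
  intro p a b hab ha hb
  obtain ⟨c, hc, h⟩ := intermediate_value_Icc hab (f := fun x => p.eval x)
    p.continuous.continuousOn (Set.mem_Icc.2 ⟨ha, hb⟩)
  exact ⟨c, hc.1, hc.2, h⟩

namespace PolyIVT

variable {R : Type} [Field R] [LinearOrder R] [IsStrictOrderedRing R]

theorem exists_root_of_mul_nonpos (hR : PolyIVT R) (p : R[X]) {a b : R} (hab : a ≤ b)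
    (h : p.eval a * p.eval b ≤ 0) : ∃ c, a ≤ c ∧ c ≤ b ∧ p.eval c = 0 := by
  rcases mul_nonpos_iff.1 h with ⟨h1, h2⟩ | ⟨h1, h2⟩
  · obtain ⟨c, h3, h4, h5⟩ := hR (-p) a b hab (by simpa using h1) (by simpa using h2)
    exact ⟨c, h3, h4, by simpa using h5⟩
  · exact hR p a b hab h1 h2

theorem exists_sqrt (hR : PolyIVT R) {a : R} (ha : 0 ≤ a) : ∃ b, 0 ≤ b ∧ b * b = a := by
  obtain ⟨c, h1, -, h3⟩ := hR (X ^ 2 - C a) 0 (1 + a) (by linarith) (by simpa using ha)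
    (by simp; nlinarith)
  exact ⟨c, h1, by simp at h3; nlinarith⟩

theorem rolle_aux (hR : PolyIVT R) (p : R[X]) (hp : p ≠ 0) {a b : R} (hab : a < b)
    (ha : p.eval a = 0) (hb : p.eval b = 0) (hne : ∀ c, a < c → c < b → p.eval c ≠ 0) :
    ∃ c, a < c ∧ c < b ∧ p.derivative.eval c = 0 := by
  obtain ⟨q, hq, hqa⟩ := exists_eq_pow_rootMultiplicity_mul_and_not_dvd p hp a
  have hq0 : q ≠ 0 := by rintro rfl; simp at hqa
  obtain ⟨g, hg, hgb⟩ := exists_eq_pow_rootMultiplicity_mul_and_not_dvd q hq0 b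
  have hm : 0 < rootMultiplicity a p := (rootMultiplicity_pos hp).2 ha
  have hk : 0 < rootMultiplicity b q := by
    refine (rootMultiplicity_pos hq0).2 ?_
    rw [hq] at hb
    simp only [eval_mul, eval_pow, eval_sub, eval_X, eval_C, mul_eq_zero] at hb
    rcases hb with hb | hb
    · exact absurd (pow_eq_zero_iff hm.ne' |>.1 hb) (sub_ne_zero.2 hab.ne')
    · exact hb
  obtain ⟨m, hm'⟩ : ∃ m, rootMultiplicity a p = m + 1 := ⟨_, (Nat.succ_pred_eq_of_pos hm).symm⟩
  obtain ⟨k, hk'⟩ : ∃ k, rootMultiplicity b q = k + 1 := ⟨_, (Nat.succ_pred_eq_of_pos hk).symm⟩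
  rw [hm'] at hq
  rw [hk'] at hg
  have hga : g.eval a ≠ 0 := by
    intro h
    apply hqa
    rw [hg]
    exact Dvd.dvd.mul_left (dvd_iff_isRoot.2 h) _
  have hgb' : g.eval b ≠ 0 := fun h => hgb (dvd_iff_isRoot.2 h)
  have hpg : p = (X - C a) ^ (m + 1) * (X - C b) ^ (k + 1) * g := by
    rw [hq, hg]; ring
  have hgsign : 0 < g.eval a * g.eval b := by
    by_contra hcon
    obtain ⟨c, h1, h2, h3⟩ := hR.exists_root_of_mul_nonpos g hab.le (not_lt.1 hcon)
    have h1' : a < c := lt_of_le_of_ne h1 (by rintro rfl; exact hga h3)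
    have h2' : c < b := lt_of_le_of_ne h2 (by rintro rfl; exact hgb' h3)
    exact hne c h1' h2' (by rw [hpg]; simp [h3])
  let h : R[X] := C ((m + 1 : ℕ) : R) * (X - C b) * g + C ((k + 1 : ℕ) : R) * (X - C a) * g
    + (X - C a) * (X - C b) * derivative g
  have hder : derivative p = (X - C a) ^ m * (X - C b) ^ k * h := by
    rw [hpg]
    simp only [derivative_mul, derivative_X_sub_C_pow, h]
    simp only [Nat.add_sub_cancel, map_natCast]
    ring
  have hha : h.eval a = -((m + 1 : ℕ) : R) * (b - a) * g.eval a := by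
    simp only [h, eval_add, eval_mul, eval_sub, eval_C, eval_X]; ring
  have hhb : h.eval b = ((k + 1 : ℕ) : R) * (b - a) * g.eval b := by
    simp [h]
  have hm0 : (0 : R) < ((m + 1 : ℕ) : R) := by positivity
  have hk0 : (0 : R) < ((k + 1 : ℕ) : R) := by positivity
  have hba : 0 < b - a := sub_pos.2 hab
  obtain ⟨c, h1, h2, h3⟩ := hR.exists_root_of_mul_nonpos h hab.le (by
    rw [hha, hhb]
    have : 0 < ((m + 1 : ℕ) : R) * (b - a) * (((k + 1 : ℕ) : R) * (b - a))
      * (g.eval a * g.eval b) := by positivity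
    linarith)
  refine ⟨c, lt_of_le_of_ne h1 ?_, lt_of_le_of_ne h2 ?_, by rw [hder]; simp [h3]⟩
  · rintro rfl
    rw [hha] at h3
    simp only [mul_eq_zero, neg_eq_zero] at h3
    rcases h3 with (h3 | h3) | h3
    · exact hm0.ne' h3
    · exact hba.ne' h3
    · exact hga h3
  · rintro rfl
    rw [hhb] at h3
    simp only [mul_eq_zero] at h3
    rcases h3 with (h3 | h3) | h3
    · exact hk0.ne' h3
    · exact hba.ne' h3
    · exact hgb' h3

theorem rolle (hR : PolyIVT R) (p : R[X]) {a b : R} (hab : a < b)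
    (ha : p.eval a = 0) (hb : p.eval b = 0) :
    ∃ c, a < c ∧ c < b ∧ p.derivative.eval c = 0 := by
  by_cases hp : p = 0
  · obtain ⟨c, h1, h2⟩ := exists_between hab
    exact ⟨c, h1, h2, by simp [hp]⟩
  classical
  let s := p.roots.toFinset.filter (fun c => a < c)
  have hmem : ∀ c, c ∈ s ↔ p.eval c = 0 ∧ a < c := by
    intro c; simp [s, hp]
  have hs : s.Nonempty := ⟨b, (hmem b).2 ⟨hb, hab⟩⟩
  obtain ⟨h1, h2⟩ := (hmem _).1 (s.min'_mem hs)
  have h3 : s.min' hs ≤ b := s.min'_le b ((hmem b).2 ⟨hb, hab⟩)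
  obtain ⟨c, h4, h5, h6⟩ := hR.rolle_aux p hp h2 ha h1 (by
    intro c hc1 hc2 hc3
    exact absurd (s.min'_le c ((hmem c).2 ⟨hc3, hc1⟩)) (not_le.2 hc2))
  exact ⟨c, h4, h5.trans_le h3, h6⟩

theorem exists_derivative_eq_slope (hR : PolyIVT R) (p : R[X]) {a b : R} (hab : a < b) :
    ∃ c, a < c ∧ c < b ∧ p.eval b - p.eval a = p.derivative.eval c * (b - a) := by
  have hba : b - a ≠ 0 := sub_ne_zero.2 hab.ne'
  obtain ⟨c, h1, h2, h3⟩ := hR.rolle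
    (p - C (p.eval a) - C ((p.eval b - p.eval a) / (b - a)) * (X - C a)) hab (by simp)
    (by simp [hba])
  refine ⟨c, h1, h2, ?_⟩
  simp at h3
  rw [sub_eq_zero.1 h3]
  field_simp

end PolyIVT

open Filter in
theorem Filter.Germ.polyIVT {I : Type} (φ : Ultrafilter I) {R : Type} [Field R] [LinearOrder R]
    [IsStrictOrderedRing R] (hR : PolyIVT R) : PolyIVT (Germ (φ : Filter I) R) := by
  intro p a b
  have hcoef : ∀ k : ℕ, ∃ f : I → R, (f : Germ (φ : Filter I) R) = p.coeff k :=
    fun k => Quotient.exists_rep _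
  choose f hf using hcoef
  let P : I → R[X] := fun i => ∑ k ∈ Finset.range (p.natDegree + 1), C (f k i) * X ^ k
  have hev : ∀ α : I → R, p.eval (α : Germ (φ : Filter I) R) =
      ((fun i => (P i).eval (α i) : I → R) : Germ (φ : Filter I) R) := by
    intro α
    rw [eval_eq_sum_range]
    simp only [P, eval_finsetSum, eval_mul, eval_C, eval_pow, eval_X]
    simp_rw [← hf]
    have := map_sum (Filter.Germ.coeRingHom (R := R) (φ : Filter I))
      (fun k => (fun i => f k i * α i ^ k)) (Finset.range (p.natDegree + 1))
    refine Eq.trans (Finset.sum_congr rfl fun k _ => ?_) (this.symm.trans ?_)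
    · rfl
    · refine congrArg (fun u : I → R => (u : Germ (φ : Filter I) R)) (funext fun i => ?_)
      simp
  refine Germ.inductionOn a fun α => Germ.inductionOn b fun β => ?_
  intro hab ha hb
  rw [hev] at ha hb
  have hab' : ∀ᶠ i in (φ : Filter I), α i ≤ β i := Germ.coe_le.1 hab
  have ha' : ∀ᶠ i in (φ : Filter I), (P i).eval (α i) ≤ 0 := Germ.coe_le.1 ha
  have hb' : ∀ᶠ i in (φ : Filter I), 0 ≤ (P i).eval (β i) := Germ.coe_le.1 hb
  have key : ∀ i, ∃ c, (α i ≤ β i → (P i).eval (α i) ≤ 0 → 0 ≤ (P i).eval (β i) →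
      α i ≤ c ∧ c ≤ β i ∧ (P i).eval c = 0) := by
    intro i
    by_cases h : α i ≤ β i ∧ (P i).eval (α i) ≤ 0 ∧ 0 ≤ (P i).eval (β i)
    · obtain ⟨c, hc⟩ := hR (P i) _ _ h.1 h.2.1 h.2.2
      exact ⟨c, fun _ _ _ => hc⟩
    · exact ⟨0, fun h1 h2 h3 => absurd ⟨h1, h2, h3⟩ h⟩
  choose c hc using key
  refine ⟨(c : Germ (φ : Filter I) R), Germ.coe_le.2 ?_, Germ.coe_le.2 ?_, ?_⟩
  · filter_upwards [hab', ha', hb'] with i h1 h2 h3 using (hc i h1 h2 h3).1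
  · filter_upwards [hab', ha', hb'] with i h1 h2 h3 using (hc i h1 h2 h3).2.1
  · rw [hev]
    exact Germ.coe_eq.2 (by
      filter_upwards [hab', ha', hb'] with i h1 h2 h3 using (hc i h1 h2 h3).2.2)

end

section

open Polynomial

/-- A proper preordering of a commutative ring. -/
structure IsProperPreordering {C : Type} [CommRing C] (P : Set C) : Prop where
  add : ∀ a ∈ P, ∀ b ∈ P, a + b ∈ P
  mul : ∀ a ∈ P, ∀ b ∈ P, a * b ∈ P
  sq : ∀ a, a * a ∈ P
  neg_one : (-1 : C) ∉ P

namespace IsProperPreordering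

variable {C : Type} [CommRing C] {P : Set C}

theorem zero (hP : IsProperPreordering P) : (0 : C) ∈ P := by simpa using hP.sq 0

theorem one (hP : IsProperPreordering P) : (1 : C) ∈ P := by simpa using hP.sq 1

theorem exists_neg_one_eq (hP : IsProperPreordering P)
    (hmax : ∀ Q, IsProperPreordering Q → P ⊆ Q → Q ⊆ P) {a : C} (ha : a ∉ P) :
    ∃ p ∈ P, ∃ q ∈ P, -1 = p + a * q := by
  by_contra hcon
  push Not at hcon
  have hQ : IsProperPreordering {c | ∃ p ∈ P, ∃ q ∈ P, c = p + a * q} := by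
    refine ⟨?_, ?_, ?_, ?_⟩
    · rintro _ ⟨p, hp, q, hq, rfl⟩ _ ⟨p', hp', q', hq', rfl⟩
      exact ⟨_, hP.add _ hp _ hp', _, hP.add _ hq _ hq', by ring⟩
    · rintro _ ⟨p, hp, q, hq, rfl⟩ _ ⟨p', hp', q', hq', rfl⟩
      exact ⟨p * p' + (a * a) * (q * q'),
        hP.add _ (hP.mul _ hp _ hp') _ (hP.mul _ (hP.sq a) _ (hP.mul _ hq _ hq')),
        p * q' + q * p', hP.add _ (hP.mul _ hp _ hq') _ (hP.mul _ hq _ hp'), by ring⟩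
    · exact fun c => ⟨_, hP.sq c, 0, hP.zero, by ring⟩
    · rintro ⟨p, hp, q, hq, h⟩
      exact hcon p hp q hq h
  exact ha (hmax _ hQ (fun p hp => ⟨p, hp, 0, hP.zero, by ring⟩) ⟨0, hP.zero, 1, hP.one, by ring⟩)

theorem exists_total (hP : IsProperPreordering P) : ∃ Q, P ⊆ Q ∧ IsProperPreordering Q ∧
    (∀ a, a ∈ Q ∨ -a ∈ Q) ∧
    ∀ a b, a * b ∈ Q → -(a * b) ∈ Q → (a ∈ Q ∧ -a ∈ Q) ∨ (b ∈ Q ∧ -b ∈ Q) := by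
  obtain ⟨Q, hPQ, hQ⟩ := zorn_subset_nonempty {Q : Set C | IsProperPreordering Q} (by
    intro c hc hchain hne
    refine ⟨⋃₀ c, ⟨?_, ?_, ?_, ?_⟩, fun s hs => Set.subset_sUnion_of_mem hs⟩
    · rintro a ⟨s, hs, ha⟩ b ⟨t, ht, hb⟩
      rcases hchain.total hs ht with h | h
      · exact ⟨t, ht, (hc ht).add _ (h ha) _ hb⟩
      · exact ⟨s, hs, (hc hs).add _ ha _ (h hb)⟩
    · rintro a ⟨s, hs, ha⟩ b ⟨t, ht, hb⟩
      rcases hchain.total hs ht with h | h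
      · exact ⟨t, ht, (hc ht).mul _ (h ha) _ hb⟩
      · exact ⟨s, hs, (hc hs).mul _ ha _ (h hb)⟩
    · obtain ⟨s, hs⟩ := hne
      exact fun a => ⟨s, hs, (hc hs).sq a⟩
    · rintro ⟨s, hs, h⟩
      exact (hc hs).neg_one h) P hP
  have hQ' : IsProperPreordering Q := hQ.prop
  have hmax : ∀ Q', IsProperPreordering Q' → Q ⊆ Q' → Q' ⊆ Q := fun Q' h1 h2 => hQ.le_of_ge h1 h2
  have key : ∀ a b, a ∉ Q → b ∉ Q → -(a * b) ∉ Q := by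
    intro a b ha hb hab
    obtain ⟨p, hp, q, hq, h1⟩ := hQ'.exists_neg_one_eq hmax ha
    obtain ⟨r, hr, s, hs, h2⟩ := hQ'.exists_neg_one_eq hmax hb
    apply hQ'.neg_one
    have : (-1 : C) = p + r + p * r + -(a * b) * (q * s) := by
      linear_combination (1 + p) * h2 - (b * s) * h1
    rw [this]
    exact hQ'.add _ (hQ'.add _ (hQ'.add _ hp _ hr) _ (hQ'.mul _ hp _ hr)) _
      (hQ'.mul _ hab _ (hQ'.mul _ hq _ hs))
  refine ⟨Q, hPQ, hQ', fun a => ?_, fun a b h1 h2 => ?_⟩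
  · by_contra! h
    exact key _ _ h.1 h.2 (by simpa using hQ'.sq a)
  · by_contra! h
    by_cases ha : a ∈ Q <;> by_cases hb : b ∈ Q
    · exact key _ _ (h.1 ha) (h.2 hb) (by simpa using h2)
    · exact key _ _ (h.1 ha) hb (by simpa using h1)
    · exact key _ _ ha (h.2 hb) (by simpa using h1)
    · exact key _ _ ha hb h2

theorem eq_zero_of_neg_mem {E : Type} [Field E] {P : Set E} (hP : IsProperPreordering P) {x : E}
    (h1 : x ∈ P) (h2 : -x ∈ P) : x = 0 := by
  by_contra hx
  apply hP.neg_one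
  have : (-1 : E) = -x * (x * (x⁻¹ * x⁻¹)) := by field_simp
  rw [this]
  exact hP.mul _ h2 _ (hP.mul _ h1 _ (hP.sq _))

end IsProperPreordering

theorem exists_linearOrder_of_cone {F : Type} [Field F] (P : Set F)
    (add : ∀ a ∈ P, ∀ b ∈ P, a + b ∈ P) (mul : ∀ a ∈ P, ∀ b ∈ P, a * b ∈ P)
    (total : ∀ a, a ∈ P ∨ -a ∈ P) (anti : ∀ a, a ∈ P → -a ∈ P → a = 0) :
    ∃ _ : LinearOrder F, IsStrictOrderedRing F ∧ ∀ x : F, 0 ≤ x ↔ x ∈ P := by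
  classical
  have hz : (0 : F) ∈ P := by simpa using total 0
  have ho : (1 : F) ∈ P := by
    rcases total 1 with h | h
    · exact h
    · simpa using mul _ h _ h
  let K : RingCone F :=
    { carrier := P, mul_mem' := fun {a b} ha hb => mul a ha b hb, one_mem' := ho,
      add_mem' := fun {a b} ha hb => add a ha b hb, zero_mem' := hz,
      eq_zero_of_mem_of_neg_mem' := fun {a} h1 h2 => anti a h1 h2 }
  have : HasMemOrNegMem K := ⟨total⟩
  let lo : LinearOrder F := LinearOrder.mkOfAddGroupCone K
  have : IsOrderedRing F := IsOrderedRing.mkOfCone K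
  refine ⟨lo, IsOrderedRing.toIsStrictOrderedRing F, fun x => ?_⟩
  change x - 0 ∈ K ↔ x ∈ P
  rw [sub_zero]
  rfl

section IVT

variable {F : Type} [Field F] [LinearOrder F]

/-- Sums of squares of polynomials of restricted degree with nonnegative weights. -/
noncomputable def weightedSq (F : Type) [Field F] [LinearOrder F] (D : WithBot ℕ) : AddSubmonoid F[X] :=
  AddSubmonoid.closure {q | ∃ (c : F) (g : F[X]), 0 ≤ c ∧ g.degree < D ∧ q = C c * (g * g)}

theorem exists_weightedSq_mod (f : F[X]) (hf : f ≠ 0) {s : F[X]}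
    (hs : s ∈ AddSubmonoid.closure {q : F[X] | ∃ (c : F) (g : F[X]), 0 ≤ c ∧ q = C c * (g * g)}) :
    ∃ s' ∈ weightedSq F f.degree, f ∣ s - s' := by
  induction hs using AddSubmonoid.closure_induction with
  | mem x hx =>
    obtain ⟨c, g, hc, rfl⟩ := hx
    refine ⟨C c * ((g % f) * (g % f)), AddSubmonoid.subset_closure
      ⟨c, g % f, hc, EuclideanDomain.mod_lt _ hf, rfl⟩, ?_⟩
    have h1 : g = f * (g / f) + g % f := (EuclideanDomain.div_add_mod g f).symm
    refine ⟨C c * (g / f) * (g + g % f), ?_⟩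
    generalize g / f = u at *
    generalize g % f = r at *
    rw [h1]
    ring
  | zero => exact ⟨0, zero_mem _, by simp⟩
  | add x y _ _ hx hy =>
    obtain ⟨a, ha, ha'⟩ := hx
    obtain ⟨b, hb, hb'⟩ := hy
    refine ⟨a + b, add_mem ha hb, ?_⟩
    have := dvd_add ha' hb'
    convert this using 1
    ring

theorem eval_nonneg_of_mem_weightedSq [IsStrictOrderedRing F] {D : WithBot ℕ} {s : F[X]} (hs : s ∈ weightedSq F D) (a : F) :
    0 ≤ s.eval a := by
  induction hs using AddSubmonoid.closure_induction with
  | mem x hx =>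
    obtain ⟨c, g, hc, -, rfl⟩ := hx
    simp only [eval_mul, eval_C]
    exact mul_nonneg hc (mul_self_nonneg _)
  | zero => simp
  | add x y _ _ hx hy => simpa using add_nonneg hx hy

theorem natDegree_le_of_mem_weightedSq {d : ℕ} {s : F[X]}
    (hs : s ∈ weightedSq F ((d + 1 : ℕ) : WithBot ℕ)) : s.natDegree ≤ 2 * d := by
  induction hs using AddSubmonoid.closure_induction with
  | mem x hx =>
    obtain ⟨c, g, hc, h, rfl⟩ := hx
    have hg : g.natDegree ≤ d := by
      rcases eq_or_ne g 0 with rfl | hg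
      · simp
      · exact Nat.lt_succ_iff.1 ((natDegree_lt_iff_degree_lt hg).2 h)
    refine (natDegree_C_mul_le _ _).trans (natDegree_mul_le.trans ?_)
    omega
  | zero => simp
  | add x y _ _ hx hy => exact (natDegree_add_le _ _).trans (max_le hx hy)

theorem not_dvd_one_add_of_sign_change [IsStrictOrderedRing F] (a b : F) (d : ℕ) : ∀ (f : F[X]), f.natDegree = d →
    f.eval a * f.eval b < 0 → ∀ s ∈ AddSubmonoid.closure
      {q : F[X] | ∃ (c : F) (g : F[X]), 0 ≤ c ∧ q = C c * (g * g)}, ¬ f ∣ 1 + s := by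
  induction d using Nat.strong_induction_on with
  | _ d ih =>
  intro f hd hf s hs hdvd
  have hf0 : f ≠ 0 := by rintro rfl; simp at hf
  rcases d with _ | d
  · rw [natDegree_eq_zero] at hd
    obtain ⟨c, rfl⟩ := hd
    simp only [eval_C] at hf
    exact absurd hf (not_lt.2 (mul_self_nonneg c))
  obtain ⟨s', hs', h2⟩ := exists_weightedSq_mod f hf0 hs
  have h3 : f ∣ 1 + s' := by
    have := dvd_sub hdvd h2
    convert this using 1
    ring
  obtain ⟨h, hh⟩ := h3
  have hpos : ∀ t, 0 < (f * h).eval t := by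
    intro t
    rw [← hh]
    have := eval_nonneg_of_mem_weightedSq hs' t
    simp only [eval_add, eval_one]
    linarith
  have hh0 : h ≠ 0 := by
    rintro rfl
    simpa using hpos 0
  rw [degree_eq_natDegree hf0, hd] at hs'
  have hdeg : (f * h).natDegree ≤ 2 * d := by
    rw [← hh]
    refine (natDegree_add_le _ _).trans (max_le (by simp) (natDegree_le_of_mem_weightedSq hs'))
  rw [natDegree_mul hf0 hh0, hd] at hdeg
  refine ih h.natDegree (by omega) h rfl ?_ s' ?_ ⟨f, by rw [hh, mul_comm]⟩
  · have h1 := mul_pos (hpos a) (hpos b)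
    simp only [eval_mul] at h1
    by_contra hcon
    nlinarith [mul_nonneg (neg_nonneg.2 hf.le) (not_lt.1 hcon)]
  · refine AddSubmonoid.closure_mono ?_ hs'
    rintro _ ⟨c, g, hc, -, rfl⟩
    exact ⟨c, g, hc, rfl⟩

theorem exists_weightedSq_lift (f : F[X]) {x : AdjoinRoot f} (hx : x ∈ AddSubmonoid.closure
    {q : AdjoinRoot f | ∃ (c : F) (g : AdjoinRoot f), 0 ≤ c ∧ q = AdjoinRoot.of f c * (g * g)}) :
    ∃ s ∈ AddSubmonoid.closure {q : F[X] | ∃ (c : F) (g : F[X]), 0 ≤ c ∧ q = C c * (g * g)},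
      AdjoinRoot.mk f s = x := by
  induction hx using AddSubmonoid.closure_induction with
  | mem x hx =>
    obtain ⟨c, g, hc, rfl⟩ := hx
    obtain ⟨g, rfl⟩ := AdjoinRoot.mk_surjective g
    exact ⟨_, AddSubmonoid.subset_closure ⟨c, g, hc, rfl⟩, by simp⟩
  | zero => exact ⟨0, zero_mem _, by simp⟩
  | add x y _ _ hx hy =>
    obtain ⟨a, ha, rfl⟩ := hx
    obtain ⟨b, hb, rfl⟩ := hy
    exact ⟨a + b, add_mem ha hb, by simp⟩

theorem exists_irreducible_sign_change [IsStrictOrderedRing F] {p : F[X]} (hp : p ≠ 0) {a b : F}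
    (h : p.eval a * p.eval b < 0) : ∃ f, Irreducible f ∧ f ∣ p ∧ f.eval a * f.eval b < 0 := by
  induction p using WfDvdMonoid.induction_on_irreducible with
  | zero => exact absurd rfl hp
  | unit u hu =>
    obtain ⟨c, -, rfl⟩ := isUnit_iff.1 hu
    simp only [eval_C] at h
    exact absurd h (not_lt.2 (mul_self_nonneg c))
  | mul q f hq hf ih =>
    by_cases h1 : f.eval a * f.eval b < 0
    · exact ⟨f, hf, dvd_mul_right _ _, h1⟩
    · obtain ⟨f', h2, h3, h4⟩ := ih hq (by
        simp only [eval_mul] at h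
        by_contra hcon
        nlinarith [mul_nonneg (not_lt.1 h1) (not_lt.1 hcon)])
      exact ⟨f', h2, h3.mul_left _, h4⟩

theorem polyIVT_of_no_extension [IsStrictOrderedRing F]
    (hmax : ∀ f : F[X], Irreducible f → 2 ≤ f.natDegree → ∀ T : Set (AdjoinRoot f),
      IsProperPreordering T → ¬ ∀ c : F, 0 ≤ c → AdjoinRoot.of f c ∈ T) : PolyIVT F := by
  intro p a b hab ha hb
  rcases ha.eq_or_lt with ha | ha
  · exact ⟨a, le_rfl, hab, ha⟩
  rcases hb.eq_or_lt with hb | hb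
  · exact ⟨b, hab, le_rfl, hb.symm⟩
  obtain ⟨f, hf, ⟨q, rfl⟩, hsign⟩ := exists_irreducible_sign_change (p := p)
    (by rintro rfl; simp at ha) (mul_neg_of_neg_of_pos ha hb)
  by_cases hdeg : f.natDegree = 1
  · obtain ⟨u, hu, v, rfl⟩ := natDegree_eq_one.1 hdeg
    refine ⟨-v / u, ?_, ?_, by simp [mul_div_cancel₀ _ hu]⟩ <;>
    · simp at hsign
      rcases lt_or_gt_of_ne hu with hu' | hu'
      · first | rw [le_div_iff_of_neg hu'] | rw [div_le_iff_of_neg hu']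
        rcases mul_neg_iff.1 hsign with h | h <;>
          nlinarith [mul_nonneg (sub_nonneg.2 hab) (neg_nonneg.2 hu'.le)]
      · first | rw [le_div_iff₀ hu'] | rw [div_le_iff₀ hu']
        rcases mul_neg_iff.1 hsign with h | h <;>
          nlinarith [mul_nonneg (sub_nonneg.2 hab) hu'.le]
  · exfalso
    have hpos := hf.natDegree_pos
    refine hmax f hf (by omega) ((AddSubmonoid.closure
      {q : AdjoinRoot f | ∃ (c : F) (g : AdjoinRoot f), 0 ≤ c ∧
        q = AdjoinRoot.of f c * (g * g)} : AddSubmonoid (AdjoinRoot f)) : Set (AdjoinRoot f))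
      ⟨fun x hx y hy => add_mem hx hy, ?_, ?_, ?_⟩ ?_
    · intro x hx y hy
      induction hx using AddSubmonoid.closure_induction with
      | mem x hx =>
        obtain ⟨c, g, hc, rfl⟩ := hx
        induction hy using AddSubmonoid.closure_induction with
        | mem y hy =>
          obtain ⟨c', g', hc', rfl⟩ := hy
          exact AddSubmonoid.subset_closure ⟨c * c', g * g', mul_nonneg hc hc', by simp; ring⟩
        | zero => rw [mul_zero]; exact zero_mem _
        | add _ _ _ _ h1 h2 => rw [mul_add]; exact add_mem h1 h2
      | zero => rw [zero_mul]; exact zero_mem _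
      | add _ _ _ _ h1 h2 => rw [add_mul]; exact add_mem h1 h2
    · exact fun x => AddSubmonoid.subset_closure ⟨1, x, zero_le_one, by simp⟩
    · intro h
      obtain ⟨s, hs, h'⟩ := exists_weightedSq_lift f h
      refine not_dvd_one_add_of_sign_change a b _ f rfl hsign s hs ?_
      rw [← AdjoinRoot.mk_eq_zero]
      simp [h']
    · exact fun c hc => AddSubmonoid.subset_closure ⟨c, 1, hc, by simp⟩

end IVT

end

section

open Polynomial

/-- The set of nonnegative elements of an ordered subfield. -/
structure IsFieldCone {L : Type} [Field L] (P : Set L) : Prop where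
  one : (1 : L) ∈ P
  zero : (0 : L) ∈ P
  add : ∀ a ∈ P, ∀ b ∈ P, a + b ∈ P
  mul : ∀ a ∈ P, ∀ b ∈ P, a * b ∈ P
  inv : ∀ a ∈ P, a⁻¹ ∈ P
  anti : ∀ a ∈ P, -a ∈ P → a = 0
  diff : ∀ a ∈ P, ∀ b ∈ P, a - b ∈ P ∨ b - a ∈ P

namespace IsFieldCone

variable {L : Type} [Field L] {P : Set L}

theorem exists_maximal (hP : IsFieldCone P) :
    ∃ Q, P ⊆ Q ∧ IsFieldCone Q ∧ ∀ Q', IsFieldCone Q' → Q ⊆ Q' → Q' ⊆ Q := by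
  obtain ⟨Q, hPQ, hQ⟩ := zorn_subset_nonempty {Q : Set L | IsFieldCone Q} (by
    intro c hc hchain hne
    have two : ∀ a ∈ ⋃₀ c, ∀ b ∈ ⋃₀ c, ∃ s ∈ c, a ∈ s ∧ b ∈ s := by
      rintro a ⟨s, hs, ha⟩ b ⟨t, ht, hb⟩
      rcases hchain.total hs ht with h | h
      · exact ⟨t, ht, h ha, hb⟩
      · exact ⟨s, hs, ha, h hb⟩
    refine ⟨⋃₀ c, ⟨?_, ?_, ?_, ?_, ?_, ?_, ?_⟩, fun s hs => Set.subset_sUnion_of_mem hs⟩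
    · obtain ⟨s, hs⟩ := hne
      exact ⟨s, hs, (hc hs).one⟩
    · obtain ⟨s, hs⟩ := hne
      exact ⟨s, hs, (hc hs).zero⟩
    · intro a ha b hb
      obtain ⟨s, hs, ha, hb⟩ := two a ha b hb
      exact ⟨s, hs, (hc hs).add _ ha _ hb⟩
    · intro a ha b hb
      obtain ⟨s, hs, ha, hb⟩ := two a ha b hb
      exact ⟨s, hs, (hc hs).mul _ ha _ hb⟩
    · rintro a ⟨s, hs, ha⟩
      exact ⟨s, hs, (hc hs).inv _ ha⟩
    · intro a ha hb
      obtain ⟨s, hs, ha, hb⟩ := two a ha _ hb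
      exact (hc hs).anti _ ha hb
    · intro a ha b hb
      obtain ⟨s, hs, ha, hb⟩ := two a ha b hb
      exact ((hc hs).diff _ ha _ hb).imp (fun h => ⟨s, hs, h⟩) (fun h => ⟨s, hs, h⟩)) P hP
  exact ⟨Q, hPQ, hQ.prop, fun Q' h1 h2 => hQ.le_of_ge h1 h2⟩

/-- The subfield of differences of elements of a field cone. -/
def subfield (hP : IsFieldCone P) : Subfield L where
  carrier := {x | x ∈ P ∨ -x ∈ P}
  one_mem' := Or.inl hP.one
  zero_mem' := Or.inl hP.zero
  add_mem' := by
    rintro a b (ha | ha) (hb | hb)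
    · exact Or.inl (hP.add _ ha _ hb)
    · rcases hP.diff _ ha _ hb with h | h
      · exact Or.inl (by simpa using h)
      · exact Or.inr (by simpa [add_comm, sub_eq_add_neg] using h)
    · rcases hP.diff _ ha _ hb with h | h
      · exact Or.inr (by simpa [add_comm, sub_eq_add_neg] using h)
      · exact Or.inl (by simpa [add_comm] using h)
    · exact Or.inr (by simpa [add_comm] using hP.add _ ha _ hb)
  mul_mem' := by
    rintro a b (ha | ha) (hb | hb)
    · exact Or.inl (hP.mul _ ha _ hb)
    · exact Or.inr (by simpa using hP.mul _ ha _ hb)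
    · exact Or.inr (by simpa using hP.mul _ ha _ hb)
    · exact Or.inl (by simpa using hP.mul _ ha _ hb)
  neg_mem' := by
    rintro a (ha | ha)
    · exact Or.inr (by simpa using ha)
    · exact Or.inl ha
  inv_mem' := by
    rintro a (ha | ha)
    · exact Or.inl (hP.inv _ ha)
    · exact Or.inr (by simpa [inv_neg] using hP.inv _ ha)

theorem exists_polyIVT_of_maximal [IsAlgClosed L] (hP : IsFieldCone P)
    (hmax : ∀ Q, IsFieldCone Q → P ⊆ Q → Q ⊆ P) :
    ∃ _ : LinearOrder hP.subfield, IsStrictOrderedRing hP.subfield ∧ PolyIVT hP.subfield ∧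
      ∀ x : hP.subfield, 0 ≤ x ↔ (x : L) ∈ P := by
  obtain ⟨lo, hlo, hpos⟩ := exists_linearOrder_of_cone (F := hP.subfield) {x | (x : L) ∈ P}
    (fun a ha b hb => hP.add _ ha _ hb) (fun a ha b hb => hP.mul _ ha _ hb)
    (fun a => a.2) (fun a ha hb => Subtype.ext (hP.anti _ ha hb))
  refine ⟨lo, hlo, polyIVT_of_no_extension ?_, hpos⟩
  intro f hf hdeg T hT hTF
  obtain ⟨Q, hTQ, hQ, htot, -⟩ := hT.exists_total
  have : Fact (Irreducible f) := ⟨hf⟩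
  obtain ⟨x, hx⟩ := IsAlgClosed.exists_eval₂_eq_zero (algebraMap hP.subfield L) f (by
    rw [degree_eq_natDegree hf.ne_zero]
    exact_mod_cast by omega)
  let j : AdjoinRoot f →+* L := AdjoinRoot.lift (algebraMap hP.subfield L) x hx
  have hj : IsFieldCone (j '' Q) := by
    refine ⟨⟨1, hQ.one, map_one j⟩, ⟨0, hQ.zero, map_zero j⟩, ?_, ?_, ?_, ?_, ?_⟩
    · rintro _ ⟨a, ha, rfl⟩ _ ⟨b, hb, rfl⟩
      exact ⟨_, hQ.add _ ha _ hb, map_add j a b⟩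
    · rintro _ ⟨a, ha, rfl⟩ _ ⟨b, hb, rfl⟩
      exact ⟨_, hQ.mul _ ha _ hb, map_mul j a b⟩
    · rintro _ ⟨a, ha, rfl⟩
      refine ⟨a⁻¹, ?_, map_inv₀ j a⟩
      have h := hQ.mul _ ha _ (hQ.sq a⁻¹)
      rcases eq_or_ne a 0 with rfl | h0
      · simpa using ha
      · rwa [← mul_assoc, mul_inv_cancel₀ h0, one_mul] at h
    · rintro _ ⟨a, ha, rfl⟩ ⟨b, hb, h⟩
      have : b = -a := j.injective (by rw [h, map_neg])
      subst this
      rw [hQ.eq_zero_of_neg_mem ha hb, map_zero]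
    · rintro _ ⟨a, ha, rfl⟩ _ ⟨b, hb, rfl⟩
      rcases htot (a - b) with h | h
      · exact Or.inl ⟨_, h, map_sub j a b⟩
      · exact Or.inr ⟨_, h, by rw [neg_sub, map_sub]⟩
  have hsub : j '' Q ⊆ P := hmax _ hj (fun y hy =>
    ⟨AdjoinRoot.of f ⟨y, Or.inl hy⟩, hTQ (hTF _ ((hpos _).2 hy)), by simp [j]; rfl⟩)
  have hroot : x ∈ hP.subfield := by
    rcases htot (AdjoinRoot.root f) with h | h
    · left
      exact hsub ⟨_, h, by simp [j]⟩
    · right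
      exact hsub ⟨_, h, by simp [j]⟩
  have hroot' : f.eval ⟨x, hroot⟩ = 0 := by
    apply Subtype.ext
    have : (algebraMap hP.subfield L) (f.eval ⟨x, hroot⟩) = 0 := by
      rw [← hx, ← eval₂_hom]
      rfl
    exact this
  have : f.natDegree = 1 := natDegree_eq_of_degree_eq_some (degree_eq_one_of_irreducible_of_root hf hroot')
  omega

end IsFieldCone

theorem exists_hom_to_polyIVT {C : Type} [CommRing C] {T : Set C} (hT : IsProperPreordering T) :
    ∃ (R : Type) (_ : Field R) (_ : LinearOrder R) (_ : IsStrictOrderedRing R) (φ : C →+* R),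
      PolyIVT R ∧ ∀ t ∈ T, 0 ≤ φ t := by
  obtain ⟨P, hTP, hP, htot, hprime⟩ := hT.exists_total
  let I : Ideal C :=
    { carrier := {a | a ∈ P ∧ -a ∈ P}
      zero_mem' := ⟨hP.zero, by simpa using hP.zero⟩
      add_mem' := by
        rintro a b ⟨h1, h2⟩ ⟨h3, h4⟩
        exact ⟨hP.add _ h1 _ h3, by simpa [add_comm] using hP.add _ h2 _ h4⟩
      smul_mem' := by
        rintro c a ⟨h1, h2⟩
        rcases htot c with h | h
        · exact ⟨hP.mul _ h _ h1, by simpa using hP.mul _ h _ h2⟩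
        · exact ⟨by simpa using hP.mul _ h _ h2, by simpa using hP.mul _ h _ h1⟩ }
  have hI : I.IsPrime := by
    refine ⟨?_, fun {a b} h => hprime a b h.1 h.2⟩
    rw [Ideal.ne_top_iff_one]
    exact fun h => hP.neg_one h.2
  let L := AlgebraicClosure (FractionRing (C ⧸ I))
  let ψ : C →+* L := (algebraMap (FractionRing (C ⧸ I)) L).comp
    ((algebraMap (C ⧸ I) (FractionRing (C ⧸ I))).comp (Ideal.Quotient.mk I))
  have hψ : ∀ a, ψ a = 0 ↔ a ∈ P ∧ -a ∈ P := by
    intro a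
    simp only [ψ, RingHom.comp_apply]
    rw [map_eq_zero_iff _ (FaithfulSMul.algebraMap_injective _ _),
      map_eq_zero_iff _ (IsFractionRing.injective _ _), Ideal.Quotient.eq_zero_iff_mem]
    rfl
  have hcone : IsFieldCone {x : L | ∃ a ∈ P, ∃ b ∈ P, ψ b ≠ 0 ∧ x = ψ a / ψ b} := by
    refine ⟨⟨1, hP.one, 1, hP.one, by simp, by simp⟩, ⟨0, hP.zero, 1, hP.one, by simp, by simp⟩,
      ?_, ?_, ?_, ?_, ?_⟩
    · rintro _ ⟨a, ha, b, hb, h, rfl⟩ _ ⟨a', ha', b', hb', h', rfl⟩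
      exact ⟨a * b' + b * a', hP.add _ (hP.mul _ ha _ hb') _ (hP.mul _ hb _ ha'), b * b',
        hP.mul _ hb _ hb', by simp [h, h'], by
          rw [div_add_div _ _ h h']
          simp only [map_add, map_mul]⟩
    · rintro _ ⟨a, ha, b, hb, h, rfl⟩ _ ⟨a', ha', b', hb', h', rfl⟩
      exact ⟨a * a', hP.mul _ ha _ ha', b * b', hP.mul _ hb _ hb', by simp [h, h'], by
          rw [div_mul_div_comm]
          simp only [map_mul]⟩
    · rintro _ ⟨a, ha, b, hb, h, rfl⟩
      by_cases h0 : ψ a = 0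
      · exact ⟨0, hP.zero, 1, hP.one, by simp, by simp [h0]⟩
      · exact ⟨b, hb, a, ha, h0, inv_div _ _⟩
    · rintro _ ⟨a, ha, b, hb, h, rfl⟩ ⟨a', ha', b', hb', h', h2⟩
      have h3 : ψ (a * b' + a' * b) = 0 := by
        rw [← neg_div, div_eq_div_iff h h'] at h2
        simp only [map_add, map_mul]
        linear_combination -h2
      have h4 : ψ (a * b') = 0 := by
        refine (hψ _).2 ⟨hP.mul _ ha _ hb', ?_⟩
        have := hP.add _ ((hψ _).1 h3).2 _ (hP.mul _ ha' _ hb)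
        convert this using 1
        ring
      rw [map_mul, mul_eq_zero, or_iff_left h'] at h4
      simp [h4]
    · rintro _ ⟨a, ha, b, hb, h, rfl⟩ _ ⟨a', ha', b', hb', h', rfl⟩
      rw [div_sub_div _ _ h h', div_sub_div _ _ h' h]
      rcases htot (a * b' - b * a') with h1 | h1
      · exact Or.inl ⟨_, h1, b * b', hP.mul _ hb _ hb', by simp [h, h'], by simp⟩
      · exact Or.inr ⟨_, h1, b' * b, hP.mul _ hb' _ hb, by simp [h, h'], by simp; ring⟩
  obtain ⟨Q, hPQ, hQ, hmax⟩ := hcone.exists_maximal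
  obtain ⟨lo, hlo, hivt, hpos⟩ := hQ.exists_polyIVT_of_maximal hmax
  have hmem : ∀ c ∈ P, ψ c ∈ Q := fun c hc => hPQ ⟨c, hc, 1, hP.one, by simp, by simp⟩
  refine ⟨hQ.subfield, inferInstance, lo, hlo, ψ.codRestrict hQ.subfield (fun c => ?_), hivt,
    fun t ht => (hpos _).2 (hmem t (hTP ht))⟩
  rcases htot c with h | h
  · exact Or.inl (hmem c h)
  · right
    rw [← map_neg]
    exact hmem _ h

end

section

open Polynomial

/-- A subring of a product of two ordered fields on which both coordinates have the same sign. -/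
def IsSignRing {R S : Type} [Field R] [LinearOrder R] [Field S] [LinearOrder S]
    (G : Subring (R × S)) : Prop :=
  ∀ g ∈ G, 0 < g.1 ↔ 0 < g.2

/-- Closure under inversion of the elements with nonzero first coordinate. -/
def IsInvClosed {R S : Type} [Field R] [Field S] (G : Subring (R × S)) : Prop :=
  ∀ g ∈ G, g.1 ≠ 0 → (g.1⁻¹, g.2⁻¹) ∈ G

/-- The first coordinate on a subring of a product. -/
abbrev Subring.fstHom {R S : Type} [Field R] [Field S] (G : Subring (R × S)) : G →+* R :=
  (RingHom.fst R S).comp G.subtype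

/-- The second coordinate on a subring of a product. -/
abbrev Subring.sndHom {R S : Type} [Field R] [Field S] (G : Subring (R × S)) : G →+* S :=
  (RingHom.snd R S).comp G.subtype

section

variable {R S : Type} [Field R] [LinearOrder R] [IsStrictOrderedRing R]
  [Field S] [LinearOrder S] [IsStrictOrderedRing S]

namespace IsSignRing

variable {G : Subring (R × S)}

theorem neg_iff (hG : IsSignRing G) {g : R × S} (hg : g ∈ G) : g.1 < 0 ↔ g.2 < 0 := by
  simpa using hG (-g) (neg_mem hg)

theorem zero_iff (hG : IsSignRing G) {g : R × S} (hg : g ∈ G) : g.1 = 0 ↔ g.2 = 0 := by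
  have h1 := hG g hg
  have h2 := hG.neg_iff hg
  constructor <;> intro h
  · rw [h] at h1 h2
    simp only [lt_irrefl, false_iff, not_lt] at h1 h2
    exact le_antisymm h1 h2
  · rw [h] at h1 h2
    simp only [lt_irrefl, iff_false, not_lt] at h1 h2
    exact le_antisymm h1 h2

theorem fstHom_injective (hG : IsSignRing G) : Function.Injective G.fstHom := by
  rw [injective_iff_map_eq_zero]
  rintro ⟨g, hg⟩ h
  exact Subtype.ext (Prod.ext h ((hG.zero_iff hg).1 h))

theorem exists_invClosed (hG : IsSignRing G) :
    ∃ G' : Subring (R × S), G ≤ G' ∧ IsSignRing G' ∧ IsInvClosed G' := by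
  have hz : ∀ {g : R × S}, g ∈ G → g.1 ≠ 0 → g.2 ≠ 0 := fun hg h h' => h ((hG.zero_iff hg).2 h')
  let G' : Subring (R × S) :=
    { carrier := {g | ∃ c ∈ G, c.1 ≠ 0 ∧ g * c ∈ G}
      one_mem' := ⟨1, one_mem _, by simp, by simp⟩
      zero_mem' := ⟨1, one_mem _, by simp, by simp⟩
      mul_mem' := by
        rintro g h ⟨c, hc, hc0, h1⟩ ⟨d, hd, hd0, h2⟩
        exact ⟨c * d, mul_mem hc hd, mul_ne_zero hc0 hd0, by
          have := mul_mem h1 h2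
          convert this using 1
          ring⟩
      add_mem' := by
        rintro g h ⟨c, hc, hc0, h1⟩ ⟨d, hd, hd0, h2⟩
        exact ⟨c * d, mul_mem hc hd, mul_ne_zero hc0 hd0, by
          have := add_mem (mul_mem h1 hd) (mul_mem h2 hc)
          convert this using 1
          ring⟩
      neg_mem' := by
        rintro g ⟨c, hc, hc0, h1⟩
        exact ⟨c, hc, hc0, by simpa using h1⟩ }
  refine ⟨G', fun g hg => ⟨1, one_mem _, by simp, by simpa using hg⟩, ?_, ?_⟩
  · rintro g ⟨c, hc, hc0, h⟩
    have h1 := hG _ (mul_mem h hc)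
    have h2 : 0 < c.1 * c.1 := mul_self_pos.2 hc0
    have h3 : 0 < c.2 * c.2 := mul_self_pos.2 (hz hc hc0)
    simp only [Prod.fst_mul, Prod.snd_mul, mul_assoc] at h1
    rwa [mul_pos_iff_of_pos_right h2, mul_pos_iff_of_pos_right h3] at h1
  · rintro g ⟨c, hc, hc0, h⟩ hg0
    refine ⟨g * c * c, mul_mem h hc, by simp [hg0, hc0], ?_⟩
    have hg2 : g.2 ≠ 0 := by
      intro h'
      exact hz h (mul_ne_zero hg0 hc0) (by simp [h'])
    have := mul_mem hc hc
    convert this using 1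
    ext <;> simp <;> field_simp

theorem exists_adjoin {S' : Type} [Field S'] [LinearOrder S']
    [IsStrictOrderedRing S'] (j : S →+* S') (x : R) (y : S')
    (h : ∀ P : G[X], 0 < P.eval₂ G.fstHom x ↔ 0 < P.eval₂ (j.comp G.sndHom) y) :
    ∃ G' : Subring (R × S'), (∀ g ∈ G, (g.1, j g.2) ∈ G') ∧ IsSignRing G' ∧ IsInvClosed G' ∧
      (x, y) ∈ G' := by
  let Φ : G[X] →+* R × S' :=
    (eval₂RingHom G.fstHom x).prod (eval₂RingHom (j.comp G.sndHom) y)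
  have hΦ : IsSignRing Φ.range := by
    rintro _ ⟨P, rfl⟩
    exact h P
  obtain ⟨G', h1, h2, h3⟩ := hΦ.exists_invClosed
  refine ⟨G', fun g hg => h1 ⟨C ⟨g, hg⟩, ?_⟩, h2, h3, h1 ⟨X, ?_⟩⟩
  · simp [Φ]
  · simp [Φ]

theorem eval₂_mem {x : R} {y : S} (h : (x, y) ∈ G) (P : G[X]) :
    (P.eval₂ G.fstHom x, P.eval₂ G.sndHom y) ∈ G := by
  have : (P.eval₂ G.fstHom x, P.eval₂ G.sndHom y) = P.eval₂ G.subtype (x, y) := by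
    ext
    · exact (hom_eval₂ P G.subtype (RingHom.fst R S) (x, y)).symm
    · exact (hom_eval₂ P G.subtype (RingHom.snd R S) (x, y)).symm
  rw [this]
  have := hom_eval₂ P (RingHom.id G) G.subtype ⟨(x, y), h⟩
  simp only [RingHom.comp_id] at this
  change _ = P.eval₂ G.subtype (x, y) at this
  rw [← this]
  exact Subtype.property _

/-- Signs of a polynomial with real-closed-like behaviour propagate on root-free intervals. -/
theorem pos_of_pos (hR : PolyIVT R) (hS : PolyIVT S) (hG : IsSignRing G) {u v x : R} {u' v' : S}
    (hu : (u, u') ∈ G) (hv : (v, v') ∈ G) (hux : u < x) (hxv : x < v) (n : ℕ) :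
    ∀ P : G[X], P.natDegree ≤ n →
      (∀ k t, derivative^[k] P ≠ 0 → u < t → t < v → (derivative^[k] P).eval₂ G.fstHom t ≠ 0) →
      0 < P.eval₂ G.fstHom x → ∀ y, u' < y → y < v' → 0 < P.eval₂ G.sndHom y := by
  induction n with
  | zero =>
    intro P hP _ hpos y _ _
    rw [Nat.le_zero, natDegree_eq_zero] at hP
    obtain ⟨c, rfl⟩ := hP
    simp only [eval₂_C] at hpos ⊢
    exact (hG _ c.2).1 hpos
  | succ n ih =>
    intro P hP hroot hpos y huy hyv
    have hP0 : P ≠ 0 := by rintro rfl; simp at hpos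
    have hnr : ∀ t, u < t → t < v → P.eval₂ G.fstHom t ≠ 0 := fun t => hroot 0 t hP0
    have hd : (derivative P).natDegree ≤ n :=
      (natDegree_derivative_le P).trans (by omega)
    have hroot' : ∀ k t, derivative^[k] (derivative P) ≠ 0 → u < t → t < v →
        (derivative^[k] (derivative P)).eval₂ G.fstHom t ≠ 0 := fun k t => hroot (k + 1) t
    have hPu : 0 ≤ P.eval₂ G.fstHom u := by
      by_contra! h
      obtain ⟨c, h1, h2, h3⟩ := hR (P.map G.fstHom) u x hux.le (by rw [eval_map]; exact h.le)
        (by rw [eval_map]; exact hpos.le)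
      rw [eval_map] at h3
      exact hnr c (lt_of_le_of_ne h1 (by rintro rfl; exact h.ne h3)) (h2.trans_lt hxv) h3
    have hPv : 0 ≤ P.eval₂ G.fstHom v := by
      by_contra! h
      obtain ⟨c, h1, h2, h3⟩ := hR.exists_root_of_mul_nonpos (P.map G.fstHom) hxv.le (by
        rw [eval_map, eval_map]; exact (mul_neg_of_pos_of_neg hpos h).le)
      rw [eval_map] at h3
      exact hnr c (hux.trans_le h1) (lt_of_le_of_ne h2 (by rintro rfl; exact h.ne h3)) h3
    have hle : ∀ {a b}, (a, b) ∈ G → 0 ≤ P.eval₂ G.fstHom a → 0 ≤ P.eval₂ G.sndHom b := by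
      intro a b hab h
      have h1 := hG.neg_iff (eval₂_mem hab P)
      by_contra! h2
      exact absurd (h1.2 h2) (not_lt.2 h)
    have hPu' := hle hu hPu
    have hPv' := hle hv hPv
    by_cases hP' : derivative P = 0
    · have hinj := hG.fstHom_injective
      have : P.natDegree = 0 := by
        rw [← natDegree_map_eq_of_injective hinj, ← derivative_eq_zero, derivative_map, hP',
          Polynomial.map_zero]
      rw [natDegree_eq_zero] at this
      obtain ⟨c, rfl⟩ := this
      simp only [eval₂_C] at hpos ⊢
      exact (hG _ c.2).1 hpos
    · have hx' := hroot' 0 x hP' hux hxv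
      rcases lt_or_gt_of_ne hx' with hx' | hx'
      · have hneg : ∀ y, u' < y → y < v' → (derivative P).eval₂ G.sndHom y < 0 := by
          intro y h1 h2
          have := ih (-derivative P) (by rwa [natDegree_neg]) (by
            intro k t
            rw [iterate_derivative_neg, neg_ne_zero, eval₂_neg, neg_ne_zero]
            exact hroot' k t) (by rw [eval₂_neg]; exact neg_pos.2 hx') y h1 h2
          rw [eval₂_neg] at this
          exact neg_pos.1 this
        obtain ⟨c, h1, h2, h3⟩ := hS.exists_derivative_eq_slope (P.map G.sndHom) hyv
        rw [derivative_map, eval_map, eval_map, eval_map] at h3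
        have := mul_neg_of_neg_of_pos (hneg c (huy.trans h1) h2) (sub_pos.2 hyv)
        linarith
      · have hpos' := ih (derivative P) hd hroot' hx'
        obtain ⟨c, h1, h2, h3⟩ := hS.exists_derivative_eq_slope (P.map G.sndHom) huy
        rw [derivative_map, eval_map, eval_map, eval_map] at h3
        have := mul_pos (hpos' c h1 (h2.trans hyv)) (sub_pos.2 huy)
        linarith

end IsSignRing

end

end

section

open Polynomial

section

variable {R : Type} [Field R] [LinearOrder R] [IsStrictOrderedRing R]

theorem Polynomial.Monic.abs_lt_of_eval_eq_zero {p : R[X]} (hp : p.Monic) {x : R}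
    (hx : p.eval x = 0) :
    |x| < 1 + ∑ i ∈ Finset.range p.natDegree, (p.coeff i * p.coeff i + 1) := by
  by_contra! h
  have hnn : ∀ i, |p.coeff i| ≤ p.coeff i * p.coeff i + 1 := fun i => by
    rcases abs_cases (p.coeff i) with ⟨h, _⟩ | ⟨h, _⟩ <;> rw [h] <;> nlinarith [sq_nonneg (p.coeff i - 1), sq_nonneg (p.coeff i + 1)]
  have h1 : 1 ≤ |x| := by
    refine le_trans ?_ h
    have := Finset.sum_nonneg (s := Finset.range p.natDegree)
      (fun i _ => (abs_nonneg (p.coeff i)).trans (hnn i))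
    linarith
  rw [eval_eq_sum_range, Finset.sum_range_succ, hp.coeff_natDegree, one_mul] at hx
  rcases hd : p.natDegree with _ | d
  · rw [hd] at hx
    simp at hx
  · rw [hd] at hx h
    have h2 : |x| ^ (d + 1) ≤ (∑ i ∈ Finset.range (d + 1), |p.coeff i|) * |x| ^ d := by
      rw [← abs_pow, ← abs_neg, ← eq_neg_of_add_eq_zero_left hx, Finset.sum_mul]
      refine (Finset.abs_sum_le_sum_abs _ _).trans (Finset.sum_le_sum fun i hi => ?_)
      rw [abs_mul, abs_pow]
      exact mul_le_mul_of_nonneg_left (pow_le_pow_right₀ h1 (by simp at hi; omega)) (abs_nonneg _)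
    have h3 : ∑ i ∈ Finset.range (d + 1), |p.coeff i| ≤ |x| - 1 := by
      have := Finset.sum_le_sum (s := Finset.range (d + 1)) (fun i _ => hnn i)
      linarith
    have h4 : 0 < |x| ^ d := pow_pos (by linarith) d
    have h5 := mul_le_mul_of_nonneg_right h3 h4.le
    rw [pow_succ] at h2
    nlinarith

theorem exists_gap (Z : Finset R) {x u₀ v₀ : R} (hu : u₀ < x) (hv : x < v₀) (hx : x ∉ Z) :
    ∃ u v, (u = u₀ ∨ u ∈ Z) ∧ (v = v₀ ∨ v ∈ Z) ∧ u < x ∧ x < v ∧ ∀ z ∈ Z, u < z → ¬ z < v := by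
  have h1 : ((insert u₀ Z).filter (· < x)).Nonempty := ⟨u₀, by simp [hu]⟩
  have h2 : ((insert v₀ Z).filter (x < ·)).Nonempty := ⟨v₀, by simp [hv]⟩
  have h3 := Finset.mem_filter.1 (Finset.max'_mem _ h1)
  have h4 := Finset.mem_filter.1 (Finset.min'_mem _ h2)
  refine ⟨_, _, by simpa using h3.1, by simpa using h4.1, h3.2, h4.2, fun z hz h5 h6 => ?_⟩
  rcases lt_trichotomy z x with h | h | h
  · exact absurd (Finset.le_max' _ z (by simp [hz, h])) (not_le.2 h5)
  · exact hx (h ▸ hz)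
  · exact absurd (Finset.min'_le _ z (by simp [hz, h])) (not_le.2 h6)

theorem PolyIVT.pos_iff (hR : PolyIVT R) (p : R[X]) {a b : R} (hab : a ≤ b)
    (h : ∀ c, a ≤ c → c ≤ b → p.eval c ≠ 0) : 0 < p.eval a ↔ 0 < p.eval b := by
  have ha := h a le_rfl hab
  have hb := h b hab le_rfl
  have key : ¬ p.eval a * p.eval b ≤ 0 := fun hc => by
    obtain ⟨c, h1, h2, h3⟩ := hR.exists_root_of_mul_nonpos p hab hc
    exact h c h1 h2 h3
  constructor
  · intro h1
    by_contra h2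
    exact key (mul_nonpos_of_nonneg_of_nonpos h1.le (not_lt.1 h2))
  · intro h1
    by_contra h2
    exact key (mul_nonpos_of_nonpos_of_nonneg (not_lt.1 h2) h1.le)

end

section

variable {R S : Type} [Field R] [LinearOrder R] [Field S] [LinearOrder S]

/-- Every root in `R` of a polynomial of degree less than `d` over a sign ring can be adjoined. -/
def CanAdjoinRoots (R S : Type) [Field R] [LinearOrder R] [Field S] [LinearOrder S]
    (d : ℕ) : Prop :=
  ∀ G : Subring (R × S), IsSignRing G → IsInvClosed G → ∀ (x : R) (P : G[X]), P ≠ 0 →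
    P.natDegree < d → P.eval₂ G.fstHom x = 0 →
    ∃ G' : Subring (R × S), G ≤ G' ∧ IsSignRing G' ∧ IsInvClosed G' ∧ ∃ y, (x, y) ∈ G'

theorem CanAdjoinRoots.finset {d : ℕ} (h : CanAdjoinRoots R S d) (Z : Finset R) :
    ∀ G : Subring (R × S), IsSignRing G → IsInvClosed G →
    (∀ x ∈ Z, ∃ P : G[X], P ≠ 0 ∧ P.natDegree < d ∧ P.eval₂ G.fstHom x = 0) →
    ∃ G' : Subring (R × S), G ≤ G' ∧ IsSignRing G' ∧ IsInvClosed G' ∧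
      ∀ x ∈ Z, ∃ y, (x, y) ∈ G' := by
  classical
  induction Z using Finset.induction_on with
  | empty => exact fun G h1 h2 _ => ⟨G, le_rfl, h1, h2, by simp⟩
  | insert x Z hx ih =>
    intro G h1 h2 hZ
    obtain ⟨P, h3, h4, h5⟩ := hZ x (Finset.mem_insert_self x Z)
    obtain ⟨G', h6, h7, h8, y, hy⟩ := h G h1 h2 x P h3 h4 h5
    obtain ⟨G'', h9, h10, h11, h12⟩ := ih G' h7 h8 (fun z hz => by
      obtain ⟨P, h3, h4, h5⟩ := hZ z (Finset.mem_insert_of_mem hz)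
      refine ⟨P.map (Subring.inclusion h6), ?_, natDegree_map_le.trans_lt h4, ?_⟩
      · rwa [Ne, Polynomial.map_eq_zero_iff (Subring.inclusion_injective h6)]
      · rw [eval₂_map]
        exact h5)
    refine ⟨G'', h6.trans h9, h10, h11, fun z hz => ?_⟩
    rcases Finset.mem_insert.1 hz with rfl | hz
    · exact ⟨y, h9 hy⟩
    · exact h12 z hz

variable [IsStrictOrderedRing R] [IsStrictOrderedRing S]

namespace IsSignRing

variable {G : Subring (R × S)}

theorem exists_root_same_signs (hR : PolyIVT R) (hS : PolyIVT S) (hG : IsSignRing G)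
    (hI : IsInvClosed G) {x : R} {f : G[X]} (hf : f.Monic) (hfx : f.eval₂ G.fstHom x = 0)
    (hmin : ∀ Q : G[X], Q ≠ 0 → Q.natDegree < f.natDegree → Q.eval₂ G.fstHom x ≠ 0)
    (hd : CanAdjoinRoots R S f.natDegree) (A : Finset G[X])
    (hA : ∀ Q ∈ A, Q.natDegree < f.natDegree) :
    ∃ y, f.eval₂ G.sndHom y = 0 ∧
      ∀ Q ∈ A, 0 < Q.eval₂ G.fstHom x ↔ 0 < Q.eval₂ G.sndHom y := by
  classical
  have hinj := hG.fstHom_injective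
  have hd0 : f.natDegree ≠ 0 := by
    intro h0
    rw [hf.natDegree_eq_zero.1 h0] at hfx
    simp at hfx
  have hf' : (derivative f).natDegree < f.natDegree := natDegree_derivative_lt hd0
  have hf'0 : derivative f ≠ 0 := by
    intro h0
    apply hd0
    rw [← natDegree_map_eq_of_injective hinj, ← derivative_eq_zero, derivative_map, h0,
      Polynomial.map_zero]
  let A' := insert (derivative f) A
  have hA' : ∀ Q ∈ A', Q.natDegree < f.natDegree := by
    intro Q hQ
    rcases Finset.mem_insert.1 hQ with rfl | hQ
    · exact hf'
    · exact hA Q hQ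
  let B := (A' ×ˢ Finset.range f.natDegree).image (fun q => derivative^[q.2] q.1)
  have hB : ∀ Q ∈ B, Q.natDegree < f.natDegree := by
    intro Q hQ
    obtain ⟨⟨P, k⟩, h1, rfl⟩ := Finset.mem_image.1 hQ
    rw [Finset.mem_product] at h1
    exact (natDegree_iterate_derivative P k).trans_lt
      (lt_of_le_of_lt (Nat.sub_le _ _) (hA' P h1.1))
  let Z := B.biUnion (fun Q => (Q.map G.fstHom).roots.toFinset)
  have hZ : ∀ z, z ∈ Z ↔ ∃ Q ∈ B, Q ≠ 0 ∧ Q.eval₂ G.fstHom z = 0 := by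
    intro z
    simp [Z, Polynomial.map_eq_zero_iff hinj, eval_map]
  have hBmem : ∀ Q ∈ A', ∀ k, derivative^[k] Q ≠ 0 → derivative^[k] Q ∈ B := by
    intro Q hQ k hk
    refine Finset.mem_image.2 ⟨(Q, k), Finset.mem_product.2 ⟨hQ, ?_⟩, rfl⟩
    by_contra h
    simp only [Finset.mem_range, not_lt] at h
    exact hk (iterate_derivative_eq_zero ((hA' Q hQ).trans_le h))
  have hxZ : x ∉ Z := by
    rw [hZ]
    rintro ⟨Q, h1, h2, h3⟩
    exact hmin Q h2 (hB Q h1) h3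
  obtain ⟨G', hGG', hG', -, hZG'⟩ := hd.finset Z G hG hI (fun z hz => by
    obtain ⟨Q, h1, h2, h3⟩ := (hZ z).1 hz
    exact ⟨Q, h2, hB Q h1, h3⟩)
  obtain ⟨b, hb, hxb⟩ : ∃ b : R × S, b ∈ G ∧ |x| < b.1 := by
    refine ⟨(1 + ∑ i ∈ Finset.range f.natDegree, (f.coeff i * f.coeff i + 1) : G),
      Subtype.property _, ?_⟩
    have := (hf.map G.fstHom).abs_lt_of_eval_eq_zero (x := x) (by rw [eval_map]; exact hfx)
    rw [natDegree_map_eq_of_injective hinj] at this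
    refine this.trans_le (le_of_eq ?_)
    change _ = G.fstHom (1 + ∑ i ∈ Finset.range f.natDegree, (f.coeff i * f.coeff i + 1))
    simp only [map_add, map_one, map_sum, map_mul, coeff_map]
  rw [abs_lt] at hxb
  obtain ⟨u, v, hu, hv, hux, hxv, hgap⟩ := exists_gap Z hxb.1 hxb.2 hxZ
  obtain ⟨u', hu'⟩ : ∃ u', (u, u') ∈ G' := by
    rcases hu with rfl | hu
    · exact ⟨-b.2, hGG' (neg_mem hb)⟩
    · exact hZG' u hu
  obtain ⟨v', hv'⟩ : ∃ v', (v, v') ∈ G' := by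
    rcases hv with rfl | hv
    · exact ⟨b.2, hGG' hb⟩
    · exact hZG' v hv
  have huv' : u' < v' := by
    have := hG' _ (sub_mem hv' hu')
    simp only [Prod.fst_sub, Prod.snd_sub, sub_pos] at this
    exact this.1 (hux.trans hxv)
  let ι := Subring.inclusion hGG'
  have hι : Function.Injective ι := Subring.inclusion_injective hGG'
  have e1 : ∀ (P : G[X]) t, (P.map ι).eval₂ G'.fstHom t = P.eval₂ G.fstHom t := by
    intro P t; rw [eval₂_map]; rfl
  have e2 : ∀ (P : G[X]) t, (P.map ι).eval₂ G'.sndHom t = P.eval₂ G.sndHom t := by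
    intro P t; rw [eval₂_map]; rfl
  have hnoroot : ∀ Q ∈ A', ∀ k t, derivative^[k] Q ≠ 0 → u < t → t < v →
      (derivative^[k] Q).eval₂ G.fstHom t ≠ 0 := by
    intro Q hQ k t h0 h1 h2 h3
    exact hgap t ((hZ t).2 ⟨_, hBmem Q hQ k h0, h0, h3⟩) h1 h2
  have hpos : ∀ Q ∈ A', 0 < Q.eval₂ G.fstHom x → ∀ y, u' < y → y < v' →
      0 < Q.eval₂ G.sndHom y := by
    intro Q hQ h y h1 h2
    rw [← e2]
    refine pos_of_pos hR hS hG' hu' hv' hux hxv _ (Q.map ι) le_rfl ?_ (by rwa [e1]) y h1 h2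
    intro k t
    rw [iterate_derivative_map, Ne, Polynomial.map_eq_zero_iff hι, e1]
    exact hnoroot Q hQ k t
  have hneg : ∀ Q ∈ A', Q.eval₂ G.fstHom x < 0 → ∀ y, u' < y → y < v' →
      Q.eval₂ G.sndHom y < 0 := by
    intro Q hQ h y h1 h2
    rw [← neg_pos, ← eval₂_neg, ← e2]
    refine pos_of_pos hR hS hG' hu' hv' hux hxv _ ((-Q).map ι) le_rfl ?_
      (by rw [e1, eval₂_neg]; linarith) y h1 h2
    intro k t
    rw [iterate_derivative_map, Ne, Polynomial.map_eq_zero_iff hι, e1, iterate_derivative_neg,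
      neg_eq_zero, eval₂_neg, neg_ne_zero]
    exact hnoroot Q hQ k t
  have hslope : ∀ a b, u ≤ a → a < b → b ≤ v → ∃ c, u < c ∧ c < v ∧
      f.eval₂ G.fstHom b - f.eval₂ G.fstHom a =
        (derivative f).eval₂ G.fstHom c * (b - a) := by
    intro a b h1 h2 h3
    obtain ⟨c, h4, h5, h6⟩ := hR.exists_derivative_eq_slope (f.map G.fstHom) h2
    rw [derivative_map, eval_map, eval_map, eval_map] at h6
    exact ⟨c, h1.trans_lt h4, h5.trans_le h3, h6⟩
  have hder : ∀ c c', u < c → c < v → u < c' → c' < v → 0 <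
      (derivative f).eval₂ G.fstHom c * (derivative f).eval₂ G.fstHom c' := by
    intro c c' h1 h2 h3 h4
    wlog hcc : c ≤ c' generalizing c c'
    · rw [mul_comm]
      exact this c' c h3 h4 h1 h2 (le_of_not_ge hcc)
    by_contra! h
    obtain ⟨t, h5, h6, h7⟩ := hR.exists_root_of_mul_nonpos ((derivative f).map G.fstHom) hcc
      (by rwa [eval_map, eval_map])
    rw [eval_map] at h7
    exact hnoroot _ (Finset.mem_insert_self _ _) 0 t hf'0 (h1.trans_le h5) (h6.trans_lt h4) h7
  have hsign : f.eval₂ G.fstHom u * f.eval₂ G.fstHom v < 0 := by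
    obtain ⟨c, h1, h2, h3⟩ := hslope u x le_rfl hux hxv.le
    obtain ⟨c', h1', h2', h3'⟩ := hslope x v hux.le hxv le_rfl
    rw [hfx] at h3 h3'
    have h5 : f.eval₂ G.fstHom u = -((derivative f).eval₂ G.fstHom c * (x - u)) := by linarith
    have h6 : f.eval₂ G.fstHom v = (derivative f).eval₂ G.fstHom c' * (v - x) := by linarith
    rw [h5, h6]
    have := mul_pos (hder c c' h1 h2 h1' h2') (mul_pos (sub_pos.2 hux) (sub_pos.2 hxv))
    linarith
  have hsign' : f.eval₂ G.sndHom u' * f.eval₂ G.sndHom v' < 0 := by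
    have h1 := mul_mem (eval₂_mem hu' (f.map ι)) (eval₂_mem hv' (f.map ι))
    rw [e1, e1, e2, e2] at h1
    exact (hG'.neg_iff h1).1 hsign
  obtain ⟨y, hy1, hy2, hy3⟩ := hS.exists_root_of_mul_nonpos (f.map G.sndHom) huv'.le
    (by rw [eval_map, eval_map]; exact hsign'.le)
  rw [eval_map] at hy3
  have hy1' : u' < y := lt_of_le_of_ne hy1 (by rintro rfl; rw [hy3] at hsign'; simp at hsign')
  have hy2' : y < v' := lt_of_le_of_ne hy2 (by rintro rfl; rw [hy3] at hsign'; simp at hsign')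
  refine ⟨y, hy3, fun Q hQ => ?_⟩
  have hQ' : Q ∈ A' := Finset.mem_insert_of_mem hQ
  rcases eq_or_ne Q 0 with rfl | hQ0
  · simp
  have hQx := hmin Q hQ0 (hA Q hQ)
  refine ⟨fun h => hpos Q hQ' h y hy1' hy2', fun h => ?_⟩
  by_contra! h'
  exact absurd (hneg Q hQ' (lt_of_le_of_ne h' hQx) y hy1' hy2') (not_lt.2 h.le)

end IsSignRing

theorem canAdjoinRoots (hR : PolyIVT R) (hS : PolyIVT S) (d : ℕ) : CanAdjoinRoots R S d := by
  classical
  induction d with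
  | zero => exact fun _ _ _ _ _ _ h => absurd h (Nat.not_lt_zero _)
  | succ d ih =>
  intro G hG hI x P hP0 hPd hPx
  by_cases hmin : ∃ Q : G[X], Q ≠ 0 ∧ Q.natDegree < P.natDegree ∧ Q.eval₂ G.fstHom x = 0
  · obtain ⟨Q, h1, h2, h3⟩ := hmin
    exact ih G hG hI x Q h1 (by omega) h3
  push Not at hmin
  by_cases hPd' : P.natDegree < d
  · exact ih G hG hI x P hP0 hPd' hPx
  have hPd : P.natDegree = d := by omega
  have hinj := hG.fstHom_injective
  have hlc : G.fstHom P.leadingCoeff ≠ 0 := by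
    rw [Ne, map_eq_zero_iff _ hinj]
    exact leadingCoeff_ne_zero.2 hP0
  let c : G := ⟨_, hI _ P.leadingCoeff.2 hlc⟩
  have hc : P.leadingCoeff * c = 1 := by
    apply hinj
    rw [map_mul, map_one]
    exact mul_inv_cancel₀ hlc
  have hf : (P * C c).Monic := monic_mul_C_of_leadingCoeff_mul_eq_one hc
  have hfd : (P * C c).natDegree = P.natDegree := natDegree_mul_C_eq_of_mul_ne_zero (by
    rw [hc]; exact one_ne_zero)
  set f := P * C c
  have hfx : f.eval₂ G.fstHom x = 0 := by simp [f, eval₂_mul, hPx]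
  rw [← hfd] at hmin
  clear_value f
  have hex : ∃ y, f.eval₂ G.sndHom y = 0 ∧ ∀ Q : G[X], Q.natDegree < f.natDegree →
      (0 < Q.eval₂ G.fstHom x ↔ 0 < Q.eval₂ G.sndHom y) := by
    by_contra hcon
    have : ∀ y, ∃ Q : G[X], f.eval₂ G.sndHom y = 0 → Q.natDegree < f.natDegree ∧
        ¬ (0 < Q.eval₂ G.fstHom x ↔ 0 < Q.eval₂ G.sndHom y) := by
      intro y
      by_cases hy : f.eval₂ G.sndHom y = 0
      · by_contra! h
        exact hcon ⟨y, hy, fun Q hQ => by_contra fun h' => h' ((h Q).2 hQ)⟩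
      · exact ⟨0, fun h => absurd h hy⟩
    choose q hq using this
    have hroots : ∀ y, y ∈ (f.map G.sndHom).roots.toFinset ↔ f.eval₂ G.sndHom y = 0 := by
      intro y
      have := (hf.map G.sndHom).ne_zero
      simp [this, eval_map]
    obtain ⟨y, h1, h2⟩ := hG.exists_root_same_signs hR hS hI hf hfx hmin
      (by rw [hfd, hPd]; exact ih) ((f.map G.sndHom).roots.toFinset.image q) (by
        intro Q hQ
        obtain ⟨y, h1, rfl⟩ := Finset.mem_image.1 hQ
        exact (hq y ((hroots y).1 h1)).1)
    exact (hq y h1).2 (h2 _ (Finset.mem_image_of_mem _ ((hroots y).2 h1)))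
  obtain ⟨y, hy, hsame⟩ := hex
  obtain ⟨G', h1, h2, h3, h4⟩ := IsSignRing.exists_adjoin (G := G) (RingHom.id S) x y (by
    intro Q
    have hQ : Q = Q %ₘ f + f * (Q /ₘ f) := (modByMonic_add_div Q f).symm
    rw [RingHom.id_comp, hQ, eval₂_add, eval₂_add, eval₂_mul, eval₂_mul, hy, hfx, zero_mul,
      zero_mul, add_zero, add_zero]
    refine hsame _ (natDegree_modByMonic_lt Q hf ?_)
    intro h1
    rw [h1] at hfx
    simp at hfx)
  exact ⟨G', h1, h2, h3, y, h4⟩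

end

end

section

open Polynomial

section

variable {R S : Type} [Field R] [LinearOrder R] [IsStrictOrderedRing R]
  [Field S] [LinearOrder S] [IsStrictOrderedRing S]

theorem PolyIVT.map_pos_iff (hR : PolyIVT R) (ι : R →+* S) (a : R) : 0 < ι a ↔ 0 < a := by
  have key : ∀ a, 0 ≤ a → 0 ≤ ι a := by
    intro a ha
    obtain ⟨b, -, rfl⟩ := hR.exists_sqrt ha
    rw [map_mul]
    exact mul_self_nonneg _
  constructor
  · intro h
    by_contra! h'
    have := key (-a) (neg_nonneg.2 h')
    rw [map_neg] at this
    linarith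
  · intro h
    exact lt_of_le_of_ne (key a h.le) (fun h' => h.ne' ((map_eq_zero ι).1 h'.symm))

theorem PolyIVT.isSignRing_range_prod {K : Type} [Field K] [LinearOrder K]
    [IsStrictOrderedRing K] (hK : PolyIVT K) (ι : K →+* R) (κ : K →+* S) :
    IsSignRing (ι.prod κ).range ∧ IsInvClosed (ι.prod κ).range := by
  constructor
  · rintro _ ⟨a, rfl⟩
    exact (hK.map_pos_iff ι a).trans (hK.map_pos_iff κ a).symm
  · rintro _ ⟨a, rfl⟩ -
    exact ⟨a⁻¹, by simp⟩

theorem PolyIVT.mem_range_of_algebraic (hR : PolyIVT R) (hS : PolyIVT S) (ι : R →+* S) {x : S}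
    {p : R[X]} (hp : p ≠ 0) (hx : p.eval₂ ι x = 0) : x ∈ ι.range := by
  obtain ⟨h1, h2⟩ := hR.isSignRing_range_prod ι (RingHom.id R)
  let j : R →+* (ι.prod (RingHom.id R)).range := (ι.prod (RingHom.id R)).rangeRestrict
  have hj : Function.Injective j := fun a b h => by
    have := congrArg (fun u : (ι.prod (RingHom.id R)).range => (u : S × R).2) h
    exact this
  obtain ⟨G, h3, h4, -, y, hy⟩ := canAdjoinRoots hS hR _ _ h1 h2 x (p.map j)
    (by rwa [Ne, Polynomial.map_eq_zero_iff hj]) (Nat.lt_succ_self _) (by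
      rw [eval₂_map]
      exact hx)
  have h5 := sub_mem hy (h3 ⟨y, rfl⟩)
  have h6 := (h4.zero_iff h5).2 (by simp)
  exact ⟨y, (sub_eq_zero.1 (by simpa using h6)).symm⟩

theorem exists_same_side (G : Subring (R × S)) (hI : IsInvClosed G) (Z : Finset R)
    (hZ : ∀ z ∈ Z, ∃ y, (z, y) ∈ G) {x : R} (hx : x ∉ Z) :
    ∃ w : R × S, w ∈ G ∧ ∀ z ∈ Z, (z < x → z < w.1) ∧ (x < z → w.1 < z) := by
  classical
  rcases Z.eq_empty_or_nonempty with rfl | hne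
  · exact ⟨0, zero_mem _, by simp⟩
  by_cases h1 : x < Z.min' hne
  · obtain ⟨y, hy⟩ := hZ _ (Z.min'_mem hne)
    refine ⟨(Z.min' hne, y) - 1, sub_mem hy (one_mem _), fun z hz => ?_⟩
    have := Z.min'_le z hz
    refine ⟨fun h => absurd h (not_lt.2 (h1.le.trans this)), fun _ => ?_⟩
    simp only [Prod.fst_sub, Prod.fst_one]
    linarith
  by_cases h2 : Z.max' hne < x
  · obtain ⟨y, hy⟩ := hZ _ (Z.max'_mem hne)
    refine ⟨(Z.max' hne, y) + 1, add_mem hy (one_mem _), fun z hz => ?_⟩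
    have := Z.le_max' z hz
    refine ⟨fun h => ?_, fun h => absurd h (not_lt.2 (this.trans h2.le))⟩
    simp only [Prod.fst_add, Prod.fst_one]
    linarith
  have h1' : Z.min' hne < x :=
    lt_of_le_of_ne (not_lt.1 h1) (by rintro rfl; exact hx (Z.min'_mem hne))
  have h2' : x < Z.max' hne :=
    lt_of_le_of_ne (not_lt.1 h2) (by rintro rfl; exact hx (Z.max'_mem hne))
  obtain ⟨u, v, hu, hv, hux, hxv, hgap⟩ := exists_gap Z h1' h2' hx
  obtain ⟨u', hu'⟩ := hZ u (by rcases hu with rfl | hu; exacts [Z.min'_mem hne, hu])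
  obtain ⟨v', hv'⟩ := hZ v (by rcases hv with rfl | hv; exacts [Z.max'_mem hne, hv])
  have htwo : (((2 : R)⁻¹, (2 : S)⁻¹) : R × S) ∈ G :=
    hI (2 : R × S) (ofNat_mem G 2) (by simp)
  refine ⟨_, mul_mem (add_mem hu' hv') htwo, fun z hz => ?_⟩
  have h4 : u < (u + v) * 2⁻¹ := by linarith
  have h5 : (u + v) * 2⁻¹ < v := by linarith
  have h3 := hgap z hz
  constructor
  · intro h
    refine lt_of_le_of_lt ?_ h4
    by_contra! h'
    exact h3 h' (h.trans hxv)
  · intro h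
    refine lt_of_lt_of_le h5 ?_
    by_contra! h'
    exact h3 (hux.trans h) h'

theorem IsSignRing.exists_same_signs (hR : PolyIVT R) (hS : PolyIVT S) {G : Subring (R × S)}
    (hG : IsSignRing G) (hI : IsInvClosed G) {x : R}
    (hx : ∀ Q : G[X], Q ≠ 0 → Q.eval₂ G.fstHom x ≠ 0) (A : Finset G[X]) :
    ∃ y, ∀ Q ∈ A, 0 < Q.eval₂ G.fstHom x ↔ 0 < Q.eval₂ G.sndHom y := by
  classical
  have hinj := hG.fstHom_injective
  let Z := A.biUnion (fun Q => (Q.map G.fstHom).roots.toFinset)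
  have hZ : ∀ z, z ∈ Z ↔ ∃ Q ∈ A, Q ≠ 0 ∧ Q.eval₂ G.fstHom z = 0 := by
    intro z
    simp [Z, Polynomial.map_eq_zero_iff hinj, eval_map]
  have hxZ : x ∉ Z := by
    rw [hZ]
    rintro ⟨Q, h1, h2, h3⟩
    exact hx Q h2 h3
  obtain ⟨G', hGG', hG', hI', hZG'⟩ := (canAdjoinRoots hR hS (A.sup natDegree + 1)).finset Z G hG
    hI (fun z hz => by
      obtain ⟨Q, h1, h2, h3⟩ := (hZ z).1 hz
      exact ⟨Q, h2, Nat.lt_succ_of_le (Finset.le_sup (f := natDegree) h1), h3⟩)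
  obtain ⟨w, hw, hside⟩ := exists_same_side G' hI' Z hZG' hxZ
  refine ⟨w.2, fun Q hQ => ?_⟩
  rcases eq_or_ne Q 0 with rfl | hQ0
  · simp
  have h1 := hG' _ (eval₂_mem hw (Q.map (Subring.inclusion hGG')))
  simp only [eval₂_map] at h1
  refine Iff.trans ?_ h1
  change 0 < Q.eval₂ G.fstHom x ↔ 0 < Q.eval₂ G.fstHom w.1
  rw [← eval_map, ← eval_map]
  rcases le_total x w.1 with h | h
  · refine hR.pos_iff _ h (fun c h2 h3 h4 => ?_)
    have hc : c ∈ Z := (hZ c).2 ⟨Q, hQ, hQ0, by rwa [← eval_map]⟩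
    exact absurd ((hside c hc).2 (lt_of_le_of_ne h2 (by rintro rfl; exact hxZ hc))) (not_lt.2 h3)
  · refine (hR.pos_iff _ h (fun c h2 h3 h4 => ?_)).symm
    have hc : c ∈ Z := (hZ c).2 ⟨Q, hQ, hQ0, by rwa [← eval_map]⟩
    exact absurd ((hside c hc).1 (lt_of_le_of_ne h3 (by rintro rfl; exact hxZ hc))) (not_lt.2 h2)

open Filter in
theorem IsSignRing.exists_ultrafilter (hR : PolyIVT R) (hS : PolyIVT S) {G : Subring (R × S)}
    (hG : IsSignRing G) (hI : IsInvClosed G) {x : R}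
    (hx : ∀ Q : G[X], Q ≠ 0 → Q.eval₂ G.fstHom x ≠ 0) :
    ∃ φ : Ultrafilter S, ∀ Q : G[X],
      0 < Q.eval₂ G.fstHom x ↔ ∀ᶠ y in (φ : Filter S), 0 < Q.eval₂ G.sndHom y := by
  have hne : (⨅ Q : G[X], 𝓟 {y | 0 < Q.eval₂ G.fstHom x ↔ 0 < Q.eval₂ G.sndHom y}).NeBot := by
    classical
    rw [iInf_eq_iInf_finset]
    refine iInf_neBot_of_directed ?_ ?_
    · intro s t
      refine ⟨s ∪ t, ?_, ?_⟩ <;>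
      · refine biInf_mono fun i hi => ?_
        simp [hi]
    · intro s
      obtain ⟨y, hy⟩ := hG.exists_same_signs hR hS hI hx s
      have : pure y ≤ ⨅ Q ∈ s, 𝓟 {y | 0 < Q.eval₂ G.fstHom x ↔ 0 < Q.eval₂ G.sndHom y} := by
        simp only [le_iInf_iff, le_principal_iff, mem_pure]
        exact hy
      exact neBot_of_le this
  obtain ⟨φ, hφ⟩ : ∃ φ : Ultrafilter S, ∀ Q : G[X], ∀ᶠ y in (φ : Filter S),
      (0 < Q.eval₂ G.fstHom x ↔ 0 < Q.eval₂ G.sndHom y) :=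
    ⟨Ultrafilter.of _, fun Q =>
      Ultrafilter.of_le _ (mem_iInf_of_mem Q (mem_principal_self _))⟩
  refine ⟨φ, fun Q => ?_⟩
  have h1 := hφ Q
  constructor
  · intro h
    filter_upwards [h1] with y hy using hy.1 h
  · intro h
    obtain ⟨y, hy1, hy2⟩ := (h.and h1).exists
    exact hy2.2 hy1

open Filter in
theorem IsSignRing.exists_adjoin_germ (hR : PolyIVT R) (hS : PolyIVT S) {G : Subring (R × S)}
    (hG : IsSignRing G) (hI : IsInvClosed G) {x : R}
    (hx : ∀ Q : G[X], Q ≠ 0 → Q.eval₂ G.fstHom x ≠ 0) :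
    ∃ (φ : Ultrafilter S) (G' : Subring (R × Germ (φ : Filter S) S)),
      (∀ g ∈ G, (g.1, (↑g.2 : Germ (φ : Filter S) S)) ∈ G') ∧ IsSignRing G' ∧
        IsInvClosed G' ∧ ∃ y, (x, y) ∈ G' := by
  obtain ⟨φ, hφ⟩ := hG.exists_ultrafilter hR hS hI hx
  let j : S →+* Germ (φ : Filter S) S :=
    (Filter.Germ.coeRingHom (φ : Filter S)).comp (Pi.constRingHom S S)
  obtain ⟨G', h1, h2, h3, h4⟩ := IsSignRing.exists_adjoin (G := G) j x
    ((id : S → S) : Germ (φ : Filter S) S) (by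
      intro Q
      rw [hφ Q]
      have : Q.eval₂ (j.comp G.sndHom) ((id : S → S) : Germ (φ : Filter S) S) =
          ((fun y => Q.eval₂ G.sndHom y : S → S) : Germ (φ : Filter S) S) := by
        have h := hom_eval₂ Q ((Pi.constRingHom S S).comp G.sndHom)
          (Filter.Germ.coeRingHom (φ : Filter S)) (id : S → S)
        refine h.symm.trans ?_
        refine congrArg (fun u : S → S => (u : Germ (φ : Filter S) S)) (funext fun y => ?_)
        exact hom_eval₂ Q ((Pi.constRingHom S S).comp G.sndHom) (Pi.evalRingHom _ y) (id : S → S)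
      rw [this]
      exact Germ.coe_lt.symm)
  exact ⟨φ, G', h1, h2, h3, _, h4⟩

end

end

section

variable {R : Type} [Field R] [LinearOrder R] [IsStrictOrderedRing R]

open Filter in
theorem exists_signRing_containing (hR : PolyIVT R) {V : Type} (ι : ℝ →+* R) (x : V → R)
    (s : Finset V) :
    ∃ (S : Type) (_ : Field S) (_ : LinearOrder S) (_ : IsStrictOrderedRing S) (κ : ℝ →+* S)
      (G : Subring (R × S)), PolyIVT S ∧ IsSignRing G ∧ IsInvClosed G ∧
      (∀ r, (ι r, κ r) ∈ G) ∧
      (∀ p : MvPolynomial V ℝ, (∃ y, p.eval₂ κ y = 0) → ∃ z, MvPolynomial.eval z p = 0) ∧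
      ∀ i ∈ s, ∃ y, (x i, y) ∈ G := by
  classical
  induction s using Finset.induction_on with
  | empty =>
    obtain ⟨h1, h2⟩ := polyIVT_real.isSignRing_range_prod ι (RingHom.id ℝ)
    exact ⟨ℝ, inferInstance, inferInstance, inferInstance, RingHom.id ℝ, _, polyIVT_real, h1, h2,
      fun r => ⟨r, rfl⟩, fun p hp => hp, by simp⟩
  | insert i s hi ih =>
    obtain ⟨S, _, _, _, κ, G, hS, hG, hI, hκ, hp, hs⟩ := ih
    by_cases halg : ∃ Q : Polynomial G, Q ≠ 0 ∧ Q.eval₂ G.fstHom (x i) = 0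
    · obtain ⟨Q, hQ, hQx⟩ := halg
      obtain ⟨G', h1, h2, h3, h4⟩ := canAdjoinRoots hR hS _ G hG hI (x i) Q hQ
        (Nat.lt_succ_self _) hQx
      refine ⟨S, _, _, ‹_›, κ, G', hS, h2, h3, fun r => h1 (hκ r), hp, fun k hk => ?_⟩
      rcases Finset.mem_insert.1 hk with rfl | hk
      · exact h4
      · obtain ⟨y, hy⟩ := hs k hk
        exact ⟨y, h1 hy⟩
    · push Not at halg
      obtain ⟨φ, G', h1, h2, h3, h4⟩ := hG.exists_adjoin_germ hR hS hI halg
      let k : (S → S) →+* Germ (φ : Filter S) S := Filter.Germ.coeRingHom (φ : Filter S)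
      refine ⟨Germ (φ : Filter S) S, inferInstance, inferInstance, inferInstance,
        k.comp ((Pi.constRingHom S S).comp κ), G', Filter.Germ.polyIVT φ hS, h2, h3,
        fun r => h1 _ (hκ r), ?_, fun k hk => ?_⟩
      · rintro p ⟨y, hy⟩
        have : ∀ i, ∃ f : S → S, k f = y i := fun i => Quotient.exists_rep _
        choose f hf using this
        obtain rfl : k ∘ f = y := funext hf
        rw [← MvPolynomial.eval₂_comp_left] at hy
        have h5 : ∀ᶠ t in (φ : Filter S),
            (MvPolynomial.eval₂ ((Pi.constRingHom S S).comp κ) f p) t = 0 :=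
          Germ.coe_eq.1 hy
        obtain ⟨t, ht⟩ := h5.exists
        apply hp
        refine ⟨fun i => f i t, ?_⟩
        rw [← ht]
        exact (MvPolynomial.eval₂_comp_left (Pi.evalRingHom (fun _ => S) t)
          ((Pi.constRingHom S S).comp κ) f p).symm
      · rcases Finset.mem_insert.1 hk with rfl | hk
        · exact h4
        · obtain ⟨y, hy⟩ := hs k hk
          exact ⟨_, h1 _ hy⟩

/-- A real polynomial system solvable over an ordered field with the intermediate value property
is solvable over the reals. -/
theorem PolyIVT.exists_real_zero (hR : PolyIVT R) {V : Type} [Finite V] (ι : ℝ →+* R) (x : V → R)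
    (A : Set (MvPolynomial V ℝ)) (hx : ∀ p ∈ A, p.eval₂ ι x = 0) :
    ∃ z : V → ℝ, ∀ p ∈ A, MvPolynomial.eval z p = 0 := by
  cases nonempty_fintype V
  obtain ⟨S, _, _, _, κ, G, hS, hG, hI, hκ, hp, hs⟩ :=
    exists_signRing_containing hR ι x Finset.univ
  choose y hy using fun i => hs i (Finset.mem_univ i)
  obtain ⟨t, ht⟩ := (isNoetherianRing_iff_ideal_fg (MvPolynomial V ℝ)).1 inferInstance
    (Ideal.span A)
  have hxt : ∀ p ∈ t, p.eval₂ ι x = 0 := by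
    intro p hp
    have h1 : Ideal.span A ≤ RingHom.ker (MvPolynomial.eval₂Hom ι x) := Ideal.span_le.2 hx
    exact h1 (ht ▸ Ideal.subset_span hp)
  have hmem : ∀ p : MvPolynomial V ℝ, (p.eval₂ ι x, p.eval₂ κ y) ∈ G := by
    intro p
    induction p using MvPolynomial.induction_on with
    | C a => simpa using hκ a
    | add p q hp hq => simpa using add_mem hp hq
    | mul_X p i hp => simpa [MvPolynomial.eval₂_mul] using mul_mem hp (hy i)
  obtain ⟨z, hz⟩ := hp (∑ p ∈ t, p * p) ⟨y, (hG.zero_iff (hmem _)).1 (by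
    rw [MvPolynomial.eval₂_sum]
    exact Finset.sum_eq_zero fun p hp => by rw [MvPolynomial.eval₂_mul, hxt p hp, zero_mul])⟩
  refine ⟨z, fun p hp => ?_⟩
  rw [map_sum, Finset.sum_eq_zero_iff_of_nonneg (fun p _ => by
    rw [map_mul]; exact mul_self_nonneg _)] at hz
  have h1 : Ideal.span (t : Set (MvPolynomial V ℝ)) ≤ RingHom.ker (MvPolynomial.eval z) :=
    Ideal.span_le.2 fun q hq => by
      have := hz q hq
      rw [map_mul, mul_self_eq_zero] at this
      exact this
  exact h1 (ht ▸ Ideal.subset_span hp)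

end

section

open Polynomial

/-- Newton's identities relating the reverse characteristic polynomial to power traces. -/
def IsNewton {R : Type} [CommRing R] (E : R[X]) (t : ℕ → R) : Prop :=
  E.coeff 0 = 1 ∧ ∀ k, ((k + 1 : ℕ) : R) * E.coeff (k + 1) =
    -∑ p ∈ Finset.HasAntidiagonal.antidiagonal k, E.coeff p.1 * t (p.2 + 1)

/-- An algebra with positive involution and a trace that behaves like that of a subalgebra of the
`n × n` matrices. -/
structure IsTraceAlgebra {R A : Type} [Field R] [LinearOrder R] [Ring A] [Algebra R A]
    [StarRing A] (τ : A →ₗ[R] R) (n : ℕ) : Prop where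
  star_smul : ∀ (r : R) (a : A), star (r • a) = r • star a
  trace_comm : ∀ a b, τ (a * b) = τ (b * a)
  trace_star : ∀ a, τ (star a) = τ a
  trace_pos : ∀ a, a ≠ 0 → 0 < τ (a * star a)
  exists_monic : ∀ a : A, ∃ χ : R[X], χ.Monic ∧ aeval a χ = 0
  exists_newton : ∀ a : A, ∃ E : R[X], IsNewton E (fun k => τ (a ^ k))
  exists_newton_sq : ∀ a b : A, star a = -a → star b = -b →
    ∃ q : R[X], q.coeff 0 = 1 ∧ IsNewton (q * q) (fun k => τ ((a * b) ^ k))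
  trace_one : τ 1 = n

section Newton

variable {R : Type} [Field R] [CharZero R]

theorem IsNewton.exists_nat_of_const {E : R[X]} {m : R} (h : IsNewton E (fun _ => m)) :
    ∃ k : ℕ, m = k := by
  have hE0 : E ≠ 0 := by
    rintro rfl
    simpa using h.1
  have hrec : ∀ k, ((k + 1 : ℕ) : R) * E.coeff (k + 1) = (k - m) * E.coeff k := by
    intro k
    cases k with
    | zero =>
      have := h.2 0
      simp at this
      simp [this]
      ring
    | succ k =>
      have h1 := h.2 k
      have h2 := h.2 (k + 1)
      rw [Finset.Nat.sum_antidiagonal_succ'] at h2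
      push_cast at h1 h2 ⊢
      linear_combination h2 - h1
  refine ⟨E.natDegree, ?_⟩
  have h1 := hrec E.natDegree
  rw [coeff_eq_zero_of_natDegree_lt (Nat.lt_succ_self _), mul_zero] at h1
  have h2 := (mul_eq_zero.1 h1.symm).resolve_right (leadingCoeff_ne_zero.2 hE0)
  exact (sub_eq_zero.1 h2).symm

theorem exists_even_of_recurrence {q : R[X]} {μ : R} (h0 : q.coeff 0 = 1) (h1 : q.coeff 1 = 0)
    (hrec : ∀ k : ℕ, ((k + 2 : ℕ) : R) * q.coeff (k + 2) = (μ - k) * q.coeff k) :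
    ∃ l : ℕ, μ = 2 * l := by
  have hodd : ∀ k, q.coeff (2 * k + 1) = 0 := by
    intro k
    induction k with
    | zero => exact h1
    | succ k ih =>
      have := hrec (2 * k + 1)
      rw [ih, mul_zero, mul_eq_zero] at this
      exact this.resolve_left (Nat.cast_ne_zero.2 (by omega))
  have hq0 : q ≠ 0 := by
    rintro rfl
    simp at h0
  have h2 := hrec q.natDegree
  rw [coeff_eq_zero_of_natDegree_lt (by omega), mul_zero] at h2
  have h3 := (mul_eq_zero.1 h2.symm).resolve_right (leadingCoeff_ne_zero.2 hq0)
  rcases Nat.even_or_odd' q.natDegree with ⟨l, hl | hl⟩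
  · refine ⟨l, ?_⟩
    rw [sub_eq_zero.1 h3, hl]
    push_cast
    ring
  · have := hodd l
    rw [← hl] at this
    exact absurd this (leadingCoeff_ne_zero.2 hq0)

theorem IsNewton.recurrence {E : R[X]} {m : R} {t : ℕ → R} (h : IsNewton E t) (h1 : t 1 = 0)
    (h2 : t 2 = -m) (ht : ∀ k, t (k + 3) = -t (k + 1)) :
    E.coeff 1 = 0 ∧
      ∀ k : ℕ, ((k + 2 : ℕ) : R) * E.coeff (k + 2) = (m - k) * E.coeff k := by
  have hE1 : E.coeff 1 = 0 := by
    have := h.2 0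
    simpa [h1] using this
  refine ⟨hE1, fun k => ?_⟩
  cases k with
  | zero =>
    have := h.2 1
    simp [Finset.Nat.antidiagonal_succ, h1, h2, hE1] at this
    simp only [zero_add, Nat.cast_ofNat, CharP.cast_eq_zero, sub_zero]
    linear_combination this
  | succ k =>
    have h3 := h.2 (k + 2)
    have h4 := h.2 k
    rw [Finset.Nat.sum_antidiagonal_succ', Finset.Nat.sum_antidiagonal_succ'] at h3
    simp only [zero_add, h1] at h3
    have h5 : ∀ j, t (j + 1 + 1 + 1) = -t (j + 1) := ht
    simp only [h5, h2, one_add_one_eq_two, mul_neg, Finset.sum_neg_distrib] at h3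
    push_cast at h3 h4 ⊢
    linear_combination h3 + h4

theorem IsNewton.exists_even {E : R[X]} {m : R} {t : ℕ → R} (h : IsNewton E t) (h1 : t 1 = 0)
    (h2 : t 2 = -m) (ht : ∀ k, t (k + 3) = -t (k + 1)) : ∃ l : ℕ, m = 2 * l :=
  exists_even_of_recurrence h.1 (h.recurrence h1 h2 ht).1 (h.recurrence h1 h2 ht).2

theorem IsNewton.exists_four {q : R[X]} {m : R} {t : ℕ → R} (hq : q.coeff 0 = 1)
    (h : IsNewton (q * q) t) (h1 : t 1 = 0)
    (h2 : t 2 = -m) (ht : ∀ k, t (k + 3) = -t (k + 1)) : ∃ l : ℕ, m = 4 * l := by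
  obtain ⟨h3, h4⟩ := h.recurrence h1 h2 ht
  have hq0 : q ≠ 0 := by
    rintro rfl
    simp at hq
  have hpoly : ∀ (E : R[X]) (μ : R), (1 + X ^ 2) * derivative E = C μ * X * E ↔ E.coeff 1 = 0 ∧
      ∀ k : ℕ, ((k + 2 : ℕ) : R) * E.coeff (k + 2) = (μ - k) * E.coeff k := by
    intro E μ
    rw [Polynomial.ext_iff]
    have h0 : ((1 + X ^ 2) * derivative E).coeff 0 = E.coeff 1 := by
      simp [add_mul, coeff_derivative, mul_coeff_zero]
    have h0' : (C μ * X * E).coeff 0 = 0 := by simp [mul_assoc]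
    have h1 : ∀ k, ((1 + X ^ 2) * derivative E).coeff (k + 1) =
        ((k + 2 : ℕ) : R) * E.coeff (k + 2) + k * E.coeff k := by
      intro k
      rw [add_mul, one_mul, coeff_add, coeff_derivative, coeff_X_pow_mul']
      cases k with
      | zero => simp; ring
      | succ k => simp [coeff_derivative]; ring
    have h1' : ∀ k, (C μ * X * E).coeff (k + 1) = μ * E.coeff k := by
      intro k
      rw [mul_assoc, coeff_C_mul, coeff_X_mul]
    constructor
    · intro h
      refine ⟨by rw [← h0, h, h0'], fun k => ?_⟩
      have := h (k + 1)
      rw [h1, h1'] at this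
      linear_combination this
    · rintro ⟨h2, h3⟩ k
      cases k with
      | zero => rw [h0, h0', h2]
      | succ k =>
        rw [h1, h1']
        linear_combination h3 k
  have h5 := (hpoly _ _).2 ⟨h3, h4⟩
  have h6 : (1 + X ^ 2) * derivative q = C (m / 2) * X * q := by
    have h7 : q * (2 * ((1 + X ^ 2) * derivative q)) = q * (2 * (C (m / 2) * X * q)) := by
      rw [derivative_mul] at h5
      have h8 : C m = 2 * C (m / 2) := by
        rw [← C_ofNat, ← C_mul]
        congr 1
        field_simp
      rw [h8] at h5
      linear_combination h5
    exact mul_left_cancel₀ two_ne_zero (mul_left_cancel₀ hq0 h7)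
  obtain ⟨h9, h10⟩ := (hpoly _ _).1 h6
  obtain ⟨l, hl⟩ := exists_even_of_recurrence hq h9 h10
  exact ⟨l, by linear_combination 2 * hl⟩

end Newton

end

section

open Polynomial

/-- A minimal projection: a nonzero symmetric idempotent dominating no smaller one. -/
structure IsMinProj {A : Type} [Ring A] [StarRing A] (e : A) : Prop where
  ne_zero : e ≠ 0
  mul_self : e * e = e
  star_eq : star e = e
  eq_of_le : ∀ f : A, f ≠ 0 → f * f = f → star f = f → e * f = f → f = e

theorem IsSumSq.aeval_trace_nonneg {R A : Type} [Field R] [LinearOrder R]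
    [IsStrictOrderedRing R] [Ring A] [Algebra R A] {τ : A →ₗ[R] R} {e a : A}
    (h : ∀ p : R[X], 0 ≤ τ (e * (aeval a p * aeval a p))) {s : R[X]} (hs : IsSumSq s) :
    0 ≤ τ (e * aeval a s) := by
  induction hs with
  | zero => simp
  | sq_add p _ ih =>
    rw [map_add, mul_add, map_add τ, map_mul (aeval a)]
    exact add_nonneg (h p) ih

namespace IsTraceAlgebra

variable {R A : Type} [Field R] [LinearOrder R] [Ring A] [Algebra R A]
  [StarRing A] {τ : A →ₗ[R] R} {n : ℕ}

theorem trace_mul_star_nonneg (h : IsTraceAlgebra τ n) (a : A) : 0 ≤ τ (a * star a) := by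
  by_cases ha : a = 0
  · simp [ha]
  · exact (h.trace_pos a ha).le

theorem trace_pos_of_idempotent (h : IsTraceAlgebra τ n) {e : A} (he : e * e = e)
    (hs : star e = e) (h0 : e ≠ 0) : 0 < τ e := by
  have := h.trace_pos e h0
  rwa [hs, he] at this

theorem eq_zero_of_sq_eq_zero (h : IsTraceAlgebra τ n) {a : A} (hs : star a = a)
    (ha : a * a = 0) : a = 0 := by
  by_contra h0
  have := h.trace_pos a h0
  rw [hs, ha, map_zero] at this
  exact lt_irrefl _ this

theorem eq_zero_of_pow_eq_zero (h : IsTraceAlgebra τ n) {a : A} (hs : star a = a) {k : ℕ}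
    (ha : a ^ k = 0) : a = 0 := by
  have h2 : ∀ j, a ^ 2 ^ j = 0 → a = 0 := by
    intro j
    induction j with
    | zero => simp
    | succ j ih =>
      intro hj
      refine ih (h.eq_zero_of_sq_eq_zero (by rw [star_pow, hs]) ?_)
      rw [← pow_two, ← pow_mul, ← pow_succ, hj]
  exact h2 k (pow_eq_zero_of_le (Nat.lt_two_pow_self).le ha)

theorem star_aeval (h : IsTraceAlgebra τ n) {a : A} (hs : star a = a) (p : R[X]) :
    star (aeval a p) = aeval a p := by
  induction p using Polynomial.induction_on' with
  | add p q hp hq => rw [map_add, star_add, hp, hq]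
  | monomial k r =>
    rw [aeval_monomial, ← Algebra.smul_def, h.star_smul, star_pow, hs]

variable [IsStrictOrderedRing R]

theorem exists_nat_of_idempotent (h : IsTraceAlgebra τ n) {e : A} (he : e * e = e) :
    ∃ m : ℕ, τ e = m := by
  obtain ⟨E, h0, hE⟩ := h.exists_newton e
  refine IsNewton.exists_nat_of_const (E := E) ⟨h0, fun k => ?_⟩
  have hp : ∀ j, e ^ (j + 1) = e := fun j => IsIdempotentElem.pow_succ_eq j he
  simpa only [hp] using hE k

theorem exists_minProj_sum (h : IsTraceAlgebra τ n) (m : ℕ) : ∀ e : A, e * e = e → star e = e →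
    τ e = m → ∃ s : Finset A, (∀ x ∈ s, IsMinProj x) ∧
      (∀ x ∈ s, ∀ y ∈ s, x ≠ y → x * y = 0) ∧ ∑ x ∈ s, x = e := by
  classical
  induction m using Nat.strong_induction_on with
  | _ m ih =>
  intro e he hs hm
  by_cases h0 : e = 0
  · exact ⟨∅, by simp, by simp, by simp [h0]⟩
  by_cases hmin : IsMinProj e
  · exact ⟨{e}, by simpa using hmin, by simp, by simp⟩
  obtain ⟨f, hf0, hf, hfs, hef, hne⟩ :
      ∃ f : A, f ≠ 0 ∧ f * f = f ∧ star f = f ∧ e * f = f ∧ f ≠ e := by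
    by_contra! hcon
    exact hmin ⟨h0, he, hs, hcon⟩
  have hfe : f * e = f := by
    have := congrArg star hef
    rwa [star_mul, hfs, hs] at this
  have hg : (e - f) * (e - f) = e - f := by
    simp [sub_mul, mul_sub, he, hf, hef, hfe]
  have hgs : star (e - f) = e - f := by rw [star_sub, hs, hfs]
  have hg0 : e - f ≠ 0 := sub_ne_zero.2 (Ne.symm hne)
  obtain ⟨m1, hm1⟩ := h.exists_nat_of_idempotent hf
  obtain ⟨m2, hm2⟩ := h.exists_nat_of_idempotent hg
  have p1 := h.trace_pos_of_idempotent hf hfs hf0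
  have p2 := h.trace_pos_of_idempotent hg hgs hg0
  have hadd : m = m1 + m2 := by
    have : (m : R) = m1 + m2 := by rw [← hm, ← hm1, ← hm2, ← map_add, add_sub_cancel]
    exact_mod_cast this
  have hm1p : 0 < m1 := by rw [hm1] at p1; exact_mod_cast p1
  have hm2p : 0 < m2 := by rw [hm2] at p2; exact_mod_cast p2
  obtain ⟨s, s1, s2, s3⟩ := ih m1 (by omega) f hf hfs hm1
  obtain ⟨t, t1, t2, t3⟩ := ih m2 (by omega) (e - f) hg hgs hm2
  have hsf : ∀ x ∈ s, x * f = x ∧ f * x = x := by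
    intro x hx
    rw [← s3, Finset.mul_sum, Finset.sum_mul]
    constructor
    · rw [Finset.sum_eq_single_of_mem x hx (fun y hy hyx => s2 x hx y hy (Ne.symm hyx)),
        (s1 x hx).mul_self]
    · rw [Finset.sum_eq_single_of_mem x hx (fun y hy hyx => s2 y hy x hx hyx),
        (s1 x hx).mul_self]
  have htf : ∀ x ∈ t, x * (e - f) = x ∧ (e - f) * x = x := by
    intro x hx
    rw [← t3, Finset.mul_sum, Finset.sum_mul]
    constructor
    · rw [Finset.sum_eq_single_of_mem x hx (fun y hy hyx => t2 x hx y hy (Ne.symm hyx)),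
        (t1 x hx).mul_self]
    · rw [Finset.sum_eq_single_of_mem x hx (fun y hy hyx => t2 y hy x hx hyx),
        (t1 x hx).mul_self]
  have hst : ∀ x ∈ s, ∀ y ∈ t, x * y = 0 := by
    intro x hx y hy
    rw [← (hsf x hx).1, ← (htf y hy).2, mul_assoc, ← mul_assoc f, mul_sub, hfe, hf, sub_self,
      zero_mul, mul_zero]
  have hts : ∀ x ∈ t, ∀ y ∈ s, x * y = 0 := by
    intro x hx y hy
    rw [← (htf x hx).1, ← (hsf y hy).2, mul_assoc, ← mul_assoc (e - f), sub_mul, hef, hf,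
      sub_self, zero_mul, mul_zero]
  refine ⟨s ∪ t, ?_, ?_, ?_⟩
  · intro x hx
    exact (Finset.mem_union.1 hx).elim (s1 x) (t1 x)
  · intro x hx y hy hxy
    rcases Finset.mem_union.1 hx with hx | hx <;> rcases Finset.mem_union.1 hy with hy | hy
    · exact s2 x hx y hy hxy
    · exact hst x hx y hy
    · exact hts x hx y hy
    · exact t2 x hx y hy hxy
  · rw [Finset.sum_union, s3, t3, add_sub_cancel]
    refine Finset.disjoint_left.2 fun x hx hx' => (s1 x hx).ne_zero ?_
    rw [← (s1 x hx).mul_self, hst x hx x hx']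

theorem isProperPreordering_of_idempotent (h : IsTraceAlgebra τ n) {e a : A} (he : e * e = e)
    (hes : star e = e) (he0 : e ≠ 0) (hs : star a = a) (hea : Commute e a) :
    IsProperPreordering {p : R[X] | ∃ s, IsSumSq s ∧ e * aeval a (p - s) = 0} := by
  have hcomm : ∀ p : R[X], Commute e (aeval a p) := by
    intro p
    induction p using Polynomial.induction_on' with
    | add p q hp hq => rw [map_add]; exact hp.add_right hq
    | monomial k r =>
      rw [aeval_monomial]
      exact (show Commute e _ from (Algebra.commutes r e).symm).mul_right (hea.pow_right k)
  have hmul : ∀ p q : R[X], e * aeval a q = 0 → e * aeval a (p * q) = 0 := by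
    intro p q hq
    rw [mul_comm, map_mul, ← mul_assoc, hq, zero_mul]
  refine ⟨?_, ?_, ?_, ?_⟩
  · rintro p ⟨s, hs, hp⟩ q ⟨t, ht, hq⟩
    refine ⟨s + t, hs.add ht, ?_⟩
    rw [add_sub_add_comm, map_add, mul_add, hp, hq, add_zero]
  · rintro p ⟨s, hs, hp⟩ q ⟨t, ht, hq⟩
    refine ⟨s * t, hs.mul ht, ?_⟩
    rw [show p * q - s * t = p * (q - t) + t * (p - s) by ring, map_add, mul_add, hmul _ _ hp,
      hmul _ _ hq, add_zero]
  · intro p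
    exact ⟨p * p, .mul_self p, by simp⟩
  · rintro ⟨s, hs', h1⟩
    have h2 : 0 ≤ τ (e * aeval a s) := by
      refine hs'.aeval_trace_nonneg fun p => ?_
      have := h.trace_mul_star_nonneg (e * aeval a p)
      rwa [star_mul, h.star_aeval hs, hes, mul_assoc, h.trace_comm, mul_assoc, mul_assoc, he,
        ← mul_assoc, h.trace_comm] at this
    have h3 : τ (e * aeval a s) = - τ e := by
      rw [map_sub, map_neg, map_one, mul_sub, mul_neg, mul_one, sub_eq_zero] at h1
      rw [← h1, map_neg]
    linarith [h.trace_pos_of_idempotent he hes he0]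

theorem exists_eq_smul_minProj (h : IsTraceAlgebra τ n) (hR : PolyIVT R) {e a : A}
    (he : IsMinProj e) (hs : star a = a) (hea : e * a = a) : ∃ l : R, a = l • e := by
  have hae : a * e = a := by
    have := congrArg star hea
    rwa [star_mul, hs, he.star_eq] at this
  have hc : Commute e a := hea.trans hae.symm
  obtain ⟨R1, _, _, _, φ, hR1, hφ⟩ := exists_hom_to_polyIVT
    (h.isProperPreordering_of_idempotent he.mul_self he.star_eq he.ne_zero hs hc)
  have hcomm : ∀ p : R[X], Commute e (aeval a p) := by
    intro p
    induction p using Polynomial.induction_on' with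
    | add p q hp hq => rw [map_add]; exact hp.add_right hq
    | monomial k r =>
      rw [aeval_monomial]
      exact (show Commute e _ from (Algebra.commutes r e).symm).mul_right (hc.pow_right k)
  have hzero : ∀ p : R[X], e * aeval a p = 0 → φ p = 0 := by
    intro p hp
    apply le_antisymm
    · have := hφ (-p) ⟨0, .zero, by simp [hp]⟩
      rw [map_neg] at this
      linarith
    · exact hφ p ⟨0, .zero, by simp [hp]⟩
  have heval : ∀ p : R[X], φ p = p.eval₂ (φ.comp C) (φ X) := by
    intro p
    conv_lhs => rw [← Polynomial.eval₂_C_X (p := p)]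
    rw [Polynomial.hom_eval₂]
  obtain ⟨χ, hχm, hχ⟩ := h.exists_monic a
  obtain ⟨l, hl⟩ : φ X ∈ (φ.comp C).range := by
    refine hR.mem_range_of_algebraic hR1 _ hχm.ne_zero ?_
    rw [← heval, hzero _ (by rw [hχ, mul_zero])]
  have hroot : ∀ p : R[X], e * aeval a p = 0 → p.eval l = 0 := by
    intro p hp
    have := hzero p hp
    rw [heval, ← hl, Polynomial.eval₂_at_apply] at this
    exact (map_eq_zero _).1 this
  obtain ⟨u, hu, hul⟩ := χ.exists_eq_pow_rootMultiplicity_mul_and_not_dvd hχm.ne_zero l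
  have hul' : u.eval l ≠ 0 := fun h0 => hul (dvd_iff_isRoot.2 h0)
  have hmul : ∀ p q : R[X], e * aeval a q = 0 → e * aeval a (p * q) = 0 := by
    intro p q hq
    rw [mul_comm, map_mul, ← mul_assoc, hq, zero_mul]
  have hpow : ∀ (p : R[X]) (k : ℕ), (e * aeval a p) ^ (k + 1) = e * aeval a (p ^ (k + 1)) := by
    intro p k
    rw [(hcomm p).mul_pow, IsIdempotentElem.pow_succ_eq k he.mul_self, map_pow]
  have hstar : ∀ p : R[X], star (e * aeval a p) = e * aeval a p := by
    intro p
    rw [star_mul, h.star_aeval hs, he.star_eq, (hcomm p).eq]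
  have h1 : e * aeval a ((X - C l) * u) = 0 := by
    refine h.eq_zero_of_pow_eq_zero (hstar _) (k := χ.rootMultiplicity l + 1) ?_
    rw [hpow, show ((X - C l) * u) ^ (χ.rootMultiplicity l + 1) =
      (X - C l) * u ^ χ.rootMultiplicity l * ((X - C l) ^ χ.rootMultiplicity l * u) by
        rw [pow_succ, mul_pow]; ring, ← hu]
    exact hmul _ _ (by rw [hχ, mul_zero])
  set v : R[X] := C (u.eval l)⁻¹ * u with hv
  have h2 : e * aeval a ((X - C l) * v) = 0 := by
    rw [hv, show (X - C l) * (C (u.eval l)⁻¹ * u) = C (u.eval l)⁻¹ * ((X - C l) * u) by ring]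
    exact hmul _ _ h1
  have hvl : v.eval l = 1 := by simp [hv, hul']
  obtain ⟨w, hw⟩ : X - C l ∣ v - 1 := dvd_iff_isRoot.2 (by simp [IsRoot, hvl])
  have hf : e * aeval a v * (e * aeval a v) = e * aeval a v := by
    have h3 := hmul w _ h2
    rw [show w * ((X - C l) * v) = v * v - v by linear_combination (-v) * hw, map_sub, mul_sub,
      sub_eq_zero, map_mul] at h3
    calc e * aeval a v * (e * aeval a v) = e * (aeval a v * e) * aeval a v := by
          simp only [mul_assoc]
      _ = e * e * (aeval a v * aeval a v) := by rw [← (hcomm v).eq]; simp only [mul_assoc]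
      _ = e * aeval a v := by rw [he.mul_self, h3]
  have hf0 : e * aeval a v ≠ 0 := by
    intro h0
    have := hroot v h0
    rw [hvl] at this
    exact one_ne_zero this
  have hfe := he.eq_of_le _ hf0 hf (hstar v) (by rw [← mul_assoc, he.mul_self])
  refine ⟨l, ?_⟩
  rw [mul_comm, map_mul, ← mul_assoc, hfe, map_sub, aeval_X, aeval_C, mul_sub, hea,
    ← Algebra.commutes, ← Algebra.smul_def] at h2
  exact sub_eq_zero.1 h2

end IsTraceAlgebra

end

/-- An orthonormal family of units of the corner `e A e` that expands every element of it. -/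
structure IsCornerFrame {R A ι : Type} [Field R] [Ring A] [Algebra R A] [StarRing A] [Fintype ι]
    (τ : A →ₗ[R] R) (e : A) (d : ι → A) : Prop where
  left : ∀ α, e * d α = d α
  right : ∀ α, d α * e = d α
  mul_star : ∀ α, d α * star (d α) = e
  star_mul : ∀ α, star (d α) * d α = e
  ortho : ∀ α β, α ≠ β → τ (star (d α) * d β) = 0
  expand : ∀ y, e * y = y → y * e = y → y = ∑ α, (τ (star (d α) * y) / τ e) • d α

theorem mul_star_of_mul_right {A : Type} [Ring A] [StarRing A] {e y : A} (he : star e = e)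
    (hy : y * e = y) : e * star y = star y := by
  rw [← he, ← star_mul, hy]

theorem trace_pow_skew_unit {R A : Type} [Field R] [Ring A] [Algebra R A] (τ : A →ₗ[R] R)
    {e i : A} (hie : i * e = i) (hi : i * i = -e) (k : ℕ) :
    τ (i ^ (k + 3)) = -τ (i ^ (k + 1)) := by
  rw [show i ^ (k + 3) = i ^ k * i * (i * i) by noncomm_ring, hi, mul_neg, map_neg, mul_assoc,
    hie, pow_succ]

namespace IsTraceAlgebra

variable {R A : Type} [Field R] [LinearOrder R] [Ring A] [Algebra R A]
  [StarRing A] {τ : A →ₗ[R] R} {n : ℕ}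

theorem trace_minProj_pos (h : IsTraceAlgebra τ n) {e : A} (he : IsMinProj e) : 0 < τ e :=
  h.trace_pos_of_idempotent he.mul_self he.star_eq he.ne_zero

variable [IsStrictOrderedRing R]

/-- Between two minimal projections, `v vᵀ` and `vᵀ v` are the same multiple of them. -/
theorem exists_norm (h : IsTraceAlgebra τ n) (hR : PolyIVT R) {e f v : A} (he : IsMinProj e)
    (hf : IsMinProj f) (hev : e * v = v) (hvf : v * f = v) (hv : v ≠ 0) :
    ∃ l : R, 0 < l ∧ v * star v = l • e ∧ star v * v = l • f := by
  obtain ⟨l, hl⟩ := h.exists_eq_smul_minProj hR he (a := v * star v) (by simp)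
    (by rw [← mul_assoc, hev])
  obtain ⟨m, hm⟩ := h.exists_eq_smul_minProj hR hf (a := star v * v) (by simp)
    (by rw [← mul_assoc, mul_star_of_mul_right hf.star_eq hvf])
  have hlm : l • v = m • v := by
    have := mul_assoc v (star v) v
    rwa [hl, hm, smul_mul_assoc, hev, mul_smul_comm, hvf] at this
  have hlm' : l = m := smul_left_injective R hv hlm
  refine ⟨l, ?_, hl, hlm' ▸ hm⟩
  have := h.trace_pos v hv
  rw [hl, map_smul, smul_eq_mul] at this
  exact pos_of_mul_pos_left this (h.trace_minProj_pos he).le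

theorem exists_scale (h : IsTraceAlgebra τ n) (hR : PolyIVT R) {e f v : A} (he : IsMinProj e)
    (hf : IsMinProj f) (hev : e * v = v) (hvf : v * f = v) (hv : v ≠ 0) :
    ∃ r : R, (r • v) * star (r • v) = e ∧ star (r • v) * (r • v) = f := by
  obtain ⟨l, hl, h1, h2⟩ := h.exists_norm hR he hf hev hvf hv
  obtain ⟨r, -, hr⟩ := hR.exists_sqrt (inv_pos.2 hl).le
  refine ⟨r, ?_, ?_⟩
  · rw [h.star_smul, smul_mul_smul_comm, h1, hr, smul_smul, inv_mul_cancel₀ hl.ne', one_smul]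
  · rw [h.star_smul, smul_mul_smul_comm, h2, hr, smul_smul, inv_mul_cancel₀ hl.ne', one_smul]

theorem exists_partial_isometry (h : IsTraceAlgebra τ n) (hR : PolyIVT R) {e f a : A}
    (he : IsMinProj e) (hf : IsMinProj f) (ha : e * a * f ≠ 0) :
    ∃ u : A, e * u = u ∧ u * f = u ∧ u * star u = e ∧ star u * u = f := by
  have h1 : e * (e * a * f) = e * a * f := by rw [← mul_assoc, ← mul_assoc, he.mul_self]
  have h2 : e * a * f * f = e * a * f := by rw [mul_assoc, hf.mul_self]
  obtain ⟨r, h3, h4⟩ := h.exists_scale hR he hf h1 h2 ha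
  exact ⟨r • (e * a * f), by rw [mul_smul_comm, h1], by rw [smul_mul_assoc, h2], h3, h4⟩

theorem exists_skew_unit (h : IsTraceAlgebra τ n) (hR : PolyIVT R) {e v : A}
    (he : IsMinProj e) (hev : e * v = v) (hve : v * e = v) (hv : v ≠ 0) (hs : star v = -v) :
    ∃ r : R, star (r • v) = -(r • v) ∧ e * (r • v) = r • v ∧ (r • v) * e = r • v ∧
      (r • v) * (r • v) = -e := by
  obtain ⟨r, h3, -⟩ := h.exists_scale hR he he hev hve hv
  have h5 : star (r • v) = -(r • v) := by rw [h.star_smul, hs, smul_neg]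
  refine ⟨r, h5, by rw [mul_smul_comm, hev], by rw [smul_mul_assoc, hve], ?_⟩
  rw [h5, mul_neg] at h3
  rw [← h3, neg_neg]

theorem eq_zero_of_add_star (h : IsTraceAlgebra τ n) (hR : PolyIVT R) {e y : A}
    (he : IsMinProj e) (hey : e * y = y) (hye : y * e = y) (hy : τ y = 0) : star y = -y := by
  obtain ⟨l, hl⟩ := h.exists_eq_smul_minProj hR he (a := y + star y) (by simp [add_comm])
    (by rw [mul_add, hey, mul_star_of_mul_right he.star_eq hye])
  have h1 := congrArg τ hl
  rw [map_add, h.trace_star, hy, add_zero, map_smul, smul_eq_mul, zero_eq_mul] at h1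
  rw [h1.resolve_right (h.trace_minProj_pos he).ne', zero_smul] at hl
  exact eq_neg_of_add_eq_zero_right hl

theorem anticomm (h : IsTraceAlgebra τ n) (hR : PolyIVT R) {e x y : A}
    (he : IsMinProj e) (hex : e * x = x) (hye : y * e = y)
    (hx : star x = -x) (hy : star y = -y) (hxy : τ (x * y) = 0) : y * x = -(x * y) := by
  have := h.eq_zero_of_add_star hR he (y := x * y) (by rw [← mul_assoc, hex])
    (by rw [mul_assoc, hye]) hxy
  rwa [star_mul, hx, hy, neg_mul_neg] at this

theorem isCornerFrame (h : IsTraceAlgebra τ n) (hR : PolyIVT R) {ι : Type} [Fintype ι]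
    {e : A} (he : IsMinProj e) {d : ι → A}
    (hd : ∀ α, e * d α = d α ∧ d α * e = d α ∧ d α * star (d α) = e ∧ star (d α) * d α = e)
    (ho : ∀ α β, α ≠ β → τ (star (d α) * d β) = 0) (h0 : ∃ α, d α = e)
    (hr : ∀ r, e * r = r → r * e = r → star r = -r → (∀ α, τ (star (d α) * r) = 0) → r = 0) :
    IsCornerFrame τ e d := by
  refine ⟨fun α => (hd α).1, fun α => (hd α).2.1, fun α => (hd α).2.2.1, fun α => (hd α).2.2.2,
    ho, fun y hey hye => ?_⟩
  have hpos := h.trace_minProj_pos he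
  rw [← sub_eq_zero]
  set r := y - ∑ α, (τ (star (d α) * y) / τ e) • d α with hrdef
  have h1 : e * r = r := by
    simp only [hrdef, mul_sub, Finset.mul_sum, mul_smul_comm, (hd _).1, hey]
  have h2 : r * e = r := by
    simp only [hrdef, sub_mul, Finset.sum_mul, smul_mul_assoc, (hd _).2.1, hye]
  have h3 : ∀ α, τ (star (d α) * r) = 0 := by
    intro α
    simp only [hrdef, mul_sub, Finset.mul_sum, mul_smul_comm, map_sub, map_sum, map_smul,
      smul_eq_mul]
    rw [Finset.sum_eq_single_of_mem α (Finset.mem_univ _) (fun β _ hb => by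
      rw [ho α β (Ne.symm hb), mul_zero]), (hd α).2.2.2, div_mul_cancel₀ _ hpos.ne', sub_self]
  obtain ⟨α, hα⟩ := h0
  refine hr r h1 h2 (h.eq_zero_of_add_star hR he h1 h2 ?_) h3
  rw [← h3 α, hα, he.star_eq, h1]

theorem trace_skew (h : IsTraceAlgebra τ n) {y : A} (hy : star y = -y) : τ y = 0 := by
  have := h.trace_star y
  rw [hy, map_neg] at this
  linarith

theorem exists_cornerFrame (h : IsTraceAlgebra τ n) (hR : PolyIVT R) {e : A}
    (he : IsMinProj e) : ∃ (δ l : ℕ) (d : Fin δ → A), 0 < δ ∧ τ e = δ * l ∧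
      IsCornerFrame τ e d := by
  by_cases c1 : ∀ r, e * r = r → r * e = r → star r = -r → r = 0
  · obtain ⟨l, hl⟩ := h.exists_nat_of_idempotent he.mul_self
    refine ⟨1, l, fun _ => e, one_pos, by simp [hl], h.isCornerFrame hR he ?_ ?_ ⟨0, rfl⟩ ?_⟩
    · simp [he.mul_self, he.star_eq]
    · intro α β hab
      exact absurd (Subsingleton.elim _ _) hab
    · exact fun r h1 h2 h3 _ => c1 r h1 h2 h3
  push Not at c1
  obtain ⟨v, v1, v2, v3, v4⟩ := c1
  obtain ⟨ri, i3, i1, i2, i4⟩ := h.exists_skew_unit hR he v1 v2 v4 v3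
  generalize ri • v = i at i1 i2 i3 i4
  have hte : τ (-e) = -τ e := map_neg _ _
  by_cases c2 : ∀ r, e * r = r → r * e = r → star r = -r → τ (i * r) = 0 → r = 0
  · obtain ⟨E, hE⟩ := h.exists_newton i
    obtain ⟨l, hl⟩ := hE.exists_even (m := τ e) (by simpa using h.trace_skew i3)
      (by rw [pow_two, i4, hte]) (trace_pow_skew_unit τ i2 i4)
    refine ⟨2, l, ![e, i], two_pos, by simp [hl], h.isCornerFrame hR he ?_ ?_ ⟨0, rfl⟩ ?_⟩
    · simp [Fin.forall_fin_succ, he.mul_self, he.star_eq, i1, i2, i3, i4]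
    · simp [Fin.forall_fin_succ, he.star_eq, i1, i2, i3, h.trace_skew i3]
    · intro r h1 h2 h3 h4
      refine c2 r h1 h2 h3 ?_
      simpa [i3] using h4 1
  push Not at c2
  obtain ⟨w, w1, w2, w3, w4, w5⟩ := c2
  obtain ⟨rj, j3, j1, j2, j4⟩ := h.exists_skew_unit hR he w1 w2 w5 w3
  have hij : τ (i * (rj • w)) = 0 := by rw [mul_smul_comm, map_smul, w4, smul_zero]
  generalize rj • w = j at j1 j2 j3 j4 hij
  have hji := h.anticomm hR he i1 j2 i3 j3 hij
  obtain ⟨k, hk⟩ : ∃ k, i * j = k := ⟨_, rfl⟩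
  have k1 : e * k = k := by rw [← hk, ← mul_assoc, i1]
  have k2 : k * e = k := by rw [← hk, mul_assoc, j2]
  have k3 : star k = -k := by rw [← hk, star_mul, i3, j3, neg_mul_neg, hji]
  have k4 : k * k = -e := by
    rw [← hk]
    calc i * j * (i * j) = i * (j * i) * j := by noncomm_ring
      _ = -((i * i) * (j * j)) := by rw [hji]; noncomm_ring
      _ = -e := by rw [i4, j4, neg_mul_neg, he.mul_self]
  have hik : i * k = -j := by rw [← hk, ← mul_assoc, i4, neg_mul, j1]
  have hjk : j * k = i := by rw [← hk, ← mul_assoc, hji, neg_mul, mul_assoc, j4, mul_neg, i2,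
    neg_neg]
  have hki : k * i = j := by
    have := congrArg star hik
    rw [star_mul, k3, i3, neg_mul_neg, star_neg, j3, neg_neg] at this
    exact this
  have hkj : k * j = -i := by
    have := congrArg star hjk
    rw [star_mul, k3, j3, neg_mul_neg, i3] at this
    exact this
  obtain ⟨q, hq0, hq⟩ := h.exists_newton_sq i j i3 j3
  rw [hk] at hq
  obtain ⟨l, hl⟩ := IsNewton.exists_four hq0 hq (m := τ e) (by simpa using h.trace_skew k3)
    (by rw [pow_two, k4, hte]) (trace_pow_skew_unit τ k2 k4)
  refine ⟨4, l, ![e, i, j, k], by norm_num, by simp [hl], h.isCornerFrame hR he ?_ ?_ ⟨0, rfl⟩ ?_⟩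
  · simp [Fin.forall_fin_succ, he.mul_self, he.star_eq, i1, i2, i3, i4, j1, j2, j3, j4, k1, k2,
      k3, k4]
  · simp [Fin.forall_fin_succ, he.star_eq, i1, i2, i3, j1, j2, j3, k1, k2, k3, h.trace_skew i3,
      h.trace_skew j3, h.trace_skew k3, hk, hji, hik, hki, hjk, hkj]
  · intro r h1 h2 h3 h4
    have hi0 : τ (i * r) = 0 := by simpa [i3] using h4 1
    have hj0 : τ (j * r) = 0 := by simpa [j3] using h4 2
    have hk0 : τ (k * r) = 0 := by simpa [k3] using h4 3
    have ai := h.anticomm hR he i1 h2 i3 h3 hi0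
    have aj := h.anticomm hR he j1 h2 j3 h3 hj0
    have ak := h.anticomm hR he k1 h2 k3 h3 hk0
    have ck : r * k = k * r := by
      rw [← hk, ← mul_assoc, ai, neg_mul, mul_assoc, aj, mul_neg, neg_neg, mul_assoc]
    have hz : k * r = 0 := by
      have h5 : k * r + k * r = 0 := by
        nth_rewrite 1 [← ck]
        rw [ak, neg_add_cancel]
      have h6 : (2 : R) • (k * r) = 0 := by rw [two_smul, h5]
      exact (smul_eq_zero.1 h6).resolve_left two_ne_zero
    have h7 := congrArg (k * ·) hz
    simp only [← mul_assoc, k4, mul_zero, neg_mul, h1] at h7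
    exact neg_eq_zero.1 h7

end IsTraceAlgebra

/-- Repeating the blocks of a representation by matrices with prescribed multiplicities. -/
theorem exists_ampliation {R A I : Type} [Field R] [Ring A] [Algebra R A] [Fintype I]
    [DecidableEq I] (M : A →ₐ[R] Matrix I I R) (L : I → ℕ)
    (hL : ∀ a p q, L p ≠ L q → M a p q = 0) :
    ∃ ρ : A →ₐ[R] Matrix (Σ p : I, Fin (L p)) (Σ p : I, Fin (L p)) R,
      ∀ a x y, ρ a x y = if x.2.val = y.2.val then M a x.1 y.1 else 0 := by
  let ρ : A →ₗ[R] Matrix (Σ p : I, Fin (L p)) (Σ p : I, Fin (L p)) R :=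
    { toFun := fun a => Matrix.of fun x y => if x.2.val = y.2.val then M a x.1 y.1 else 0
      map_add' := by
        intro a b
        ext x y
        by_cases h : x.2.val = y.2.val <;> simp [h]
      map_smul' := by
        intro r a
        ext x y
        by_cases h : x.2.val = y.2.val <;> simp [h] }
  refine ⟨AlgHom.ofLinearMap ρ ?_ ?_, fun a x y => rfl⟩
  · ext ⟨p, i⟩ ⟨q, j⟩
    simp only [ρ, LinearMap.coe_mk, AddHom.coe_mk, map_one, of_apply, Matrix.one_apply,
      Sigma.mk.injEq]
    by_cases hpq : p = q
    · subst hpq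
      simp [Fin.ext_iff]
    · simp [hpq]
  · intro a b
    ext ⟨p, i⟩ ⟨q, j⟩
    simp only [ρ, LinearMap.coe_mk, AddHom.coe_mk, map_mul, of_apply, Matrix.mul_apply,
      Fintype.sum_sigma]
    have key : ∀ x, ∑ k : Fin (L x), (if i.val = k.val then M a p x else 0) *
        (if k.val = j.val then M b x q else 0) =
        if i.val = j.val then M a p x * M b x q else 0 := by
      intro x
      by_cases hx : L p = L x
      · rw [Finset.sum_eq_single_of_mem (⟨i.val, hx ▸ i.2⟩ : Fin (L x)) (Finset.mem_univ _)]
        · simp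
        · intro k _ hk
          rw [if_neg fun h => hk (Fin.ext h.symm), zero_mul]
      · simp [hL a p x hx]
    rw [Finset.sum_congr rfl fun x _ => key x]
    split_ifs <;> simp

theorem IsTraceAlgebra.exists_rep_of_frame {R A : Type} [Field R] [LinearOrder R]
    [IsStrictOrderedRing R] [Ring A] [Algebra R A] [StarRing A] {τ : A →ₗ[R] R} {n : ℕ}
    (h : IsTraceAlgebra τ n) {I : Type} [Fintype I] (w : I → A) (m : I → R)
    (L : I → ℕ) (hexp : ∀ b q, b * w q = ∑ p, (τ (star (w p) * b * w q) / m p) • w p)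
    (ho : ∀ p q, p ≠ q → τ (star (w p) * w q) = 0) (hm : ∀ p, τ (star (w p) * w p) = m p)
    (hm0 : ∀ p, m p ≠ 0)
    (hL : ∀ a p q, L p ≠ L q ∨ m p ≠ m q → τ (star (w p) * a * w q) = 0)
    (htr : ∀ a, ∑ p, L p * (τ (star (w p) * a * w p) / m p) = τ a) :
    ∃ ρ : A →ₐ[R] Matrix (Fin n) (Fin n) R,
      (∀ a, ρ (star a) = (ρ a)ᵀ) ∧ ∀ a, (ρ a).trace = τ a := by
  classical
  let M0 : A →ₗ[R] Matrix I I R :=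
    { toFun := fun a => Matrix.of fun p q => τ (star (w p) * a * w q) / m p
      map_add' := by
        intro a b
        ext x y
        simp [mul_add, add_mul, add_div]
      map_smul' := by
        intro r a
        ext x y
        simp [mul_div_assoc] }
  have hM1 : M0 1 = 1 := by
    ext p q
    by_cases hpq : p = q
    · subst hpq
      simp [M0, hm, hm0]
    · simp [M0, hpq, ho p q hpq]
  have hMm : ∀ a b, M0 (a * b) = M0 a * M0 b := by
    intro a b
    ext p q
    simp only [M0, LinearMap.coe_mk, AddHom.coe_mk, of_apply, Matrix.mul_apply]
    rw [mul_assoc, mul_assoc, hexp b q]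
    simp only [Finset.mul_sum, mul_smul_comm, map_sum, map_smul, smul_eq_mul, Finset.sum_div,
      ← mul_assoc]
    exact Finset.sum_congr rfl fun r _ => by ring
  obtain ⟨ρ, hρ⟩ := exists_ampliation (AlgHom.ofLinearMap M0 hM1 hMm) L (by
    intro a p q hpq
    simp [M0, hL a p q (.inl hpq)])
  have hρ' : ∀ a x y, ρ a x y = if x.2.val = y.2.val then
      τ (star (w x.1) * a * w y.1) / m x.1 else 0 := hρ
  have htrace : ∀ a, (ρ a).trace = τ a := by
    intro a
    rw [← htr, Matrix.trace, Fintype.sum_sigma]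
    simp [hρ']
  have hcard : Fintype.card (Σ p : I, Fin (L p)) = n := by
    have := htrace 1
    rw [map_one, Matrix.trace_one, h.trace_one] at this
    exact_mod_cast this
  have hsymm : ∀ a, ρ (star a) = (ρ a)ᵀ := by
    intro a
    ext x y
    rw [Matrix.transpose_apply, hρ', hρ']
    simp only [eq_comm (a := x.2.val)]
    congr 1
    have h1 : τ (star (w x.1) * star a * w y.1) = τ (star (w y.1) * a * w x.1) := by
      rw [← h.trace_star]
      simp [mul_assoc]
    by_cases hxy : m x.1 = m y.1
    · rw [h1, hxy]
    · rw [h1, hL _ _ _ (.inr (Ne.symm hxy)), zero_div, zero_div]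
  let E := Fintype.equivFinOfCardEq hcard
  refine ⟨(Matrix.reindexAlgEquiv R R E).toAlgHom.comp ρ, ?_, ?_⟩
  · intro a
    ext i j
    simp [hsymm]
  · intro a
    rw [← htrace]
    simp [Matrix.trace, ← Equiv.sum_comp E]

/-- An algebra with positive involution and trace over an ordered field with the intermediate value
property for polynomials is represented by matrices. -/
theorem IsTraceAlgebra.exists_rep {R A : Type} [Field R] [LinearOrder R]
    [IsStrictOrderedRing R] [Ring A] [Algebra R A] [StarRing A] {τ : A →ₗ[R] R} {n : ℕ}
    (h : IsTraceAlgebra τ n) (hR : PolyIVT R) :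
    ∃ ρ : A →ₐ[R] Matrix (Fin n) (Fin n) R,
      (∀ a, ρ (star a) = (ρ a)ᵀ) ∧ ∀ a, (ρ a).trace = τ a := by
  classical
  obtain ⟨s, hs, hso, hs1⟩ := h.exists_minProj_sum n 1 (mul_one 1) (star_one A) h.trace_one
  let r : Setoid s :=
    { r := fun e f => ∃ u : A, e.1 * u = u ∧ u * f.1 = u ∧ u * star u = e.1 ∧ star u * u = f.1
      iseqv := by
        refine ⟨fun e => ⟨e.1, ?_⟩, ?_, ?_⟩
        · simp [(hs _ e.2).mul_self, (hs _ e.2).star_eq]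
        · rintro e f ⟨u, h1, h2, h3, h4⟩
          exact ⟨star u, mul_star_of_mul_right (hs _ f.2).star_eq h2, by
            rw [← h3, ← mul_assoc, h4]
            exact mul_star_of_mul_right (hs _ f.2).star_eq h2, by rw [star_star, h4],
            by rw [star_star, h3]⟩
        · rintro e f k ⟨u, h1, h2, h3, h4⟩ ⟨v, g1, g2, g3, g4⟩
          refine ⟨u * v, by rw [← mul_assoc, h1], by rw [mul_assoc, g2], ?_, ?_⟩
          · rw [star_mul, mul_assoc, ← mul_assoc v, g3, ← mul_assoc, h2, h3]
          · rw [star_mul, mul_assoc, ← mul_assoc (star u), h4, g1, g4] }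
  let c : s → s := fun e => (Quotient.mk r e).out
  have hc : ∀ e, r e (c e) := fun e => Setoid.symm (Quotient.mk_out (s := r) e)
  have hcc : ∀ e f, (∃ a, e.1 * a * f.1 ≠ 0) → c e = c f := by
    rintro e f ⟨a, ha⟩
    have : r e f := h.exists_partial_isometry hR (hs _ e.2) (hs _ f.2) ha
    exact congrArg Quotient.out (Quotient.sound this)
  choose u u1 u2 u3 u4 using hc
  choose δ l d hδ hl hd using fun e : s => h.exists_cornerFrame hR (hs e.1 e.2)
  have hw1 : ∀ e α, e.1 * (u e * d (c e) α) = u e * d (c e) α := fun e α => by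
    rw [← mul_assoc, u1]
  have hw2 : ∀ e α, (u e * d (c e) α) * (c e).1 = u e * d (c e) α := fun e α => by
    rw [mul_assoc, (hd _).right]
  have hτc : ∀ e, τ e.1 = τ (c e).1 := fun e => by rw [← u3, ← u4, h.trace_comm]
  have hw3 : ∀ e f a α β, c e ≠ c f →
      star (u e * d (c e) α) * a * (u f * d (c f) β) = 0 := by
    intro e f a α β hef
    have h1 : e.1 * a * f.1 = 0 := by
      by_contra h0
      exact hef (hcc e f ⟨a, h0⟩)
    calc star (u e * d (c e) α) * a * (u f * d (c f) β)
        = star (e.1 * (u e * d (c e) α)) * a * (f.1 * (u f * d (c f) β)) := by rw [hw1, hw1]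
      _ = star (u e * d (c e) α) * (e.1 * a * f.1) * (u f * d (c f) β) := by
          rw [star_mul _ (_ * _), (hs _ e.2).star_eq]
          simp only [mul_assoc]
      _ = 0 := by rw [h1, mul_zero, zero_mul]
  refine h.exists_rep_of_frame (I := Σ e : s, Fin (δ (c e))) (fun p => u p.1 * d (c p.1) p.2)
    (fun p => τ p.1.1) (fun p => l (c p.1)) ?_ ?_ ?_ ?_ ?_ ?_
  · rintro b ⟨f, β⟩
    rw [Fintype.sum_sigma]
    conv_lhs => rw [← one_mul (b * _), ← hs1, Finset.sum_mul, ← Finset.sum_coe_sort]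
    refine Finset.sum_congr rfl fun e _ => ?_
    by_cases hef : c e = c f
    · have h1 := (hd (c e)).expand (star (u e) * (b * (u f * d (c f) β)))
        (by rw [← mul_assoc, mul_star_of_mul_right (hs _ (c e).2).star_eq (u2 e)])
        (by rw [hef, mul_assoc, mul_assoc, hw2])
      have h2 := congrArg (u e * ·) h1
      simp only [← mul_assoc, u3] at h2
      simp only [← mul_assoc]
      rw [h2, Finset.mul_sum]
      refine Finset.sum_congr rfl fun α _ => ?_
      rw [mul_smul_comm, hτc e, star_mul]
    · have h1 : e.1 * (b * (u f * d (c f) β)) = 0 := by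
        by_contra h0
        refine hef (hcc e f ⟨b, fun h2 => h0 ?_⟩)
        rw [← hw1 f β, ← mul_assoc, ← mul_assoc, h2, zero_mul]
      simp only [hw3 e f b _ β hef, map_zero, zero_div, zero_smul, Finset.sum_const_zero]
      exact h1
  · rintro ⟨e, α⟩ ⟨f, β⟩ hne
    by_cases hef : e = f
    · subst hef
      have hαβ : α ≠ β := fun h0 => hne (by rw [h0])
      dsimp only
      rw [star_mul, mul_assoc, ← mul_assoc (star (u e)), u4, (hd _).left, (hd _).ortho _ _ hαβ]
    · dsimp only
      rw [← hw1 e, ← hw1 f, star_mul _ (_ * _), (hs _ e.2).star_eq, mul_assoc,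
        ← mul_assoc e.1, hso _ e.2 _ f.2 fun h0 => hef (Subtype.ext h0), zero_mul, mul_zero,
        map_zero]
  · rintro ⟨e, α⟩
    dsimp only
    rw [star_mul, mul_assoc, ← mul_assoc (star (u e)), u4, (hd _).left, (hd _).star_mul, hτc e]
  · rintro ⟨e, α⟩
    exact (h.trace_minProj_pos (hs _ e.2)).ne'
  · rintro a ⟨e, α⟩ ⟨f, β⟩ hne
    dsimp only at hne ⊢
    rw [hw3, map_zero]
    intro hef
    rw [hτc e, hτc f, hef] at hne
    simp at hne
  · intro a
    rw [Fintype.sum_sigma]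
    conv_rhs => rw [← one_mul a, ← hs1, Finset.sum_mul, map_sum, ← Finset.sum_coe_sort]
    refine Finset.sum_congr rfl fun e _ => ?_
    have h1 : ∀ α, τ (star (u e * d (c e) α) * a * (u e * d (c e) α)) = τ (e.1 * a) := by
      intro α
      rw [mul_assoc, h.trace_comm, mul_assoc, h.trace_comm]
      congr 1
      rw [star_mul, ← mul_assoc, mul_assoc (u e), (hd _).mul_star, u2, u3]
    simp only [h1, Finset.sum_const, Finset.card_univ, Fintype.card_fin, nsmul_eq_mul]
    have h2 := h.trace_minProj_pos (hs _ e.2)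
    have h3 := hl (c e)
    rw [← hτc] at h3
    field_simp
    rw [h3]
    ring

section

open Polynomial

theorem Matrix.derivative_det {D m : Type} [CommRing D] [Fintype m] [DecidableEq m]
    (M : Matrix m m D[X]) :
    derivative M.det = (adjugate M * M.map derivative).trace := by
  have h1 : ∀ i, (adjugate M * M.map derivative) i i =
      ∑ σ : Equiv.Perm m, ((Equiv.Perm.sign σ : ℤ) : D[X]) *
        ((∏ j ∈ Finset.univ.erase i, M (σ j) j) * derivative (M (σ i) i)) := by
    intro i
    have : (adjugate M * M.map derivative) i i =
        (M.updateCol i (fun j => derivative (M j i))).det := by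
      rw [← cramer_apply, cramer_eq_adjugate_mulVec]
      rfl
    rw [this, det_apply']
    refine Finset.sum_congr rfl fun σ _ => ?_
    congr 1
    rw [← Finset.prod_erase_mul _ _ (Finset.mem_univ i)]
    congr 1
    · refine Finset.prod_congr rfl fun j hj => ?_
      rw [updateCol_ne (Finset.ne_of_mem_erase hj)]
    · simp
  simp only [Matrix.trace, diag_apply, h1]
  rw [det_apply', derivative_sum, Finset.sum_comm]
  refine Finset.sum_congr rfl fun σ _ => ?_
  rw [derivative_mul, derivative_intCast, zero_mul, zero_add, derivative_prod_finset,
    Finset.mul_sum]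

theorem Matrix.isNewton_charpolyRev {D m : Type} [CommRing D] [Fintype m] [DecidableEq m]
    (M : Matrix m m D) : IsNewton M.charpolyRev (fun k => (M ^ k).trace) := by
  refine ⟨by rw [coeff_zero_eq_eval_zero, eval_charpolyRev], fun k => ?_⟩
  set N : Matrix m m D[X] := 1 - (X : D[X]) • M.map C with hN
  have hE : M.charpolyRev = N.det := rfl
  let B : ℕ → Matrix m m D := fun k => (adjugate N).map fun p => p.coeff k
  have hNB : N * adjugate N = M.charpolyRev • (1 : Matrix m m D[X]) := by rw [mul_adjugate, hE]
  have hNB' : adjugate N = M.charpolyRev • (1 : Matrix m m D[X]) +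
      (X : D[X]) • (M.map C * adjugate N) := by
    rw [← hNB, hN, sub_mul, one_mul, smul_mul_assoc, sub_add_cancel]
  have hB0 : B 0 = M.charpolyRev.coeff 0 • (1 : Matrix m m D) := by
    ext i j
    simp only [B, map_apply]
    rw [hNB']
    by_cases hij : i = j <;> simp [hij]
  have hBs : ∀ k, B (k + 1) = M.charpolyRev.coeff (k + 1) • (1 : Matrix m m D) + M * B k := by
    intro k
    ext i j
    simp only [B, map_apply, Matrix.add_apply, Matrix.mul_apply]
    refine (congrArg (fun P : Matrix m m D[X] => (P i j).coeff (k + 1)) hNB').trans ?_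
    by_cases hij : i = j <;> simp [hij, Matrix.mul_apply]
  have hB : ∀ k, B k = ∑ p ∈ Finset.HasAntidiagonal.antidiagonal k,
      M.charpolyRev.coeff p.1 • M ^ p.2 := by
    intro k
    induction k with
    | zero => simp [hB0]
    | succ k ih =>
      rw [hBs, ih, Finset.Nat.sum_antidiagonal_succ', Finset.mul_sum]
      simp [pow_succ']
  have h1 : (k + 1 : ℕ) * M.charpolyRev.coeff (k + 1) = (derivative M.charpolyRev).coeff k := by
    rw [coeff_derivative]
    push_cast
    ring
  have hN' : N.map derivative = -(M.map C) := by
    ext i j : 1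
    by_cases hij : i = j <;> simp [hN, hij]
  have h2 : (derivative M.charpolyRev).coeff k = -(B k * M).trace := by
    rw [hE, derivative_det, hN', mul_neg, trace_neg, coeff_neg]
    simp [Matrix.trace, Matrix.mul_apply, B]
  rw [h1, h2, hB, Finset.sum_mul, trace_sum]
  simp [pow_succ]

theorem Matrix.exists_det_eq_sq_of_skew {K : Type} [Field K] [CharZero K] (N : ℕ) :
    ∀ {m : Type} [Fintype m] [DecidableEq m] (M : Matrix m m K), Fintype.card m = N → Mᵀ = -M →
      ∃ q, M.det = q * q := by
  induction N using Nat.strong_induction_on with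
  | _ N ih =>
  intro m _ _ M hN hM
  have hM' : ∀ i j, M j i = -M i j := fun i j => congrFun (congrFun hM i) j
  by_cases h0 : M = 0
  · rcases isEmpty_or_nonempty m with hm | hm
    · exact ⟨1, by simp⟩
    · exact ⟨0, by rw [h0, det_zero, mul_zero]⟩
  obtain ⟨i, j, hij⟩ : ∃ i j, M i j ≠ 0 := by
    by_contra! hcon
    exact h0 (Matrix.ext hcon)
  have hdiag : ∀ i, M i i = 0 := fun i => self_eq_neg.1 (hM' i i)
  have hne : i ≠ j := by
    rintro rfl
    exact hij (hdiag i)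
  let f : Fin 2 → m := ![i, j]
  have hf : Function.Injective f := by
    intro a b hab
    fin_cases a <;> fin_cases b
    · rfl
    · exact absurd hab hne
    · exact absurd hab hne.symm
    · rfl
  let e : Fin 2 ⊕ ↥(Set.range f)ᶜ ≃ m :=
    (Equiv.sumCongr (Equiv.ofInjective f hf) (Equiv.refl _)).trans (Equiv.Set.sumCompl (Set.range f))
  set M' := M.submatrix e e with hM'def
  have hskew : M'ᵀ = -M' := by
    rw [hM'def, transpose_submatrix, hM]
    rfl
  have hskew' : ∀ x y, M' y x = -M' x y := fun i j => congrFun (congrFun hskew i) j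
  have h11 : M'.toBlocks₁₁ = !![0, M i j; -M i j, 0] := by
    ext a b
    fin_cases a <;> fin_cases b <;> simp [M', toBlocks₁₁, e, f, hdiag, hM' i j]
  have hdet : (M'.toBlocks₁₁).det = M i j * M i j := by
    rw [h11, det_fin_two_of]
    ring
  have hu : IsUnit (M'.toBlocks₁₁).det := by
    rw [hdet]
    exact (mul_ne_zero hij hij).isUnit
  let := invertibleOfIsUnitDet _ hu
  have h12 : M'.toBlocks₂₁ = -(M'.toBlocks₁₂)ᵀ := by
    ext a b
    exact hskew' _ _
  have h11' : (M'.toBlocks₁₁)ᵀ = -M'.toBlocks₁₁ := by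
    ext a b
    exact hskew' _ _
  have h22 : (M'.toBlocks₂₂)ᵀ = -M'.toBlocks₂₂ := by
    ext a b
    exact hskew' _ _
  have hinv : ((M'.toBlocks₁₁)⁻¹)ᵀ = -(M'.toBlocks₁₁)⁻¹ := by
    rw [transpose_nonsing_inv, h11']
    refine inv_eq_right_inv ?_
    rw [neg_mul_neg, mul_nonsing_inv _ hu]
  have hcard : Fintype.card ↥(Set.range f)ᶜ < N := by
    have h1 := Fintype.card_congr e
    rw [Fintype.card_sum, Fintype.card_fin, hN] at h1
    omega
  obtain ⟨q, hq⟩ := ih _ hcard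
    (M'.toBlocks₂₂ - M'.toBlocks₂₁ * (M'.toBlocks₁₁)⁻¹ * M'.toBlocks₁₂) rfl (by
      rw [transpose_sub, transpose_mul, transpose_mul, hinv, h22, h12, transpose_neg,
        transpose_transpose]
      simp only [Matrix.neg_mul, Matrix.mul_neg, Matrix.mul_assoc, sub_neg_eq_add, neg_neg, neg_add'])
  refine ⟨M i j * q, ?_⟩
  rw [← det_submatrix_equiv_self e, ← hM'def, ← fromBlocks_toBlocks M', det_fromBlocks₁₁,
    invOf_eq_nonsing_inv, hq, hdet]
  ring

theorem Matrix.exists_det_one_sub_mul_eq_sq {K m : Type} [Field K] [CharZero K] [Fintype m]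
    [DecidableEq m] {a b : Matrix m m K} (ha : aᵀ = -a) (hb : bᵀ = -b) :
    ∃ q, (1 - a * b).det = q * q := by
  obtain ⟨q, hq⟩ := exists_det_eq_sq_of_skew _ (fromBlocks a 1 (-1) (-b)) rfl (by
    rw [fromBlocks_transpose, fromBlocks_neg, ha, transpose_neg, transpose_neg, hb,
      Matrix.transpose_one, neg_neg, neg_neg])
  obtain ⟨r, hr⟩ := exists_det_eq_sq_of_skew _ (fromBlocks b 1 (-1) 0) rfl (by
    rw [fromBlocks_transpose, fromBlocks_neg, hb, transpose_neg, Matrix.transpose_one,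
      transpose_zero, neg_neg, neg_zero])
  have h : fromBlocks a 1 (-1) (-b) * fromBlocks b 1 (-1) 0 =
      fromBlocks (a * b - 1) a 0 (-1) := by
    rw [fromBlocks_multiply]
    congr 1 <;> simp [sub_eq_add_neg]
  refine ⟨q * r, ?_⟩
  have h2 := congrArg det h
  rw [det_mul, hq, hr, det_fromBlocks_zero₂₁, ← det_mul] at h2
  rw [show (1 - a * b) = (a * b - 1) * (-1) by simp, ← h2]
  ring

theorem Matrix.exists_charpolyRev_eq_sq {D m : Type} [CommRing D] [IsDomain D] [CharZero D]
    [IsIntegrallyClosed D[X]] [Fintype m] [DecidableEq m] {a b : Matrix m m D}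
    (ha : aᵀ = -a) (hb : bᵀ = -b) :
    ∃ q : D[X], q.coeff 0 = 1 ∧ (a * b).charpolyRev = q * q := by
  let K := FractionRing D[X]
  let j : D[X] →+* K := algebraMap D[X] K
  have hj : Function.Injective j := IsFractionRing.injective D[X] K
  have : CharZero K := charZero_of_injective_algebraMap hj
  obtain ⟨q, hq⟩ := exists_det_one_sub_mul_eq_sq (a := ((X : D[X]) • a.map C).map j)
    (b := (b.map C).map j) (by
      ext x y
      have h := congrFun (congrFun ha x) y
      simp only [transpose_apply, Matrix.neg_apply] at h
      simp [h]) (by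
      ext x y
      have h := congrFun (congrFun hb x) y
      simp only [transpose_apply, Matrix.neg_apply] at h
      simp [h])
  have h1 : j (a * b).charpolyRev = q * q := by
    rw [← hq, charpolyRev, RingHom.map_det, RingHom.mapMatrix_apply, Matrix.map_sub _ (map_sub j),
      Matrix.map_one _ (map_zero j) (map_one j), ← Matrix.map_mul, Matrix.map_mul,
      smul_mul_assoc]
  obtain ⟨p, hp⟩ := IsIntegrallyClosed.exists_algebraMap_eq_of_isIntegral_pow (R := D[X])
    (x := q) (n := 2) two_pos (by rw [pow_two, ← h1]; exact isIntegral_algebraMap)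
  have h2 : (a * b).charpolyRev = p * p := hj (by rw [h1, map_mul, ← hp])
  have h3 : p.coeff 0 * p.coeff 0 = 1 := by
    rw [← mul_coeff_zero, ← h2, coeff_zero_eq_eval_zero, eval_charpolyRev]
  rcases mul_self_eq_one_iff.1 h3 with h4 | h4
  · exact ⟨p, h4, h2⟩
  · exact ⟨-p, by rw [coeff_neg, h4, neg_neg], by rw [h2, neg_mul_neg]⟩

end

section

open Polynomial

/-- A trace on an algebra with involution, which becomes an `IsTraceAlgebra` after dividing out its
radical. -/
structure IsPreTraceAlgebra {R A : Type} [Field R] [LinearOrder R] [Ring A] [Algebra R A]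
    [StarRing A] (τ : A →ₗ[R] R) (n : ℕ) : Prop where
  star_smul : ∀ (r : R) (a : A), star (r • a) = r • star a
  trace_comm : ∀ a b, τ (a * b) = τ (b * a)
  trace_star : ∀ a, τ (star a) = τ a
  trace_nonneg : ∀ a, 0 ≤ τ (a * star a)
  exists_monic : ∀ a : A, ∃ χ : R[X], χ.Monic ∧ ∀ c, τ (aeval a χ * c) = 0
  exists_newton : ∀ a : A, ∃ E : R[X], IsNewton E (fun k => τ (a ^ k))
  exists_newton_sq : ∀ a b : A, star a = -a → star b = -b →
    ∃ q : R[X], q.coeff 0 = 1 ∧ IsNewton (q * q) (fun k => τ ((a * b) ^ k))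
  trace_one : τ 1 = n

namespace IsPreTraceAlgebra

variable {R A : Type} [Field R] [LinearOrder R] [Ring A] [Algebra R A]
  [StarRing A] {τ : A →ₗ[R] R} {n : ℕ}

/-- The radical of the trace form. -/
def radical (τ : A →ₗ[R] R) (hτ : ∀ a b, τ (a * b) = τ (b * a)) : Ideal A where
  carrier := {a | ∀ c, τ (a * c) = 0}
  add_mem' {a b} ha hb c := by rw [add_mul, map_add, ha, hb, add_zero]
  zero_mem' c := by rw [zero_mul, map_zero]
  smul_mem' x a ha c := by rw [smul_eq_mul, mul_assoc, hτ, mul_assoc, ha]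

instance (hτ : ∀ a b, τ (a * b) = τ (b * a)) : (radical τ hτ).IsTwoSided where
  mul_mem_of_left b ha c := by rw [mul_assoc, ha]

theorem star_mem_radical (h : IsPreTraceAlgebra τ n) {a : A}
    (ha : a ∈ radical τ h.trace_comm) : star a ∈ radical τ h.trace_comm := by
  intro c
  rw [← h.trace_star, star_mul, star_star, h.trace_comm]
  exact ha _

variable [IsStrictOrderedRing R]

theorem mem_radical_of_trace_eq_zero (h : IsPreTraceAlgebra τ n) {a : A}
    (ha : τ (a * star a) = 0) : a ∈ radical τ h.trace_comm := by
  intro c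
  by_contra ht
  have hs : 0 ≤ τ (star c * c) := by simpa using h.trace_nonneg (star c)
  set t := τ (a * c) with ht'
  set s := τ (star c * c) with hs'
  have h2 : τ (star c * star a) = t := by rw [← star_mul, h.trace_star]
  have h1 := h.trace_nonneg (a + (-t / (s + 1)) • star c)
  rw [star_add, h.star_smul, star_star, add_mul, mul_add, mul_add, map_add, map_add, map_add, ha,
    mul_smul_comm, smul_mul_assoc, smul_mul_smul_comm, map_smul, map_smul, map_smul, h2,
    ← ht', ← hs'] at h1
  simp only [smul_eq_mul] at h1
  have h3 : 0 + -t / (s + 1) * t + (-t / (s + 1) * t + -t / (s + 1) * (-t / (s + 1)) * s) =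
      -(t ^ 2 * (s + 2) / (s + 1) ^ 2) := by
    field_simp
    ring
  have h4 : 0 < t ^ 2 * (s + 2) / (s + 1) ^ 2 := by positivity
  rw [h3] at h1
  linarith

theorem exists_rep (h : IsPreTraceAlgebra τ n) (hR : PolyIVT R) :
    ∃ ρ : A →ₐ[R] Matrix (Fin n) (Fin n) R, (∀ a, ρ (star a) = (ρ a).transpose) ∧
      ∀ a, (ρ a).trace = τ a := by
  let I := radical τ h.trace_comm
  let π : A →ₐ[R] A ⧸ I := Ideal.Quotient.mkₐ R I
  have hπ : Function.Surjective π := Ideal.Quotient.mkₐ_surjective R I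
  have hπ0 : ∀ a, π a = 0 ↔ a ∈ I := fun a => Ideal.Quotient.eq_zero_iff_mem
  let σ := Function.surjInv hπ
  have hσ : ∀ x, π (σ x) = x := Function.surjInv_eq hπ
  have hσ' : ∀ a, σ (π a) - a ∈ I := fun a => by rw [← hπ0, map_sub, hσ, sub_self]
  have hstar : ∀ a, π (star (σ (π a))) = π (star a) := by
    intro a
    rw [← sub_eq_zero, ← map_sub, ← star_sub, hπ0]
    exact h.star_mem_radical (hσ' a)
  have htr : ∀ a, τ (σ (π a)) = τ a := by
    intro a
    rw [← sub_eq_zero, ← map_sub, ← mul_one (σ (π a) - a)]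
    exact hσ' a 1
  let _ : StarRing (A ⧸ I) :=
    { star := fun x => π (star (σ x))
      star_involutive := by
        intro x
        obtain ⟨a, rfl⟩ := hπ x
        change π (star (σ (π (star (σ (π a)))))) = π a
        rw [hstar a, hstar, star_star]
      star_mul := by
        intro x y
        obtain ⟨a, rfl⟩ := hπ x
        obtain ⟨b, rfl⟩ := hπ y
        change π (star (σ (π a * π b))) = π (star (σ (π b))) * π (star (σ (π a)))
        rw [← map_mul, hstar, hstar, hstar, star_mul, map_mul]
      star_add := by
        intro x y
        obtain ⟨a, rfl⟩ := hπ x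
        obtain ⟨b, rfl⟩ := hπ y
        change π (star (σ (π a + π b))) = π (star (σ (π a))) + π (star (σ (π b)))
        rw [← map_add, hstar, hstar, hstar, star_add, map_add] }
  have hs : ∀ a, star (π a) = π (star a) := hstar
  let τ' : A ⧸ I →ₗ[R] R :=
    { toFun := fun x => τ (σ x)
      map_add' := by
        intro x y
        obtain ⟨a, rfl⟩ := hπ x
        obtain ⟨b, rfl⟩ := hπ y
        rw [← map_add, htr, htr, htr, map_add]
      map_smul' := by
        intro r x
        obtain ⟨a, rfl⟩ := hπ x
        rw [← map_smul, htr, htr, map_smul, RingHom.id_apply] }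
  have ht : ∀ a, τ' (π a) = τ a := htr
  have H : IsTraceAlgebra τ' n :=
    { star_smul := by
        intro r x
        obtain ⟨a, rfl⟩ := hπ x
        rw [← map_smul, hs, hs, h.star_smul, map_smul]
      trace_comm := by
        intro x y
        obtain ⟨a, rfl⟩ := hπ x
        obtain ⟨b, rfl⟩ := hπ y
        rw [← map_mul, ← map_mul, ht, ht, h.trace_comm]
      trace_star := by
        intro x
        obtain ⟨a, rfl⟩ := hπ x
        rw [hs, ht, ht, h.trace_star]
      trace_pos := by
        intro x hx
        obtain ⟨a, rfl⟩ := hπ x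
        rw [hs, ← map_mul, ht]
        refine lt_of_le_of_ne (h.trace_nonneg a) fun h0 => hx ?_
        exact (hπ0 a).2 (h.mem_radical_of_trace_eq_zero h0.symm)
      exists_monic := by
        intro x
        obtain ⟨a, rfl⟩ := hπ x
        obtain ⟨χ, h1, h2⟩ := h.exists_monic a
        refine ⟨χ, h1, ?_⟩
        rw [aeval_algHom_apply]
        exact (hπ0 _).2 h2
      exists_newton := by
        intro x
        obtain ⟨a, rfl⟩ := hπ x
        simp only [← map_pow, ht]
        exact h.exists_newton a
      exists_newton_sq := by
        intro x y hx hy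
        have hskew : ∀ x : A ⧸ I, star x = -x → ∃ a, star a = -a ∧ π a = x := by
          intro x hx
          obtain ⟨a, rfl⟩ := hπ x
          refine ⟨(2⁻¹ : R) • (a - star a), ?_, ?_⟩
          · rw [h.star_smul, star_sub, star_star, ← smul_neg, neg_sub]
          · rw [map_smul, map_sub, ← hs, hx, sub_neg_eq_add, ← two_smul R, smul_smul,
              inv_mul_cancel₀ two_ne_zero, one_smul]
        obtain ⟨a, ha, rfl⟩ := hskew x hx
        obtain ⟨b, hb, rfl⟩ := hskew y hy
        simp only [← map_mul, ← map_pow, ht]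
        exact h.exists_newton_sq a b ha hb
      trace_one := by
        rw [← map_one π, ht, h.trace_one] }
  obtain ⟨ρ, h1, h2⟩ := H.exists_rep hR
  refine ⟨ρ.comp π, fun a => ?_, fun a => ?_⟩
  · rw [AlgHom.comp_apply, AlgHom.comp_apply, ← hs, h1]
  · rw [AlgHom.comp_apply, h2, ht]

end IsPreTraceAlgebra

end

section

open Polynomial

theorem IsNewton.map {R S : Type} [CommRing R] [CommRing S] {E : R[X]} {t : ℕ → R}
    (h : IsNewton E t) (f : R →+* S) : IsNewton (E.map f) (fun k => f (t k)) := by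
  refine ⟨by rw [coeff_map, h.1, map_one], fun k => ?_⟩
  have h1 := congrArg f (h.2 k)
  simpa only [map_mul, map_natCast, map_neg, map_sum, coeff_map] using h1

theorem IsNewton.of_map {R S : Type} [CommRing R] [CommRing S] {E : R[X]} {t : ℕ → R}
    {f : R →+* S} (hf : Function.Injective f) (h : IsNewton (E.map f) (fun k => f (t k))) :
    IsNewton E t := by
  refine ⟨hf (by rw [← coeff_map, h.1, map_one]), fun k => hf ?_⟩
  have h1 := h.2 k
  simpa only [map_mul, map_natCast, map_neg, map_sum, coeff_map] using h1

theorem Matrix.charpoly_mem_lifts {k D m : Type} [CommRing k] [CommRing D]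
    {ι : k →+* D} [Fintype m] [DecidableEq m] {M : Matrix m m D}
    (h : M.charpolyRev ∈ lifts ι) : M.charpoly ∈ lifts ι := by
  rw [lifts_iff_coeff_lifts] at h ⊢
  intro i
  have h1 := h (revAt M.charpoly.natDegree i)
  rwa [← reverse_charpoly, coeff_reverse, revAt_invol] at h1

section Lift

variable {k D : Type} [CommRing k] [Algebra ℚ k] [CommRing D] [IsDomain D] [CharZero D]
  {ι : k →+* D}

theorem mem_range_of_natCast_mul_mem_range {x : D} {m : ℕ} (hm : m ≠ 0)
    (hx : (m : D) * x ∈ ι.range) : x ∈ ι.range := by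
  obtain ⟨y, hy⟩ := hx
  refine ⟨algebraMap ℚ k (m : ℚ)⁻¹ * y, mul_left_cancel₀ (Nat.cast_ne_zero.2 hm) ?_⟩
  have h1 : (m : k) * algebraMap ℚ k (m : ℚ)⁻¹ = 1 := by
    rw [← map_natCast (algebraMap ℚ k) m, ← map_mul, mul_inv_cancel₀ (Nat.cast_ne_zero.2 hm),
      map_one]
  rw [← hy, ← map_natCast ι m, ← map_mul, ← mul_assoc, h1, one_mul]

theorem IsNewton.mem_lifts {E : D[X]} {t : ℕ → k} (h : IsNewton E (fun k => ι (t k))) :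
    E ∈ lifts ι := by
  rw [lifts_iff_coeff_lifts]
  intro m
  change E.coeff m ∈ ι.range
  induction m using Nat.strong_induction_on with
  | _ m ih =>
  cases m with
  | zero =>
    rw [h.1]
    exact one_mem _
  | succ m =>
    refine mem_range_of_natCast_mul_mem_range (Nat.succ_ne_zero m) ?_
    rw [h.2]
    refine neg_mem (sum_mem fun p hp => mul_mem (ih _ ?_) ⟨_, rfl⟩)
    have := Finset.HasAntidiagonal.mem_antidiagonal.1 hp
    omega

theorem mem_lifts_of_mul_self {q : D[X]} (h0 : q.coeff 0 = 1) (h : q * q ∈ lifts ι) :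
    q ∈ lifts ι := by
  rw [lifts_iff_coeff_lifts] at h ⊢
  intro m
  change q.coeff m ∈ ι.range
  induction m using Nat.strong_induction_on with
  | _ m ih =>
  cases m with
  | zero =>
    rw [h0]
    exact one_mem _
  | succ m =>
    refine mem_range_of_natCast_mul_mem_range two_ne_zero ?_
    have h1 : (q * q).coeff (m + 1) ∈ ι.range := h (m + 1)
    rw [coeff_mul, Finset.Nat.sum_antidiagonal_succ,
      ← Finset.add_sum_erase _ _ (show (m, 0) ∈ Finset.HasAntidiagonal.antidiagonal m by simp),
      h0] at h1
    dsimp only at h1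
    rw [one_mul, mul_one, ← add_assoc] at h1
    have h2 : ∑ x ∈ (Finset.HasAntidiagonal.antidiagonal m).erase (m, 0),
        q.coeff (x.1 + 1) * q.coeff x.2 ∈ ι.range := by
      refine sum_mem fun p hp => ?_
      have h3 := Finset.HasAntidiagonal.mem_antidiagonal.1 (Finset.mem_of_mem_erase hp)
      have h4 : p.2 ≠ 0 := by
        intro h4
        exact Finset.ne_of_mem_erase hp (Prod.ext (by omega) h4)
      exact mul_mem (ih _ (by omega)) (ih _ (by omega))
    have h5 := sub_mem h1 h2
    rw [add_sub_cancel_right, ← two_mul] at h5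
    exact_mod_cast h5

end Lift

/-- An algebra `B` with involution over the ring `k` mapping to matrices over `D`, together with a
specialization `A` of `B` over the field `R`. -/
structure IsTraceModel {R D k B A : Type} [Field R] [LinearOrder R] [CommRing D] [CommRing k]
    [Ring B] [Algebra k B] [StarRing B] [Ring A] [Algebra R A] [StarRing A] {n : ℕ}
    (ι : k →+* D) (ψ : k →+* R) (θ : B →+* Matrix (Fin n) (Fin n) D) (T : B → k) (π : B →+* A)
    (τ : A →ₗ[R] R) : Prop where
  injective : Function.Injective ι
  star_smul : ∀ (c : k) (b : B), star (c • b) = c • star b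
  star_smul' : ∀ (r : R) (a : A), star (r • a) = r • star a
  toMatrix_star : ∀ b, θ (star b) = (θ b).transpose
  toMatrix_smul : ∀ c b, θ (c • b) = ι c • θ b
  map_trace : ∀ b, ι (T b) = (θ b).trace
  surjective : Function.Surjective π
  map_star : ∀ b, π (star b) = star (π b)
  map_smul : ∀ c b, π (c • b) = ψ c • π b
  trace_map : ∀ b, τ (π b) = ψ (T b)
  trace_nonneg : ∀ a, 0 ≤ τ (a * star a)

namespace IsTraceModel

variable {R D k B A : Type} [Field R] [LinearOrder R] [CommRing D] [CommRing k]
  [Ring B] [Algebra k B] [StarRing B] [Ring A] [Algebra R A] [StarRing A] {n : ℕ}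
  {ι : k →+* D} {ψ : k →+* R} {θ : B →+* Matrix (Fin n) (Fin n) D} {T : B → k} {π : B →+* A}
  {τ : A →ₗ[R] R}

theorem trace_eq (h : IsTraceModel ι ψ θ T π τ) {b c : B} (hbc : (θ b).trace = (θ c).trace) :
    τ (π b) = τ (π c) := by
  rw [h.trace_map, h.trace_map, h.injective (a₁ := T b) (a₂ := T c)]
  rw [h.map_trace, h.map_trace, hbc]

theorem toMatrix_aeval (h : IsTraceModel ι ψ θ T π τ) (b : B) (χ : k[X]) :
    θ (aeval b χ) = aeval (θ b) (χ.map ι) := by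
  rw [aeval_eq_sum_range, aeval_eq_sum_range' (Nat.lt_succ_of_le natDegree_map_le), map_sum]
  refine Finset.sum_congr rfl fun i _ => ?_
  rw [h.toMatrix_smul, map_pow, coeff_map]

theorem map_aeval (h : IsTraceModel ι ψ θ T π τ) (b : B) (χ : k[X]) :
    π (aeval b χ) = aeval (π b) (χ.map ψ) := by
  rw [aeval_eq_sum_range, aeval_eq_sum_range' (Nat.lt_succ_of_le natDegree_map_le), map_sum]
  refine Finset.sum_congr rfl fun i _ => ?_
  rw [h.map_smul, map_pow, coeff_map]

theorem isNewton_charpolyRev (h : IsTraceModel ι ψ θ T π τ) (b : B) :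
    IsNewton (θ b).charpolyRev (fun k => ι (T (b ^ k))) := by
  simp only [h.map_trace, map_pow]
  exact Matrix.isNewton_charpolyRev _

theorem exists_skew_lift [IsStrictOrderedRing R] [Algebra ℚ k] (h : IsTraceModel ι ψ θ T π τ)
    {a : A} (ha : star a = -a) : ∃ b, star b = -b ∧ π b = a := by
  obtain ⟨b, rfl⟩ := h.surjective a
  refine ⟨algebraMap ℚ k 2⁻¹ • (b - star b), ?_, ?_⟩
  · rw [h.star_smul, star_sub, star_star, ← smul_neg, neg_sub]
  · have h1 : ψ (algebraMap ℚ k 2⁻¹) = (2 : R)⁻¹ := by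
      rw [← RingHom.comp_apply, eq_ratCast]
      norm_num
    rw [h.map_smul, map_sub, h.map_star, ha, sub_neg_eq_add, h1, ← two_smul R, smul_smul,
      inv_mul_cancel₀ two_ne_zero, one_smul]

theorem isPreTraceAlgebra [IsStrictOrderedRing R] [Algebra ℚ k] [IsDomain D] [CharZero D]
    [IsIntegrallyClosed D[X]] (h : IsTraceModel ι ψ θ T π τ) : IsPreTraceAlgebra τ n where
  star_smul := h.star_smul'
  trace_comm a b := by
    obtain ⟨a, rfl⟩ := h.surjective a
    obtain ⟨b, rfl⟩ := h.surjective b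
    rw [← map_mul, ← map_mul]
    refine h.trace_eq ?_
    rw [map_mul, map_mul, Matrix.trace_mul_comm]
  trace_star a := by
    obtain ⟨a, rfl⟩ := h.surjective a
    rw [← h.map_star]
    refine h.trace_eq ?_
    rw [h.toMatrix_star, Matrix.trace_transpose]
  trace_nonneg := h.trace_nonneg
  exists_monic a := by
    obtain ⟨b, rfl⟩ := h.surjective a
    obtain ⟨χ, h1, -, h2⟩ := lifts_and_natDegree_eq_and_monic
      (Matrix.charpoly_mem_lifts (h.isNewton_charpolyRev b).mem_lifts)
      (Matrix.charpoly_monic (θ b))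
    refine ⟨χ.map ψ, h2.map ψ, fun c => ?_⟩
    obtain ⟨c, rfl⟩ := h.surjective c
    rw [← h.map_aeval, ← map_mul, h.trace_eq (c := 0), map_zero, map_zero]
    rw [map_mul, h.toMatrix_aeval, h1, Matrix.aeval_self_charpoly, zero_mul, map_zero]
  exists_newton a := by
    obtain ⟨b, rfl⟩ := h.surjective a
    obtain ⟨E, hE⟩ := (mem_lifts _).1 (h.isNewton_charpolyRev b).mem_lifts
    have h1 := h.isNewton_charpolyRev b
    rw [← hE] at h1
    refine ⟨E.map ψ, ?_⟩
    simp only [← map_pow, h.trace_map]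
    exact (h1.of_map h.injective).map ψ
  exists_newton_sq a b ha hb := by
    obtain ⟨a, ha', rfl⟩ := h.exists_skew_lift ha
    obtain ⟨b, hb', rfl⟩ := h.exists_skew_lift hb
    obtain ⟨q, h0, hq⟩ := Matrix.exists_charpolyRev_eq_sq
      (a := θ a) (b := θ b) (by rw [← h.toMatrix_star, ha', map_neg])
      (by rw [← h.toMatrix_star, hb', map_neg])
    have h1 := h.isNewton_charpolyRev (a * b)
    rw [map_mul, hq] at h1
    obtain ⟨p, rfl⟩ := (mem_lifts _).1 (mem_lifts_of_mul_self h0 h1.mem_lifts)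
    refine ⟨p.map ψ, ?_, ?_⟩
    · rw [coeff_map] at h0 ⊢
      rw [h.injective (h0.trans (map_one ι).symm), map_one]
    · rw [← Polynomial.map_mul] at h1 ⊢
      simp only [← map_mul, ← map_pow, h.trace_map]
      exact (h1.of_map h.injective).map ψ
  trace_one := by
    have h1 : T 1 = n := h.injective (by rw [h.map_trace, map_one, map_natCast]; simp)
    rw [← map_one π, h.trace_map, h1, map_natCast]

end IsTraceModel

end

section Quadratic

variable {R : Type} [CommRing R] [LinearOrder R] [IsStrictOrderedRing R]

theorem quadratic_nonneg_of_subring_fin (P : Subring R) : ∀ (N : ℕ) (G : Fin N → Fin N → R),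
    (∀ i j, G i j = G j i) → (∀ i j, G i j ∈ P) →
    (∀ x : Fin N → R, (∀ i, x i ∈ P) → 0 ≤ ∑ i, ∑ j, x i * x j * G i j) →
    ∀ x : Fin N → R, 0 ≤ ∑ i, ∑ j, x i * x j * G i j
  | 0, _, _, _, _, _ => by simp
  | N + 1, G, hs, hP, h, x => by
    have hq : ∀ (t : R) (y : Fin N → R),
        ∑ i, ∑ j, (Fin.cons t y : Fin (N + 1) → R) i * (Fin.cons t y : Fin (N + 1) → R) j * G i j =
          t * t * G 0 0 + 2 * t * (∑ j, y j * G 0 j.succ) +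
            ∑ i, ∑ j, y i * y j * G i.succ j.succ := by
      intro t y
      simp only [Fin.sum_univ_succ, Fin.cons_zero, Fin.cons_succ, Finset.sum_add_distrib]
      have h1 : ∑ i, t * y i * G 0 i.succ = t * ∑ j, y j * G 0 j.succ := by
        rw [Finset.mul_sum]
        exact Finset.sum_congr rfl fun _ _ => by ring
      have h2 : ∑ i, y i * t * G i.succ 0 = t * ∑ j, y j * G 0 j.succ := by
        rw [Finset.mul_sum]
        exact Finset.sum_congr rfl fun _ _ => by rw [hs _ 0]; ring
      rw [h1, h2]
      ring
    have hc : ∀ (t : R) (y : Fin N → R), t ∈ P → (∀ i, y i ∈ P) →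
        0 ≤ t * t * G 0 0 + 2 * t * (∑ j, y j * G 0 j.succ) +
            ∑ i, ∑ j, y i * y j * G i.succ j.succ := by
      intro t y ht hy
      rw [← hq]
      refine h _ fun i => ?_
      cases i using Fin.cases with
      | zero => exact ht
      | succ i => exact hy i
    have h00 : 0 ≤ G 0 0 := by simpa using hc 1 0 (one_mem _) fun _ => zero_mem _
    have hx : x = Fin.cons (x 0) fun i => x i.succ := (Fin.cons_self_tail x).symm
    rw [hx, hq]
    set y := fun i : Fin N => x i.succ
    rcases h00.eq_or_lt with h0 | h0
    · have hz : ∀ j : Fin N, G 0 j.succ = 0 := by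
        intro j
        have h1 := hc (-(G j.succ j.succ + 1)) (Pi.single j (G 0 j.succ))
          (neg_mem (add_mem (hP _ _) (one_mem _))) (by
            intro i
            by_cases hij : i = j
            · subst hij
              simpa using hP _ _
            · simp [hij])
        have h2 := hc 0 (Pi.single j 1) (zero_mem _) (by
            intro i
            by_cases hij : i = j
            · subst hij
              simp
            · simp [hij])
        rw [← h0] at h1 h2
        simp only [Pi.single_apply, ite_mul, mul_ite, zero_mul, mul_zero, Finset.sum_ite_eq',
          Finset.mem_univ, if_true, zero_add, one_mul,
          add_zero] at h1 h2
        by_contra hne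
        have h3 : 0 < G 0 j.succ * G 0 j.succ := mul_self_pos.2 hne
        nlinarith [mul_nonneg h3.le h2]
      have ih := quadratic_nonneg_of_subring_fin P N (fun i j => G i.succ j.succ)
        (fun i j => hs _ _) (fun i j => hP _ _) (fun y hy => by
          simpa [hz, ← h0] using hc 0 y (zero_mem _) hy) y
      simpa [hz, ← h0] using ih
    · have hG : ∀ y : Fin N → R,
          ∑ i, ∑ j, y i * y j * (G 0 0 * G i.succ j.succ - G 0 i.succ * G 0 j.succ) =
          G 0 0 * ∑ i, ∑ j, y i * y j * G i.succ j.succ -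
            (∑ j, y j * G 0 j.succ) * ∑ j, y j * G 0 j.succ := by
        intro y
        rw [Finset.sum_mul_sum, Finset.mul_sum, ← Finset.sum_sub_distrib]
        refine Finset.sum_congr rfl fun i _ => ?_
        rw [Finset.mul_sum, ← Finset.sum_sub_distrib]
        exact Finset.sum_congr rfl fun j _ => by ring
      have ih := quadratic_nonneg_of_subring_fin P N
        (fun i j => G 0 0 * G i.succ j.succ - G 0 i.succ * G 0 j.succ)
        (fun i j => by rw [hs i.succ, mul_comm (G 0 i.succ)])
        (fun i j => sub_mem (mul_mem (hP _ _) (hP _ _)) (mul_mem (hP _ _) (hP _ _)))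
        (fun y hy => by
          have h1 := hc (-∑ j, y j * G 0 j.succ) (fun i => G 0 0 * y i)
            (neg_mem (sum_mem fun j _ => mul_mem (hy _) (hP _ _)))
            fun i => mul_mem (hP _ _) (hy i)
          have h2 : ∑ j, G 0 0 * y j * G 0 j.succ = G 0 0 * ∑ j, y j * G 0 j.succ := by
            rw [Finset.mul_sum]
            exact Finset.sum_congr rfl fun _ _ => by ring
          have h3 : ∑ i, ∑ j, G 0 0 * y i * (G 0 0 * y j) * G i.succ j.succ =
              G 0 0 * (G 0 0 * ∑ i, ∑ j, y i * y j * G i.succ j.succ) := by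
            simp only [Finset.mul_sum]
            exact Finset.sum_congr rfl fun _ _ => Finset.sum_congr rfl fun _ _ => by ring
          rw [h2, h3] at h1
          rw [hG]
          refine nonneg_of_mul_nonneg_right (a := G 0 0) ?_ h0
          linarith) y
      rw [hG] at ih
      refine nonneg_of_mul_nonneg_right (a := G 0 0) ?_ h0
      nlinarith [mul_self_nonneg (G 0 0 * x 0 + ∑ j, y j * G 0 j.succ)]

/-- A quadratic form with coefficients in a subring that is nonnegative on the points of the
subring is nonnegative. -/
theorem quadratic_nonneg_of_subring (P : Subring R) {m : Type} (s : Finset m) (G : m → m → R)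
    (hs : ∀ i j, G i j = G j i) (hP : ∀ i j, G i j ∈ P)
    (h : ∀ x : m → R, (∀ i, x i ∈ P) → 0 ≤ ∑ i ∈ s, ∑ j ∈ s, x i * x j * G i j) (x : m → R) :
    0 ≤ ∑ i ∈ s, ∑ j ∈ s, x i * x j * G i j := by
  let e := s.equivFin
  have key : ∀ x : m → R, ∑ i ∈ s, ∑ j ∈ s, x i * x j * G i j =
      ∑ i, ∑ j, x (e.symm i) * x (e.symm j) * G (e.symm i) (e.symm j) := by
    intro x
    rw [← Finset.sum_coe_sort, ← e.symm.sum_comp]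
    refine Finset.sum_congr rfl fun i _ => ?_
    rw [← Finset.sum_coe_sort, ← e.symm.sum_comp]
  rw [key]
  refine quadratic_nonneg_of_subring_fin P _ (fun i j => G (e.symm i) (e.symm j))
    (fun i j => hs _ _) (fun i j => hP _ _) (fun y hy => ?_) fun i => x (e.symm i)
  classical
  let z : m → R := fun i => if hi : i ∈ s then y (e ⟨i, hi⟩) else 0
  have hz : ∀ i, z (e.symm i) = y i := fun i => by simp [z]
  have h1 := h z fun i => by
    by_cases hi : i ∈ s
    · simpa [z, hi] using hy _
    · simp [z, hi]
  rw [key] at h1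
  simpa only [hz] using h1

end Quadratic

section

open Polynomial

/-- The involution on a monoid algebra induced by an involution on the monoid. -/
abbrev MonoidAlgebra.starRing (k W : Type) [CommSemiring k] [Monoid W] [StarMul W] :
    StarRing (MonoidAlgebra k W) where
  star := MonoidAlgebra.mapDomain star
  star_involutive x := by
    induction x using MonoidAlgebra.induction_linear with
    | zero => simp
    | add x y hx hy => rw [mapDomain_add, mapDomain_add, hx, hy]
    | single w r => rw [mapDomain_single, mapDomain_single, star_star]
  star_add := MonoidAlgebra.mapDomain_add _
  star_mul x y := by
    induction x using MonoidAlgebra.induction_linear with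
    | zero => simp
    | add x₁ x₂ h1 h2 => rw [add_mul, mapDomain_add, mapDomain_add, mul_add, h1, h2]
    | single w r =>
      induction y using MonoidAlgebra.induction_linear with
      | zero => simp
      | add y₁ y₂ h1 h2 => rw [mul_add, mapDomain_add, mapDomain_add, add_mul, h1, h2]
      | single v s =>
        rw [single_mul_single, mapDomain_single, mapDomain_single, mapDomain_single,
          single_mul_single, star_mul, mul_comm r s]

attribute [local instance] MonoidAlgebra.starRing

theorem MonoidAlgebra.star_single {k W : Type} [CommSemiring k] [Monoid W] [StarMul W] (w : W)
    (r : k) : star (MonoidAlgebra.single w r) = MonoidAlgebra.single (star w) r :=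
  MonoidAlgebra.mapDomain_single

theorem MonoidAlgebra.star_smul_eq {k W : Type} [CommSemiring k] [Monoid W] [StarMul W] (r : k)
    (x : MonoidAlgebra k W) : star (r • x) = r • star x := by
  induction x using MonoidAlgebra.induction_linear with
  | zero => simp
  | add x y hx hy => rw [smul_add, star_add, hx, hy, star_add, smul_add]
  | single w s => rw [smul_single, star_single, star_single, smul_single]

/-- A real closed specialization of the traces of a matrix representation comes from a matrix
representation, provided that it is positive. -/
theorem PolyIVT.exists_rep_of_trace {R W P C : Type} [Field R] [LinearOrder R]
    [IsStrictOrderedRing R] (hR : PolyIVT R) [Monoid W] [StarMul W] [CommRing P] [IsDomain P]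
    [UniqueFactorizationMonoid P] [CharZero P] [CommRing C] [Algebra ℚ C] {n : ℕ}
    (ι : C →+* P) (hι : Function.Injective ι) (φ : C →+* R)
    (v : W →* Matrix (Fin n) (Fin n) P) (hv : ∀ w, v (star w) = (v w).transpose)
    (t : W → C) (ht : ∀ w, ι (t w) = (v w).trace)
    (hpos : ∀ (s : Finset W) (c : W → C),
      0 ≤ φ (∑ i ∈ s, ∑ j ∈ s, c i * c j * t (i * star j))) :
    ∃ ρ : W →* Matrix (Fin n) (Fin n) R, (∀ w, ρ (star w) = (ρ w).transpose) ∧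
      ∀ w, (ρ w).trace = φ (t w) := by
  let k := MvPolynomial R C
  let D := MvPolynomial R P
  let ψ : k →+* R := MvPolynomial.eval₂Hom φ id
  let ι' : k →+* D := MvPolynomial.map ι
  let v' : W →* Matrix (Fin n) (Fin n) D :=
    (((MvPolynomial.C : P →+* D).mapMatrix : Matrix (Fin n) (Fin n) P →+* _) : _ →* _).comp v
  let θ : MonoidAlgebra k W →+* Matrix (Fin n) (Fin n) D :=
    MonoidAlgebra.liftNCRingHom ((Matrix.scalar (Fin n)).comp ι') v'
      fun x w => Matrix.scalar_commute _ (mul_comm _) _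
  have hθ : ∀ w c, θ (MonoidAlgebra.single w c) = ι' c • (v w).map MvPolynomial.C := by
    intro w c
    rw [MonoidAlgebra.liftNCRingHom_single, Matrix.smul_eq_diagonal_mul]
    rfl
  let T : MonoidAlgebra k W →+ k :=
    MonoidAlgebra.liftNC (AddMonoidHom.id k) fun w => MvPolynomial.C (t w)
  have hT : ∀ w c, T (MonoidAlgebra.single w c) = c * MvPolynomial.C (t w) :=
    fun w c => MonoidAlgebra.liftNC_single _ _ _ _
  let π : MonoidAlgebra k W →+* MonoidAlgebra R W := MonoidAlgebra.mapRingHom W ψ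
  have hπ : ∀ w c, π (MonoidAlgebra.single w c) = MonoidAlgebra.single w (ψ c) :=
    fun w c => MonoidAlgebra.mapRingHom_single _ _ _
  let τ : MonoidAlgebra R W →ₗ[R] R :=
    (Finsupp.linearCombination R fun w => φ (t w)).comp
      (MonoidAlgebra.coeffLinearEquiv R).toLinearMap
  have hτ : ∀ w r, τ (MonoidAlgebra.single w r) = r * φ (t w) := by
    intro w r
    simp [τ]
  have hstar : ∀ w, t (star w) = t w := by
    intro w
    apply hι
    rw [ht, ht, hv, Matrix.trace_transpose]
  have h : IsTraceModel ι' ψ θ T π τ :=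
    { injective := MvPolynomial.map_injective _ hι
      star_smul := MonoidAlgebra.star_smul_eq
      star_smul' := MonoidAlgebra.star_smul_eq
      toMatrix_star := by
        intro b
        induction b using MonoidAlgebra.induction_linear with
        | zero => simp
        | add x y hx hy => rw [star_add, map_add, hx, hy, map_add, Matrix.transpose_add]
        | single w r =>
          rw [MonoidAlgebra.star_single, hθ, hθ, hv, Matrix.transpose_smul, Matrix.transpose_map]
      toMatrix_smul := by
        intro c b
        induction b using MonoidAlgebra.induction_linear with
        | zero => simp
        | add x y hx hy => rw [smul_add, map_add, hx, hy, map_add, smul_add]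
        | single w r =>
          rw [MonoidAlgebra.smul_single, hθ, hθ, smul_smul, smul_eq_mul, map_mul]
      map_trace := by
        intro b
        induction b using MonoidAlgebra.induction_linear with
        | zero => simp
        | add x y hx hy => rw [map_add, map_add, hx, hy, map_add, Matrix.trace_add]
        | single w r =>
          rw [hT, hθ, map_mul, MvPolynomial.map_C, ht, Matrix.trace_smul, smul_eq_mul,
            AddMonoidHom.map_trace]
      surjective := MonoidAlgebra.map_surjective (ψ : k →+ R)
        fun r => ⟨MvPolynomial.X r, MvPolynomial.eval₂Hom_X' _ _ _⟩
      map_star := by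
        intro b
        induction b using MonoidAlgebra.induction_linear with
        | zero => simp
        | add x y hx hy => rw [star_add, map_add, hx, hy, map_add, star_add]
        | single w r => rw [MonoidAlgebra.star_single, hπ, hπ, MonoidAlgebra.star_single]
      map_smul := by
        intro c b
        induction b using MonoidAlgebra.induction_linear with
        | zero => simp
        | add x y hx hy => rw [smul_add, map_add, hx, hy, map_add, smul_add]
        | single w r =>
          rw [MonoidAlgebra.smul_single, hπ, hπ, MonoidAlgebra.smul_single, smul_eq_mul,
            smul_eq_mul, map_mul]
      trace_map := by
        intro b
        induction b using MonoidAlgebra.induction_linear with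
        | zero => simp
        | add x y hx hy => rw [map_add, map_add, hx, hy, map_add, map_add]
        | single w r =>
          rw [hT, hπ, hτ, map_mul]
          exact congrArg _ (MvPolynomial.eval₂Hom_C _ _ _).symm
      trace_nonneg := by
        intro a
        have h1 : τ (a * star a) = ∑ i ∈ a.coeff.support, ∑ j ∈ a.coeff.support,
            a.coeff i * a.coeff j * φ (t (i * star j)) := by
          have h2 : a = ∑ i ∈ a.coeff.support, MonoidAlgebra.single i (a.coeff i) :=
            (MonoidAlgebra.sum_coeff_single a).symm
          conv_lhs => rw [h2]
          rw [star_sum, Finset.sum_mul_sum, map_sum]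
          refine Finset.sum_congr rfl fun i _ => ?_
          rw [map_sum]
          refine Finset.sum_congr rfl fun j _ => ?_
          rw [MonoidAlgebra.star_single, MonoidAlgebra.single_mul_single, hτ]
        rw [h1]
        refine quadratic_nonneg_of_subring φ.range _ _ (fun i j => ?_) (fun i j => ⟨_, rfl⟩)
          (fun x hx => ?_) _
        · rw [← hstar, star_mul, star_star]
        · choose c hc using hx
          have h2 := hpos a.coeff.support c
          simpa only [map_sum, map_mul, hc] using h2 }
  have : IsIntegrallyClosed D[X] := inferInstance
  obtain ⟨ρ, h1, h2⟩ := h.isPreTraceAlgebra.exists_rep hR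
  refine ⟨(ρ : MonoidAlgebra R W →* Matrix (Fin n) (Fin n) R).comp (MonoidAlgebra.of R W),
    fun w => ?_, fun w => ?_⟩
  · change ρ (MonoidAlgebra.single (star w) 1) = (ρ (MonoidAlgebra.single w 1)).transpose
    rw [← h1, MonoidAlgebra.star_single]
  · change (ρ (MonoidAlgebra.single w 1)).trace = _
    rw [h2, hτ, one_mul]

end

section TraceRing

variable {n g : ℕ}

theorem transpose_mem_closure_genSet {w : MatP n g} (hw : w ∈ Submonoid.closure (genSet n g)) :
    wᵀ ∈ Submonoid.closure (genSet n g) := by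
  induction hw using Submonoid.closure_induction with
  | mem w hw =>
    refine Submonoid.subset_closure ?_
    rcases hw with ⟨j, rfl⟩ | ⟨j, rfl⟩
    · exact Or.inr ⟨j, rfl⟩
    · exact Or.inl ⟨j, rfl⟩
  | one => simp
  | mul x y _ _ hx hy =>
    rw [transpose_mul]
    exact mul_mem hy hx

instance : StarMul (Submonoid.closure (genSet n g)) where
  star w := ⟨(w : MatP n g)ᵀ, transpose_mem_closure_genSet w.2⟩
  star_involutive _ := Subtype.ext (transpose_transpose _)
  star_mul _ _ := Subtype.ext (transpose_mul _ _)

/-- The algebra generated by the traces of words in the generic matrices and their transposes. -/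
def traceSubalgebra (n g : ℕ) : Subalgebra ℝ (PolyRing n g) :=
  Algebra.adjoin ℝ (trace '' (Submonoid.closure (genSet n g) : Set (MatP n g)))

theorem coe_smul_matrix (c : traceSubalgebra n g) (h : MatP n g) :
    c • h = (c : PolyRing n g) • h :=
  rfl

theorem mem_span_of_mem_traceRing {h : MatP n g} (hh : h ∈ traceRing n g) :
    h ∈ Submodule.span (traceSubalgebra n g)
      (Submonoid.closure (genSet n g) : Set (MatP n g)) := by
  rw [← Algebra.adjoin_eq_span]
  change h ∈ Algebra.adjoin (traceSubalgebra n g) (genSet n g)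
  induction hh using Algebra.adjoin_induction with
  | mem x hx =>
    rcases hx with hx | ⟨w, hw, rfl⟩
    · exact Algebra.subset_adjoin hx
    · have h2 : w.trace ∈ traceSubalgebra n g :=
        Algebra.subset_adjoin (Set.mem_image_of_mem _ hw)
      rw [← coe_smul_matrix ⟨_, h2⟩, ← Algebra.algebraMap_eq_smul_one]
      exact Subalgebra.algebraMap_mem _ _
  | algebraMap r =>
    rw [IsScalarTower.algebraMap_apply ℝ (traceSubalgebra n g)]
    exact Subalgebra.algebraMap_mem _ _
  | add x y _ _ hx hy => exact add_mem hx hy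
  | mul x y _ _ hx hy => exact mul_mem hx hy

theorem trace_mem_traceSubalgebra {h : MatP n g} (hh : h ∈ traceRing n g) :
    h.trace ∈ traceSubalgebra n g := by
  have hh' := mem_span_of_mem_traceRing hh
  clear hh
  induction hh' using Submodule.span_induction with
  | mem w hw => exact Algebra.subset_adjoin (Set.mem_image_of_mem _ hw)
  | zero =>
    rw [trace_zero]
    exact zero_mem _
  | add x y _ _ hx hy =>
    rw [trace_add]
    exact add_mem hx hy
  | smul c x _ hx =>
    rw [trace_smul]
    exact mul_mem c.2 hx

theorem smul_one_mem_traceRing {c : PolyRing n g} (hc : c ∈ traceSubalgebra n g) :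
    c • (1 : MatP n g) ∈ traceRing n g := by
  induction hc using Algebra.adjoin_induction with
  | mem c hc =>
    obtain ⟨w, hw, rfl⟩ := hc
    exact Algebra.subset_adjoin (Or.inr ⟨w, hw, rfl⟩)
  | algebraMap r =>
    rw [algebraMap_smul, ← Algebra.algebraMap_eq_smul_one]
    exact Subalgebra.algebraMap_mem _ _
  | add x y _ _ hx hy =>
    rw [add_smul]
    exact add_mem hx hy
  | mul x y _ _ hx hy =>
    rw [← mul_one (1 : MatP n g), ← smul_mul_smul_comm]
    exact mul_mem hx hy

theorem smul_mem_traceRing {c : PolyRing n g} (hc : c ∈ traceSubalgebra n g) {h : MatP n g}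
    (hh : h ∈ traceRing n g) : c • h ∈ traceRing n g := by
  rw [← one_mul h, ← smul_mul_assoc]
  exact mul_mem (smul_one_mem_traceRing hc) hh

theorem closure_genSet_le_traceRing {w : MatP n g}
    (hw : w ∈ Submonoid.closure (genSet n g)) : w ∈ traceRing n g :=
  (Submonoid.closure_le (S := (traceRing n g).toSubmonoid)).2
    (fun _ hx => Algebra.subset_adjoin (Or.inl hx)) hw

theorem transpose_mem_traceRing {h : MatP n g} (hh : h ∈ traceRing n g) :
    hᵀ ∈ traceRing n g := by
  induction hh using Algebra.adjoin_induction with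
  | mem h hh =>
    rcases hh with hh | ⟨w, hw, rfl⟩
    · exact closure_genSet_le_traceRing
        (transpose_mem_closure_genSet (Submonoid.subset_closure hh))
    · rw [transpose_smul, transpose_one]
      exact Algebra.subset_adjoin (Or.inr ⟨w, hw, rfl⟩)
  | algebraMap r =>
    rw [Algebra.algebraMap_eq_smul_one, transpose_smul, transpose_one,
      ← Algebra.algebraMap_eq_smul_one]
    exact Subalgebra.algebraMap_mem _ _
  | add x y _ _ hx hy =>
    rw [transpose_add]
    exact add_mem hx hy
  | mul x y _ _ hx hy =>
    rw [transpose_mul]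
    exact mul_mem hy hx

theorem omegaSet_eq_closure : OmegaSet n g = (Subsemiring.closure
    {c : MatP n g | ∃ h ∈ traceRing n g, c = (trace (h * hᵀ)) • (1 : MatP n g)} :
      Set (MatP n g)) := by
  rw [Subsemiring.coe_closure_eq]
  rfl

/-- A trace certificate that the equations `s = 0`, `s ∈ S`, have no common solution. -/
def HasCertificate (n g : ℕ) (S : Set (MatP n g)) : Prop :=
  ∃ ω ∈ OmegaSet n g, ∃ (k : ℕ) (h : Fin k → MatP n g) (s : Fin k → MatP n g),
    (∀ i, h i ∈ traceRing n g) ∧ (∀ i, s i ∈ S) ∧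
    (-1 : MatP n g) = ω + ∑ i, (Matrix.trace (h i * s i)) • (1 : MatP n g)

/-- The ideal of the trace subalgebra generated by the traces `tr (h * s)`. -/
def traceIdeal (S : Set (MatP n g)) : Ideal (traceSubalgebra n g) :=
  Ideal.span {c | ∃ h ∈ traceRing n g, ∃ s ∈ S, (c : PolyRing n g) = trace (h * s)}

theorem exists_sum_of_mem_traceIdeal {S : Set (MatP n g)} {c : traceSubalgebra n g}
    (hc : c ∈ traceIdeal S) : ∃ (k : ℕ) (h : Fin k → MatP n g) (s : Fin k → MatP n g),
      (∀ i, h i ∈ traceRing n g) ∧ (∀ i, s i ∈ S) ∧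
      (c : PolyRing n g) = ∑ i, trace (h i * s i) := by
  obtain ⟨k, f, d, rfl⟩ := Submodule.mem_span_set'.1 hc
  choose h hh s hs hd using fun i => (d i).2
  refine ⟨k, fun i => (f i : PolyRing n g) • h i, s, fun i => smul_mem_traceRing (f i).2 (hh i),
    hs, ?_⟩
  rw [AddSubmonoidClass.coe_finsetSum]
  refine Finset.sum_congr rfl fun i _ => ?_
  rw [smul_mul_assoc, trace_smul, ← hd]
  rfl

/-- The preordering attached to a system of equations. -/
def tracePreordering (S : Set (MatP n g)) : Set (traceSubalgebra n g) :=
  {c | ∃ a b : traceSubalgebra n g,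
    (a : PolyRing n g) • (1 : MatP n g) ∈ OmegaSet n g ∧ b ∈ traceIdeal S ∧ c = a + b}

theorem isProperPreordering_tracePreordering (hn : 0 < n) {S : Set (MatP n g)}
    (h : ¬ HasCertificate n g S) : IsProperPreordering (tracePreordering S) where
  add := by
    rintro _ ⟨a, b, ha, hb, rfl⟩ _ ⟨a', b', ha', hb', rfl⟩
    refine ⟨a + a', b + b', ?_, add_mem hb hb', by ring⟩
    rw [omegaSet_eq_closure] at *
    rw [Subalgebra.coe_add, add_smul]
    exact add_mem ha ha'
  mul := by
    rintro _ ⟨a, b, ha, hb, rfl⟩ _ ⟨a', b', ha', hb', rfl⟩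
    refine ⟨a * a', (a + b) * b' + a' * b, ?_,
      add_mem (Ideal.mul_mem_left _ _ hb') (Ideal.mul_mem_left _ _ hb), by ring⟩
    rw [omegaSet_eq_closure] at *
    have h1 := mul_mem ha ha'
    rwa [smul_mul_smul_comm, mul_one] at h1
  sq a := by
    refine ⟨a * a, 0, ?_, zero_mem _, (add_zero _).symm⟩
    rw [omegaSet_eq_closure]
    refine Subsemiring.subset_closure ⟨(√(n : ℝ)⁻¹ • (a : PolyRing n g)) • 1,
      smul_one_mem_traceRing (Subalgebra.smul_mem _ a.2 _), ?_⟩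
    congr 1
    have h1 : √(n : ℝ)⁻¹ * √(n : ℝ)⁻¹ = (n : ℝ)⁻¹ := Real.mul_self_sqrt (by positivity)
    have hn' : (n : ℝ) ≠ 0 := by positivity
    rw [transpose_smul, transpose_one, smul_mul_smul_comm, mul_one, trace_smul, trace_one,
      smul_mul_smul_comm, h1, Fintype.card_fin, smul_eq_mul, mul_comm _ (n : PolyRing n g),
      ← nsmul_eq_mul, ← Nat.cast_smul_eq_nsmul ℝ, smul_smul, mul_inv_cancel₀ hn', one_smul]
    rfl
  neg_one := by
    rintro ⟨a, b, ha, hb, hab⟩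
    obtain ⟨k, h', s, hh, hs, hb'⟩ := exists_sum_of_mem_traceIdeal hb
    refine h ⟨_, ha, k, h', s, hh, hs, ?_⟩
    rw [← Finset.sum_smul, ← hb', ← add_smul, ← Subalgebra.coe_add, ← hab]
    simp

end TraceRing

section Certificate

variable {n g : ℕ} {S : Set (MatP n g)}

theorem eq_zero_of_trace_transpose_mul_self_eq_zero {R m : Type} [Field R] [LinearOrder R]
    [IsStrictOrderedRing R] [Fintype m] {M : Matrix m m R} (h : (Mᵀ * M).trace = 0) : M = 0 := by
  simp only [trace, diag_apply, mul_apply, transpose_apply] at h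
  rw [Finset.sum_eq_zero_iff_of_nonneg fun i _ => Finset.sum_nonneg fun j _ => mul_self_nonneg _]
    at h
  ext i j
  have h1 := h j (Finset.mem_univ _)
  rw [Finset.sum_eq_zero_iff_of_nonneg fun i _ => mul_self_nonneg _] at h1
  exact mul_self_eq_zero.1 (h1 i (Finset.mem_univ _))

/-- A homomorphism from the trace subalgebra to a real closed field that is nonnegative on the
traces `tr (h * hᵀ)` is evaluation at a point. -/
theorem exists_point_of_hom {R : Type} [Field R] [LinearOrder R] [IsStrictOrderedRing R]
    (hR : PolyIVT R) (φ : traceSubalgebra n g →+* R)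
    (hφ : ∀ (h : MatP n g) (hh : h ∈ traceRing n g),
      0 ≤ φ ⟨(h * hᵀ).trace,
        trace_mem_traceSubalgebra (mul_mem hh (transpose_mem_traceRing hh))⟩) :
    ∃ x : Fin g × Fin n × Fin n → R, ∀ c : traceSubalgebra n g,
      MvPolynomial.eval₂ (φ.comp (algebraMap ℝ (traceSubalgebra n g))) x c = φ c := by
  let t : Submonoid.closure (genSet n g) → traceSubalgebra n g := fun w =>
    ⟨(w : MatP n g).trace, Algebra.subset_adjoin (Set.mem_image_of_mem _ w.2)⟩
  let _ : Algebra ℚ (traceSubalgebra n g) :=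
    ((algebraMap ℝ (traceSubalgebra n g)).comp (algebraMap ℚ ℝ)).toAlgebra
  obtain ⟨ρ, hρ1, hρ2⟩ := hR.exists_rep_of_trace (W := Submonoid.closure (genSet n g))
    (P := PolyRing n g) (traceSubalgebra n g).val.toRingHom Subtype.val_injective φ
    (Submonoid.closure (genSet n g)).subtype (fun _ => rfl) t (fun _ => rfl) (by
      intro s c
      have hh : ∑ i ∈ s, (c i : PolyRing n g) • (i : MatP n g) ∈ traceRing n g :=
        sum_mem fun i _ => smul_mem_traceRing (c i).2 (closure_genSet_le_traceRing i.2)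
      refine (hφ _ hh).trans_eq (congrArg φ (Subtype.ext ?_))
      change ((∑ i ∈ s, (c i : PolyRing n g) • (i : MatP n g)) *
        (∑ i ∈ s, (c i : PolyRing n g) • (i : MatP n g))ᵀ).trace = _
      rw [transpose_sum, Finset.sum_mul_sum, trace_sum, AddSubmonoidClass.coe_finsetSum]
      refine Finset.sum_congr rfl fun i _ => ?_
      rw [trace_sum, AddSubmonoidClass.coe_finsetSum]
      refine Finset.sum_congr rfl fun j _ => ?_
      rw [transpose_smul, smul_mul_smul_comm, trace_smul]
      rfl)
  let x : Fin g × Fin n × Fin n → R := fun v =>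
    ρ ⟨genMat n g v.1, Submonoid.subset_closure (Or.inl ⟨v.1, rfl⟩)⟩ v.2.1 v.2.2
  let ev : PolyRing n g →+* R :=
    MvPolynomial.eval₂Hom (φ.comp (algebraMap ℝ (traceSubalgebra n g))) x
  have hgen : ∀ j, ev.mapMatrix (genMat n g j) =
      ρ ⟨genMat n g j, Submonoid.subset_closure (Or.inl ⟨j, rfl⟩)⟩ := by
    intro j
    ext a b
    exact MvPolynomial.eval₂Hom_X' _ _ _
  have hword : ∀ (w : MatP n g) (hw : w ∈ Submonoid.closure (genSet n g)),
      ev.mapMatrix w = ρ ⟨w, hw⟩ := by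
    intro w hw
    induction hw using Submonoid.closure_induction with
    | mem w hw =>
      rcases hw with ⟨j, rfl⟩ | ⟨j, rfl⟩
      · exact hgen j
      · have h1 := hρ1 ⟨genMat n g j, Submonoid.subset_closure (Or.inl ⟨j, rfl⟩)⟩
        rw [← hgen] at h1
        exact h1.symm
    | one => exact (map_one ev.mapMatrix).trans (map_one ρ).symm
    | mul v w hv hw h1 h2 => rw [map_mul, h1, h2, ← map_mul, MulMemClass.mk_mul_mk]
  refine ⟨x, fun ⟨c, hc⟩ => ?_⟩
  change ev c = _
  induction hc using Algebra.adjoin_induction with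
  | mem c hc =>
    obtain ⟨w, hw, rfl⟩ := hc
    rw [AddMonoidHom.map_trace]
    refine Eq.trans ?_ (hρ2 ⟨w, hw⟩)
    rw [← hword]
    rfl
  | algebraMap r => exact MvPolynomial.eval₂Hom_C _ _ _
  | add c d hc hd h1 h2 => rw [map_add, h1, h2, ← map_add]; rfl
  | mul c d hc hd h1 h2 => rw [map_mul, h1, h2, ← map_mul]; rfl

theorem exists_evalMat_eq_zero (hn : 0 < n) (hS : ∀ s ∈ S, s ∈ traceRing n g)
    (h : ¬ HasCertificate n g S) :
    ∃ A : Fin g → Matrix (Fin n) (Fin n) ℝ, ∀ s ∈ S, evalMat n g A s = 0 := by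
  obtain ⟨R, _, _, _, φ, hR, hφ⟩ :=
    exists_hom_to_polyIVT (isProperPreordering_tracePreordering hn h)
  have hφ0 : ∀ b ∈ traceIdeal S, φ b = 0 := by
    intro b hb
    have h0 : ((0 : traceSubalgebra n g) : PolyRing n g) • (1 : MatP n g) ∈ OmegaSet n g := by
      rw [omegaSet_eq_closure, Subalgebra.coe_zero, zero_smul]
      exact zero_mem _
    have h1 := hφ b ⟨0, b, h0, hb, (zero_add b).symm⟩
    have h2 := hφ (-b) ⟨0, -b, h0, neg_mem hb, (zero_add _).symm⟩
    rw [map_neg] at h2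
    linarith
  obtain ⟨x, hx⟩ := exists_point_of_hom hR φ fun h hh => hφ _ ⟨_, 0, by
    rw [omegaSet_eq_closure]
    exact Subsemiring.subset_closure ⟨h, hh, rfl⟩, zero_mem _, (add_zero _).symm⟩
  let ev : PolyRing n g →+* R :=
    MvPolynomial.eval₂Hom (φ.comp (algebraMap ℝ (traceSubalgebra n g))) x
  have hs : ∀ s ∈ S, s.map ev = 0 := by
    intro s hs
    apply eq_zero_of_trace_transpose_mul_self_eq_zero
    have hsT := transpose_mem_traceRing (hS s hs)
    rw [← transpose_map, ← Matrix.map_mul, ← AddMonoidHom.map_trace]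
    refine (hx ⟨_, trace_mem_traceSubalgebra (mul_mem hsT (hS s hs))⟩).trans (hφ0 _ ?_)
    exact Ideal.subset_span ⟨_, hsT, s, hs, rfl⟩
  obtain ⟨z, hz⟩ := hR.exists_real_zero _ x {p | ∃ s ∈ S, ∃ i j, p = s i j} (by
    rintro p ⟨s, hsS, i, j, rfl⟩
    exact congrFun (congrFun (hs s hsS) i) j)
  refine ⟨fun j => of fun a b => z (j, a, b), fun s hsS => ?_⟩
  ext i j
  exact hz _ ⟨s, hsS, i, j, rfl⟩

theorem HasCertificate.evalMat_ne_zero (hn : 0 < n) (h : HasCertificate n g S)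
    (A : Fin g → Matrix (Fin n) (Fin n) ℝ) : ∃ s ∈ S, evalMat n g A s ≠ 0 := by
  by_contra! hA
  obtain ⟨ω, hω, k, h, s, -, hs, hsum⟩ := h
  let ev : PolyRing n g →+* ℝ := MvPolynomial.eval fun v => A v.1 v.2.1 v.2.2
  have hev : ∀ s ∈ S, ev.mapMatrix s = 0 := hA
  have hsmul : ∀ p : PolyRing n g, ev.mapMatrix (p • (1 : MatP n g)) = ev p • 1 := by
    intro p
    rw [RingHom.mapMatrix_apply, Matrix.map_smul' _ _ _ (map_mul ev),
      Matrix.map_one _ (map_zero ev) (map_one ev)]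
  have hpos : ∃ r : ℝ, 0 ≤ r ∧ ev.mapMatrix ω = r • 1 := by
    clear hsum
    rw [omegaSet_eq_closure] at hω
    induction hω using Subsemiring.closure_induction with
    | mem x hx =>
      obtain ⟨h, -, rfl⟩ := hx
      refine ⟨_, ?_, hsmul _⟩
      simp only [trace, diag_apply, mul_apply, transpose_apply, map_sum, map_mul]
      exact Finset.sum_nonneg fun i _ => Finset.sum_nonneg fun j _ => mul_self_nonneg _
    | zero => exact ⟨0, le_rfl, by rw [map_zero, zero_smul]⟩
    | one => exact ⟨1, zero_le_one, by rw [map_one, one_smul]⟩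
    | add x y _ _ hx hy =>
      obtain ⟨r, hr, h1⟩ := hx
      obtain ⟨s, hs, h2⟩ := hy
      exact ⟨r + s, add_nonneg hr hs, by rw [map_add, h1, h2, add_smul]⟩
    | mul x y _ _ hx hy =>
      obtain ⟨r, hr, h1⟩ := hx
      obtain ⟨s, hs, h2⟩ := hy
      exact ⟨r * s, mul_nonneg hr hs, by rw [map_mul, h1, h2, smul_mul_smul_comm, mul_one]⟩
  obtain ⟨r, hr, h1⟩ := hpos
  have h2 := congrArg ev.mapMatrix hsum
  have h3 : ∀ i, ev.mapMatrix ((h i * s i).trace • (1 : MatP n g)) = 0 := by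
    intro i
    rw [hsmul, AddMonoidHom.map_trace]
    have h4 : (h i * s i).map ev = ev.mapMatrix (h i * s i) := rfl
    have h5 : ev.mapMatrix (h i * s i) = 0 := by rw [map_mul, hev _ (hs i), mul_zero]
    exact (congrArg (fun M : Matrix (Fin n) (Fin n) ℝ => M.trace • 1) (h4.trans h5)).trans
      (by rw [trace_zero, zero_smul])
  rw [map_add, map_sum, Finset.sum_eq_zero fun i _ => h3 i, add_zero, h1, map_neg, map_one] at h2
  have h6 := congrFun (congrFun h2 ⟨0, hn⟩) ⟨0, hn⟩
  simp at h6
  linarith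

end Certificate

/-- Infeasibility certificate for systems of equations over TT_n. -/
theorem stmt14 (n g : ℕ) (hn : 0 < n) (hg : 0 < g)
    (S : Set (MatP n g)) (hS : ∀ s ∈ S, s ∈ traceRing n g) :
    {A : Fin g → Matrix (Fin n) (Fin n) ℝ | ∀ s ∈ S, evalMat n g A s = 0} = ∅ ↔
      ∃ ω ∈ OmegaSet n g, ∃ (k : ℕ) (h : Fin k → MatP n g) (s : Fin k → MatP n g),
        (∀ i, h i ∈ traceRing n g) ∧ (∀ i, s i ∈ S) ∧
        (-1 : MatP n g) =
          ω + ∑ i, (Matrix.trace (h i * s i)) • (1 : MatP n g) := by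
  constructor
  · intro hempty
    by_contra hcert
    obtain ⟨A, hA⟩ := exists_evalMat_eq_zero hn hS hcert
    exact hempty.subset hA
  · intro hcert
    refine Set.eq_empty_of_forall_notMem fun A hA => ?_
    obtain ⟨s, hs, hne⟩ := HasCertificate.evalMat_ne_zero hn hcert A
    exact hne (hA s hs)
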